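/- Let n ≥ 2, R₀ > 0, c₀ ≥ 1, c₁ > 0, β > 2 and ε ∈ (0, 1/2). Let f_v be C³ on ℝⁿ ∖ B̄_{R₀} with 1/c₀ ≤ f_v(x) ≤ c₀ and |Dᵏ(f_v(x) − 1)| ≤ c₀|x|^{−β−k} for |x| > R₀ and k = 0, 1, 2, 3, and let v be a convex classical solution of det(D²v) = f_v on ℝⁿ ∖ B̄_{R₀} with |v(x) − ½|x|²| ≤ c₁|x|^{2−ε} for |x| ≥ R₀. Set w(x) = v(x) − ½|x|². Then there exists R₁ > R₀ depending only on (n, R₀, ε, c₀, c₁, β) such that: if n ≥ 3, |Dʲw(x)| ≤ C|x|^{2−2ε−j} for |x| > 2R₁ and j = 0, 1, 2, 3, 4, and |D⁴w(y₁) − D⁴w(y₂)|/|y₁−y₂|^α ≤ C|y₁|^{−2−2ε−α} for |y₁| > 2R₁, |y₂ − y₁| < |y₁|/2, α ∈ (0,1); if n = 2, the same estimates hold with 2ε replaced by any ε̄ with 0 < ε̄ < 2ε. -/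

import Mathlib

open Filter Bornology Matrix MeasureTheory
open scoped RealInnerProductSpace

noncomputable section

/-- `ℝⁿ` as a Euclidean space. -/
abbrev En (n : ℕ) := EuclideanSpace ℝ (Fin n)

/-- The Hessian matrix `D²u(x)` of `u : ℝⁿ → ℝ` at `x`. -/
def Hess {n : ℕ} (u : En n → ℝ) (x : En n) : Matrix (Fin n) (Fin n) ℝ :=
  Matrix.of fun i j =>
    iteratedFDeriv ℝ 2 u x ![EuclideanSpace.single i 1, EuclideanSpace.single j 1]

/-- Hypotheses of Proposition 2.1: `fv` is `C³` outside `B̄_{R₀}`, pinched between `1/c₀` and `c₀`,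
with `|Dᵏ(fv - 1)(x)| ≤ c₀ |x|^{-β-k}` for `k = 0,1,2,3`; `v` is a convex classical solution of
`det D²v = fv` outside `B̄_{R₀}`, with `|v(x) - |x|²/2| ≤ c₁ |x|^{2-ε}`. -/
def ExtHyp (n : ℕ) (R₀ c₀ c₁ β ε : ℝ) (fv v : En n → ℝ) : Prop :=
  ContDiffOn ℝ 3 fv {x : En n | R₀ < ‖x‖} ∧
  (∀ x : En n, R₀ < ‖x‖ → 1 / c₀ ≤ fv x ∧ fv x ≤ c₀) ∧
  (∀ k : ℕ, k ≤ 3 → ∀ x : En n, R₀ < ‖x‖ →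
      ‖iteratedFDeriv ℝ k (fun y => fv y - 1) x‖ ≤ c₀ * ‖x‖ ^ (-β - (k : ℝ))) ∧
  ContDiffOn ℝ (⊤ : ℕ∞) v {x : En n | R₀ < ‖x‖} ∧
  (∀ x : En n, R₀ < ‖x‖ → (Hess v x).PosSemidef ∧ (Hess v x).det = fv x) ∧
  (∀ x : En n, R₀ ≤ ‖x‖ → |v x - ‖x‖ ^ 2 / 2| ≤ c₁ * ‖x‖ ^ ((2 : ℝ) - ε))

open scoped ContDiff

/-- The derivative of `h` in the direction `a`. -/
def pd {n : ℕ} (a : En n) (h : En n → ℝ) : En n → ℝ := fun x => fderiv ℝ h x a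

/-- The standard basis vectors. -/
abbrev stdVec {n : ℕ} (i : Fin n) : En n := EuclideanSpace.single i 1

theorem pd_contDiff {n : ℕ} {h : En n → ℝ} (hh : ContDiff ℝ ∞ h) (a : En n) :
    ContDiff ℝ ∞ (pd a h) :=
  (hh.fderiv_right (m := ∞) (by norm_num)).clm_apply contDiff_const

theorem pd_comm {n : ℕ} {h : En n → ℝ} (hh : ContDiff ℝ ∞ h) (a b : En n) :
    pd a (pd b h) = pd b (pd a h) := by
  funext x
  have hd : DifferentiableAt ℝ (fderiv ℝ h) x :=
    ((hh.fderiv_right (m := ∞) (by norm_num)).differentiable (by norm_num)) x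
  have key : ∀ c d : En n, pd c (pd d h) x = fderiv ℝ (fderiv ℝ h) x c d := by
    intro c d
    have := (hd.hasFDerivAt.clm_apply (hasFDerivAt_const d x)).fderiv
    change fderiv ℝ (fun y => fderiv ℝ h y d) x c = _
    rw [this]
    simp
  rw [key, key]
  have hs : IsSymmSndFDerivAt ℝ h x :=
    (hh.contDiffAt).isSymmSndFDerivAt
      (by simpa using (WithTop.coe_le_coe.2 (le_top : (2 : ℕ∞) ≤ ⊤)))
  exact hs a b

theorem hasDerivAt_line {n : ℕ} {h : En n → ℝ} (hh : ContDiff ℝ ∞ h) (x a : En n) (t : ℝ) :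
    HasDerivAt (fun t : ℝ => h (x + t • a)) (pd a h (x + t • a)) t := by
  have h1 : HasFDerivAt h (fderiv ℝ h (x + t • a)) (x + t • a) :=
    (hh.differentiable (by norm_num) _).hasFDerivAt
  have h2 : HasDerivAt (fun t : ℝ => x + t • a) a t := by
    simpa using ((hasDerivAt_id t).smul_const a).const_add x
  exact h1.comp_hasDerivAt t h2

theorem pd_add {n : ℕ} {h k : En n → ℝ} (hh : ContDiff ℝ ∞ h) (hk : ContDiff ℝ ∞ k) (a : En n) :
    pd a (fun x => h x + k x) = fun x => pd a h x + pd a k x := by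
  funext x
  simp only [pd]
  rw [fderiv_fun_add (hh.differentiable (by norm_num) x) (hk.differentiable (by norm_num) x)]
  rfl

theorem pd_sub {n : ℕ} {h k : En n → ℝ} (hh : ContDiff ℝ ∞ h) (hk : ContDiff ℝ ∞ k) (a : En n) :
    pd a (fun x => h x - k x) = fun x => pd a h x - pd a k x := by
  funext x
  simp only [pd]
  rw [fderiv_fun_sub (hh.differentiable (by norm_num) x) (hk.differentiable (by norm_num) x)]
  rfl

theorem pd_mul {n : ℕ} {h k : En n → ℝ} (hh : ContDiff ℝ ∞ h) (hk : ContDiff ℝ ∞ k) (a : En n) :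
    pd a (fun x => h x * k x) = fun x => pd a h x * k x + h x * pd a k x := by
  funext x
  simp only [pd]
  rw [fderiv_fun_mul (hh.differentiable (by norm_num) x) (hk.differentiable (by norm_num) x)]
  simp; ring

theorem pd_const_mul {n : ℕ} {h : En n → ℝ} (hh : ContDiff ℝ ∞ h) (c : ℝ) (a : En n) :
    pd a (fun x => c * h x) = fun x => c * pd a h x := by
  funext x
  simp only [pd]
  rw [fderiv_const_mul (hh.differentiable (by norm_num) x)]
  rfl

theorem pd_sum {n : ℕ} {ι : Type*} (s : Finset ι) {h : ι → En n → ℝ}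
    (hh : ∀ i ∈ s, ContDiff ℝ ∞ (h i)) (a : En n) :
    pd a (fun x => ∑ i ∈ s, h i x) = fun x => ∑ i ∈ s, pd a (h i) x := by
  funext x
  simp only [pd]
  rw [fderiv_fun_sum (fun i hi => (hh i hi).differentiable (by norm_num) x)]
  simp

theorem pd_comp_affine {n : ℕ} {h : En n → ℝ} (hh : ContDiff ℝ ∞ h) (x₀ : En n) (r : ℝ) (a : En n) :
    pd a (fun y => h (x₀ + r • y)) = fun y => r * pd a h (x₀ + r • y) := by
  funext y
  have h1 : HasFDerivAt h (fderiv ℝ h (x₀ + r • y)) (x₀ + r • y) :=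
    (hh.differentiable (by norm_num) _).hasFDerivAt
  have h2 : HasFDerivAt (fun y : En n => x₀ + r • y) (r • ContinuousLinearMap.id ℝ (En n)) y :=
    ((hasFDerivAt_id y).const_smul r).const_add x₀
  have := (h1.comp y h2).fderiv
  simp only [pd]
  change fderiv ℝ (h ∘ fun y => x₀ + r • y) y a = _
  rw [this]
  simp

theorem contDiff_comp_affine {n : ℕ} {h : En n → ℝ} (hh : ContDiff ℝ ∞ h) (x₀ : En n) (r : ℝ) :
    ContDiff ℝ ∞ (fun y => h (x₀ + r • y)) :=
  hh.comp (contDiff_const.add (contDiff_id.const_smul r))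

theorem pd_congr_of_eventuallyEq {n : ℕ} {h k : En n → ℝ} {x : En n} (hk : h =ᶠ[nhds x] k)
    (a : En n) : pd a h =ᶠ[nhds x] pd a k := by
  filter_upwards [hk.eventuallyEq_nhds] with y hy
  simp only [pd, hy.fderiv_eq]

/-- Iterated derivatives along a list of directions. -/
def pds {n : ℕ} : List (En n) → (En n → ℝ) → (En n → ℝ)
  | [], h => h
  | a :: l, h => pd a (pds l h)

theorem iteratedFDeriv_apply_eq_pds {n : ℕ} {h : En n → ℝ} (hh : ContDiff ℝ ∞ h) (k : ℕ)
    (m : Fin k → En n) (x : En n) :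
    iteratedFDeriv ℝ k h x m = pds (List.ofFn m) h x := by
  induction k generalizing x with
  | zero => simp [pds]
  | succ k ih =>
    rw [iteratedFDeriv_succ_apply_left, List.ofFn_succ]
    simp only [pds, pd]
    have hd : DifferentiableAt ℝ (iteratedFDeriv ℝ k h) x :=
      (hh.differentiable_iteratedFDeriv (m := k) (by exact_mod_cast ENat.natCast_lt_top k)) x
    have hfun : pds (List.ofFn fun i => m i.succ) h
        = fun y => iteratedFDeriv ℝ k h y (Fin.tail m) := by
      funext y
      rw [ih]; rfl
    rw [hfun]
    have := hd.hasFDerivAt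
    have h3 := ((ContinuousMultilinearMap.apply ℝ (fun _ : Fin k => En n) ℝ
      (Fin.tail m)).hasFDerivAt.comp x this).fderiv
    have h4 : (fun y => iteratedFDeriv ℝ k h y (Fin.tail m)) =
      (ContinuousMultilinearMap.apply ℝ (fun _ : Fin k => En n) ℝ (Fin.tail m)) ∘
        iteratedFDeriv ℝ k h := rfl
    rw [h4, h3]
    rfl

/-- A multilinear form is controlled by its values on the standard basis. -/
theorem norm_multilinear_le_of_basis {n k : ℕ}
    (T : ContinuousMultilinearMap ℝ (fun _ : Fin k => En n) ℝ) {B : ℝ} (hB : 0 ≤ B)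
    (hT : ∀ I : Fin k → Fin n, |T fun j => stdVec (I j)| ≤ B) : ‖T‖ ≤ (n : ℝ) ^ k * B := by
  refine ContinuousMultilinearMap.opNorm_le_bound (by positivity) fun m => ?_
  have hm : m = fun j => ∑ i : Fin n, m j i • stdVec (n := n) i := by
    funext j
    have := (EuclideanSpace.basisFun (Fin n) ℝ).sum_repr (m j)
    simpa using this.symm
  have h1 : T m = ∑ I : Fin k → Fin n, (∏ j, m j (I j)) • T fun j => stdVec (I j) := by
    conv_lhs => rw [hm]
    rw [ContinuousMultilinearMap.map_sum]
    refine Finset.sum_congr rfl fun I _ => ?_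
    rw [ContinuousMultilinearMap.map_smul_univ]
  rw [h1]
  calc ‖∑ I : Fin k → Fin n, (∏ j, m j (I j)) • T fun j => stdVec (I j)‖
      ≤ ∑ I : Fin k → Fin n, (∏ j, ‖m j‖) * B := by
        refine norm_sum_le_of_le _ fun I _ => ?_
        rw [norm_smul, Real.norm_eq_abs, Finset.abs_prod, Real.norm_eq_abs]
        refine mul_le_mul ?_ (hT I) (abs_nonneg _) (by positivity)
        refine Finset.prod_le_prod (fun _ _ => abs_nonneg _) fun j _ => ?_
        simpa using PiLp.norm_apply_le (m j) (I j)
    _ = (n : ℝ) ^ k * B * ∏ j, ‖m j‖ := by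
        simp [Finset.card_univ]; ring

/-- The Laplacian. -/
def lap {n : ℕ} (h : En n → ℝ) : En n → ℝ :=
  fun x => ∑ i, pd (stdVec i) (pd (stdVec i) h) x

/-- The array of second derivatives. -/
def hes {n : ℕ} (h : En n → ℝ) (x : En n) : Fin n → Fin n → ℝ :=
  fun i j => pd (stdVec i) (pd (stdVec j) h) x

theorem lap_contDiff {n : ℕ} {h : En n → ℝ} (hh : ContDiff ℝ ∞ h) : ContDiff ℝ ∞ (lap h) :=
  ContDiff.sum fun _ _ => pd_contDiff (pd_contDiff hh _) _

theorem pd_lap {n : ℕ} {h : En n → ℝ} (hh : ContDiff ℝ ∞ h) (a : En n) :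
    pd a (lap h) = lap (pd a h) := by
  unfold lap
  rw [pd_sum _ fun _ _ => pd_contDiff (pd_contDiff hh _) _]
  funext x
  refine Finset.sum_congr rfl fun i _ => ?_
  rw [pd_comm (pd_contDiff hh _), pd_comm hh a]

theorem hes_contDiff {n : ℕ} {h : En n → ℝ} (hh : ContDiff ℝ ∞ h) : ContDiff ℝ ∞ (hes h) := by
  refine contDiff_pi.2 fun i => contDiff_pi.2 fun j => ?_
  exact pd_contDiff (pd_contDiff hh _) _

/-- A smooth kernel supported in the closed unit ball. -/
def Ker {n : ℕ} (κ : En n → ℝ) : Prop := ContDiff ℝ ∞ κ ∧ ∀ y, 1 < ‖y‖ → κ y = 0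

theorem Ker.dir {n : ℕ} {κ : En n → ℝ} (h : Ker κ) (a : En n) : Ker (pd a κ) := by
  refine ⟨pd_contDiff h.1 a, fun y hy => ?_⟩
  have h0 : κ =ᶠ[nhds y] fun _ => 0 := by
    filter_upwards [(isOpen_lt continuous_const continuous_norm).mem_nhds hy] with z hz
    exact h.2 z hz
  have := (pd_congr_of_eventuallyEq h0 a).self_of_nhds
  rw [this]; simp [pd]

theorem Ker.hasCompactSupport {n : ℕ} {κ : En n → ℝ} (h : Ker κ) : HasCompactSupport κ := by
  refine HasCompactSupport.of_support_subset_isCompact (isCompact_closedBall (0 : En n) 1) ?_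
  intro y hy
  by_contra hc
  exact hy (h.2 y (by simpa using hc))

theorem Ker.integrable_mul {n : ℕ} {κ : En n → ℝ} (h : Ker κ) {g : En n → ℝ}
    (hg : Continuous g) : Integrable fun y => κ y * g y :=
  (h.1.continuous.mul hg).integrable_of_hasCompactSupport h.hasCompactSupport.mul_right

theorem Ker.integrable_abs {n : ℕ} {κ : En n → ℝ} (h : Ker κ) : Integrable fun y => |κ y| :=
  (h.1.continuous.integrable_of_hasCompactSupport h.hasCompactSupport).abs

theorem Ker.integral_pd_mul {n : ℕ} {κ : En n → ℝ} (h : Ker κ) {g : En n → ℝ}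
    (hg : ContDiff ℝ ∞ g) (a : En n) :
    ∫ y, pd a κ y * g y = -∫ y, κ y * pd a g y := by
  have := integral_mul_fderiv_eq_neg_fderiv_mul_of_integrable (μ := volume) (𝕜 := ℝ)
    (f := κ) (g := g) (v := a)
    ((h.dir a).integrable_mul hg.continuous) (h.integrable_mul (pd_contDiff hg a).continuous)
    (h.integrable_mul hg.continuous)
    (fun x _ => h.1.differentiable (by norm_num) x)
    (fun x _ => hg.differentiable (by norm_num) x)
  change ∫ y, fderiv ℝ κ y a * g y = -∫ y, κ y * fderiv ℝ g y a
  rw [this]; simp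

/-- The average of `g` around `x` at scale `s` against the kernel `κ`. -/
def scaleAvg {n : ℕ} (κ g : En n → ℝ) (s : ℝ) (x : En n) : ℝ := ∫ y, κ y * g (x + s • y)

theorem hasDerivAt_integral_ker {n : ℕ} {κ : En n → ℝ} (h : Ker κ) {G G' : ℝ → En n → ℝ}
    (hG : ∀ t y, HasDerivAt (fun t => G t y) (G' t y) t)
    (hc : ∀ t, Continuous (G t)) (hc' : Continuous (Function.uncurry G')) (t₀ : ℝ) :
    HasDerivAt (fun t => ∫ y, κ y * G t y) (∫ y, κ y * G' t₀ y) t₀ := by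
  obtain ⟨B, hB⟩ := ((isCompact_Icc (a := t₀ - 1) (b := t₀ + 1)).prod
    (isCompact_closedBall (0 : En n) 1)).exists_bound_of_continuousOn hc'.continuousOn
  have hs : Set.Icc (t₀ - 1) (t₀ + 1) ∈ nhds t₀ := Icc_mem_nhds (by linarith) (by linarith)
  refine (hasDerivAt_integral_of_dominated_loc_of_deriv_le (μ := volume)
    (F := fun t y => κ y * G t y) (F' := fun t y => κ y * G' t y) (x₀ := t₀)
    (s := Set.Icc (t₀ - 1) (t₀ + 1)) (bound := fun y => |κ y| * B) hs ?_ ?_ ?_ ?_ ?_ ?_).2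
  · exact Eventually.of_forall fun t => (h.1.continuous.mul (hc t)).aestronglyMeasurable
  · exact h.integrable_mul (hc t₀)
  · exact (h.1.continuous.mul (hc'.comp (continuous_const.prodMk continuous_id))).aestronglyMeasurable
  · refine Eventually.of_forall fun y t ht => ?_
    rw [norm_mul, Real.norm_eq_abs]
    by_cases hy : ‖y‖ ≤ 1
    · exact mul_le_mul_of_nonneg_left (hB (t, y) ⟨ht, by simpa using hy⟩) (abs_nonneg _)
    · simp [h.2 y (not_le.1 hy)]
  · exact h.integrable_abs.mul_const B
  · exact Eventually.of_forall fun y t _ => (hG t y).const_mul _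

theorem Ker.abs_integral_le {n : ℕ} {κ : En n → ℝ} (h : Ker κ) {k : En n → ℝ} {B : ℝ}
    (hB : ∀ y, ‖y‖ ≤ 1 → |k y| ≤ B) : |∫ y, κ y * k y| ≤ (∫ y, |κ y|) * B := by
  rw [← integral_mul_const]
  refine norm_integral_le_of_norm_le (f := fun y => κ y * k y) (h.integrable_abs.mul_const B) (Eventually.of_forall fun y => ?_)
  rw [norm_mul, Real.norm_eq_abs, Real.norm_eq_abs]
  by_cases hy : ‖y‖ ≤ 1
  · exact mul_le_mul_of_nonneg_left (hB y hy) (abs_nonneg _)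
  · simp [h.2 y (not_le.1 hy)]

theorem Ker.abs_scaleAvg_le_osc {n : ℕ} {κ : En n → ℝ} (h : Ker κ) (h0 : ∫ y, κ y = 0)
    {g : En n → ℝ} (hg : Continuous g) {s B : ℝ} {x : En n}
    (hB : ∀ y, ‖y‖ ≤ 1 → |g (x + s • y) - g x| ≤ B) :
    |scaleAvg κ g s x| ≤ (∫ y, |κ y|) * B := by
  have : scaleAvg κ g s x = ∫ y, κ y * (g (x + s • y) - g x) := by
    simp_rw [mul_sub]
    rw [integral_sub (h.integrable_mul (by fun_prop)) (h.integrable_mul continuous_const),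
      integral_mul_const, h0]
    simp [scaleAvg]
  rw [this]
  exact h.abs_integral_le hB

theorem Ker.integral_pd {n : ℕ} {κ : En n → ℝ} (h : Ker κ) (a : En n) : ∫ y, pd a κ y = 0 := by
  have := h.integral_pd_mul (g := fun _ => 1) contDiff_const a
  simpa [pd] using this

theorem Ker.scaleAvg_pd {n : ℕ} {κ : En n → ℝ} (h : Ker κ) {g : En n → ℝ}
    (hg : ContDiff ℝ ∞ g) (a : En n) (s : ℝ) (x : En n) :
    scaleAvg (pd a κ) g s x = -(s * scaleAvg κ (pd a g) s x) := by
  unfold scaleAvg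
  rw [h.integral_pd_mul (contDiff_comp_affine hg x s), pd_comp_affine hg, ← integral_const_mul]
  congr 1
  exact integral_congr_ae (Eventually.of_forall fun y => by simp only []; ring)

theorem Ker.hasDerivAt_scaleAvg_line {n : ℕ} {κ : En n → ℝ} (h : Ker κ) {g : En n → ℝ}
    (hg : ContDiff ℝ ∞ g) (a x : En n) (s t : ℝ) :
    HasDerivAt (fun t : ℝ => scaleAvg κ g s (x + t • a))
      (scaleAvg κ (pd a g) s (x + t • a)) t := by
  have hp := (pd_contDiff hg a).continuous
  have hgc := hg.continuous
  refine hasDerivAt_integral_ker h (G := fun t y => g (x + t • a + s • y))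
    (G' := fun t y => pd a g (x + t • a + s • y)) (fun t y => ?_) (fun t => by fun_prop) ?_ t
  · have := hasDerivAt_line hg (x + s • y) a t
    have e : ∀ t : ℝ, x + s • y + t • a = x + t • a + s • y := fun t => by abel
    simpa only [e] using this
  · exact hp.comp (by fun_prop)

theorem continuous_scaleAvg {n : ℕ} {κ : En n → ℝ} (h : Ker κ) {g : En n → ℝ}
    (hg : ContDiff ℝ ∞ g) (x : En n) : Continuous fun s => scaleAvg κ g s x := by
  have hd : ∀ s, HasDerivAt (fun s => scaleAvg κ g s x)
      (∫ y, κ y * fderiv ℝ g (x + s • y) y) s := by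
    refine hasDerivAt_integral_ker h (G := fun s y => g (x + s • y))
      (G' := fun s y => fderiv ℝ g (x + s • y) y) (fun t y => hasDerivAt_line hg x y t)
      (fun t => hg.continuous.comp (by fun_prop)) ?_
    exact (((hg.continuous_fderiv (by norm_num)).comp (by fun_prop)).clm_apply continuous_snd)
  exact continuous_iff_continuousAt.2 fun s => (hd s).continuousAt

/-- A pair of kernels with `∇ψ = -yφ` and `∫ φ = 1`. -/
structure KerPair (n : ℕ) where
  /-- the averaging kernel -/
  φ : En n → ℝ
  /-- its potential -/
  ψ : En n → ℝ
  kφ : Ker φ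
  kψ : Ker ψ
  grad : ∀ i y, pd (stdVec i) ψ y = -(y i * φ y)
  mass : ∫ y, φ y = 1

theorem exists_kerPair {n : ℕ} (hn : 0 < n) : Nonempty (KerPair n) := by
  let P : ℝ → ℝ := fun r => Real.smoothTransition (2 - 4 * r)
  have hP : ContDiff ℝ ∞ P := Real.smoothTransition.contDiff.comp
    (contDiff_const.sub (contDiff_const.mul contDiff_id))
  have hP' : ContDiff ℝ ∞ (deriv P) := ((contDiff_infty_iff_deriv (f := P)).1 hP).2
  have hP0 : ∀ r, 1/2 ≤ r → P r = 0 := fun r hr =>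
    Real.smoothTransition.zero_of_nonpos (by linarith)
  have hP'0 : ∀ r, 1 < r → deriv P r = 0 := fun r hr => by
    have : P =ᶠ[nhds r] fun _ => 0 := by
      filter_upwards [lt_mem_nhds hr] with z hz
      exact hP0 z (by linarith)
    rw [this.deriv_eq]; simp
  have hmono : Antitone P := fun a b hab => Real.smoothTransition.monotone (by linarith)
  have hP'np : ∀ r, deriv P r ≤ 0 := fun r => hmono.deriv_nonpos
  let φ₀ : En n → ℝ := fun y => -2 * deriv P (‖y‖ ^ 2)
  let ψ₀ : En n → ℝ := fun y => P (‖y‖ ^ 2)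
  have hns : ContDiff ℝ ∞ fun y : En n => ‖y‖ ^ 2 := contDiff_norm_sq ℝ
  have kφ : Ker φ₀ := by
    refine ⟨contDiff_const.mul (hP'.comp hns), fun y hy => ?_⟩
    have : deriv P (‖y‖ ^ 2) = 0 := hP'0 _ (by nlinarith)
    simp [φ₀, this]
  have kψ : Ker ψ₀ := ⟨hP.comp hns, fun y hy => hP0 _ (by nlinarith)⟩
  have grad : ∀ i y, pd (stdVec i) ψ₀ y = -(y i * φ₀ y) := by
    intro i y
    have h1 : HasFDerivAt (fun y : En n => ‖y‖ ^ 2) (2 • innerSL ℝ y) y :=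
      (hasStrictFDerivAt_norm_sq y).hasFDerivAt
    have h2 : HasDerivAt P (deriv P (‖y‖ ^ 2)) (‖y‖ ^ 2) :=
      (hP.differentiable (by norm_num) _).hasDerivAt
    have h3 := (h2.comp_hasFDerivAt y h1).fderiv
    change fderiv ℝ (P ∘ fun y : En n => ‖y‖ ^ 2) y (stdVec i) = _
    rw [h3]
    simp [φ₀, EuclideanSpace.inner_single_right]
    ring
  have hpos : 0 < ∫ y, φ₀ y := by
    have hnn : 0 ≤ φ₀ := fun y => by
      have := hP'np (‖y‖ ^ 2)
      simp only [φ₀, Pi.zero_apply]; linarith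
    by_contra hcon
    have hne : φ₀ ≠ 0 := by
      intro h0
      have hz : ∀ r, 0 ≤ r → deriv P r = 0 := by
        intro r hr
        have := congrFun h0 (EuclideanSpace.single ⟨0, hn⟩ (Real.sqrt r))
        simpa [φ₀, Real.sq_sqrt hr] using this
      have : P 0 = P 1 := by
        obtain ⟨c, hc, hc'⟩ := exists_deriv_eq_slope P (zero_lt_one)
          hP.continuous.continuousOn (hP.differentiable (by norm_num)).differentiableOn
        rw [hz c hc.1.le] at hc'
        have : P 1 - P 0 = 0 := by simpa using hc'.symm
        linarith
      rw [hP0 1 (by norm_num)] at this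
      have h1 : P 0 = 1 := Real.smoothTransition.one_of_one_le (by norm_num)
      rw [h1] at this; norm_num at this
    obtain ⟨z, hz⟩ := Function.ne_iff.1 hne
    exact hcon (kφ.1.continuous.integral_pos_of_hasCompactSupport_nonneg_nonzero
      kφ.hasCompactSupport hnn hz)
  set m := ∫ y, φ₀ y with hm
  refine ⟨⟨fun y => m⁻¹ * φ₀ y, fun y => m⁻¹ * ψ₀ y, ?_, ?_, ?_, ?_⟩⟩
  · exact ⟨contDiff_const.mul kφ.1, fun y hy => by simp [kφ.2 y hy]⟩
  · exact ⟨contDiff_const.mul kψ.1, fun y hy => by simp [kψ.2 y hy]⟩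
  · intro i y
    rw [pd_const_mul kψ.1]
    simp only [grad i y]; ring
  · rw [integral_const_mul, ← hm]
    exact inv_mul_cancel₀ hpos.ne'

theorem KerPair.representation {n : ℕ} (p : KerPair n) {k : En n → ℝ} (hk : ContDiff ℝ ∞ k)
    (x : En n) (S : ℝ) :
    k x = scaleAvg p.φ k S x - ∫ s in (0 : ℝ)..S, s * scaleAvg p.ψ (lap k) s x := by
  have hd : ∀ s, HasDerivAt (fun s => scaleAvg p.φ k s x) (s * scaleAvg p.ψ (lap k) s x) s := by
    intro s
    have h1 : HasDerivAt (fun s => scaleAvg p.φ k s x)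
        (∫ y, p.φ y * fderiv ℝ k (x + s • y) y) s := by
      refine hasDerivAt_integral_ker p.kφ (G := fun s y => k (x + s • y))
        (G' := fun s y => fderiv ℝ k (x + s • y) y) (fun t y => hasDerivAt_line hk x y t)
        (fun t => hk.continuous.comp (by fun_prop)) ?_ s
      exact (((hk.continuous_fderiv (by norm_num)).comp (by fun_prop)).clm_apply continuous_snd)
    convert h1 using 1
    have hpc : ∀ i : Fin n, ContDiff ℝ ∞ (pd (stdVec i) k) := fun i => pd_contDiff hk _
    have h2 : ∀ y, p.φ y * fderiv ℝ k (x + s • y) y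
        = ∑ i, -(pd (stdVec i) p.ψ y * pd (stdVec i) k (x + s • y)) := by
      intro y
      have hy : y = ∑ i : Fin n, y i • stdVec (n := n) i := by
        have := (EuclideanSpace.basisFun (Fin n) ℝ).sum_repr y
        simpa using this.symm
      conv_lhs => rw [hy]
      rw [map_sum, Finset.mul_sum]
      refine Finset.sum_congr rfl fun i _ => ?_
      rw [p.grad, ← hy, map_smul, smul_eq_mul]
      simp only [pd]; ring
    simp_rw [h2]
    rw [integral_finsetSum]
    swap
    · intro i _
      exact ((p.kψ.dir _).integrable_mul
        ((hpc i).continuous.comp (by fun_prop : Continuous fun y : En n => x + s • y))).neg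
    have h3 : ∀ i : Fin n, ∫ y, -(pd (stdVec i) p.ψ y * pd (stdVec i) k (x + s • y))
        = s * scaleAvg p.ψ (pd (stdVec i) (pd (stdVec i) k)) s x := by
      intro i
      rw [integral_neg]
      change -(scaleAvg (pd (stdVec i) p.ψ) (pd (stdVec i) k) s x) = _
      rw [p.kψ.scaleAvg_pd (hpc i)]; ring
    simp_rw [h3]
    rw [← Finset.mul_sum]
    congr 1
    simp only [scaleAvg, lap, Finset.mul_sum]
    rw [integral_finsetSum]
    intro i _
    exact p.kψ.integrable_mul ((pd_contDiff (hpc i) _).continuous.comp (by fun_prop))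
  have hcont : Continuous fun s => s * scaleAvg p.ψ (lap k) s x :=
    continuous_id.mul (continuous_scaleAvg p.kψ (lap_contDiff hk) x)
  have := intervalIntegral.integral_eq_sub_of_hasDerivAt (a := 0) (b := S) (fun s _ => hd s)
    (hcont.intervalIntegrable _ _)
  rw [this]
  simp [scaleAvg, integral_mul_const, p.mass]

theorem Ker.scaleAvg_pd_pd {n : ℕ} {κ : En n → ℝ} (h : Ker κ) {g : En n → ℝ}
    (hg : ContDiff ℝ ∞ g) (a b : En n) (s : ℝ) (x : En n) :
    scaleAvg (pd a (pd b κ)) g s x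
      = s ^ 2 * scaleAvg κ (pd a (pd b g)) s x := by
  rw [(h.dir b).scaleAvg_pd hg, h.scaleAvg_pd (pd_contDiff hg a), pd_comm hg]; ring

/-- The scale density in the representation of a second derivative. -/
def KerPair.density {n : ℕ} (p : KerPair n) (h : En n → ℝ) (a b x : En n) (s : ℝ) : ℝ :=
  s * scaleAvg p.ψ (lap (pd a (pd b h))) s x

theorem KerPair.continuous_density {n : ℕ} (p : KerPair n) {h : En n → ℝ} (hh : ContDiff ℝ ∞ h)
    (a b x : En n) : Continuous (p.density h a b x) :=
  continuous_id.mul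
    (continuous_scaleAvg p.kψ (lap_contDiff (pd_contDiff (pd_contDiff hh b) a)) x)

theorem KerPair.density_eq {n : ℕ} (p : KerPair n) {h : En n → ℝ} (hh : ContDiff ℝ ∞ h)
    (a b x : En n) {s : ℝ} (hs : s ≠ 0) :
    p.density h a b x s = s⁻¹ * scaleAvg (pd a (pd b p.ψ)) (lap h) s x := by
  rw [KerPair.density, p.kψ.scaleAvg_pd_pd (lap_contDiff hh), ← pd_lap (pd_contDiff hh b),
    ← pd_lap hh]
  field_simp

theorem KerPair.hessian_representation {n : ℕ} (p : KerPair n) {h : En n → ℝ}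
    (hh : ContDiff ℝ ∞ h) (a b x : En n) {S : ℝ} (hS : 0 < S) :
    pd a (pd b h) x = (S ^ 2)⁻¹ * scaleAvg (pd a (pd b p.φ)) h S x
      - ∫ s in (0 : ℝ)..S, p.density h a b x s := by
  rw [p.representation (pd_contDiff (pd_contDiff hh b) a) x S, p.kφ.scaleAvg_pd_pd hh]
  congr 1
  field_simp

theorem pd_eq_sum_stdVec {n : ℕ} (h : En n → ℝ) (e y : En n) :
    pd e h y = ∑ i, e i * pd (stdVec i) h y := by
  have he : e = ∑ i : Fin n, e i • stdVec (n := n) i := by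
    have := (EuclideanSpace.basisFun (Fin n) ℝ).sum_repr e
    simpa using this.symm
  conv_lhs => rw [he]
  simp [pd, map_sum]

/-- The total mass of the first derivatives of a kernel. -/
def dirMass {n : ℕ} (κ : En n → ℝ) : ℝ := ∑ i : Fin n, ∫ y, |pd (stdVec i) κ y|

theorem dirMass_nonneg {n : ℕ} (κ : En n → ℝ) : 0 ≤ dirMass κ :=
  Finset.sum_nonneg fun _ _ => integral_nonneg fun _ => abs_nonneg _

theorem Ker.integral_abs_pd_le {n : ℕ} {κ : En n → ℝ} (h : Ker κ) (e : En n) :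
    ∫ y, |pd e κ y| ≤ ‖e‖ * dirMass κ := by
  rw [dirMass, Finset.mul_sum]
  simp_rw [← integral_const_mul]
  rw [← integral_finsetSum _ fun i _ => (h.dir (stdVec i)).integrable_abs.const_mul _]
  refine integral_mono (h.dir e).integrable_abs
    (integrable_finsetSum _ fun i _ => (h.dir (stdVec i)).integrable_abs.const_mul _) fun y => ?_
  simp only []
  rw [pd_eq_sum_stdVec]
  refine (Finset.abs_sum_le_sum_abs _ _).trans (Finset.sum_le_sum fun i _ => ?_)
  rw [abs_mul]
  exact mul_le_mul_of_nonneg_right (by simpa using PiLp.norm_apply_le e i) (abs_nonneg _)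

theorem Ker.abs_scaleAvg_sub_le {n : ℕ} {κ : En n → ℝ} (h : Ker κ) {g : En n → ℝ}
    (hg : ContDiff ℝ ∞ g) {s B : ℝ} (hs : 0 < s) (hB0 : 0 ≤ B) {x x' : En n}
    (hB : ∀ t ∈ Set.Icc (0 : ℝ) 1, ∀ e : En n,
      |scaleAvg (pd e κ) g s (x' + t • (x - x'))| ≤ (∫ y, |pd e κ y|) * B) :
    |scaleAvg κ g s x - scaleAvg κ g s x'| ≤ dirMass κ * B * (‖x - x'‖ / s) := by
  have hd := fun t => h.hasDerivAt_scaleAvg_line hg (x - x') x' s t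
  have hbound : ∀ t ∈ Set.Icc (0 : ℝ) 1, ‖scaleAvg κ (pd (x - x') g) s (x' + t • (x - x'))‖
      ≤ dirMass κ * B * (‖x - x'‖ / s) := by
    intro t ht
    have h1 := hB t ht (x - x')
    rw [h.scaleAvg_pd hg, abs_neg, abs_mul, abs_of_pos hs] at h1
    have h2 := h1.trans (mul_le_mul_of_nonneg_right (h.integral_abs_pd_le (x - x')) hB0)
    rw [Real.norm_eq_abs, ← mul_div_assoc, le_div_iff₀ hs]
    linarith
  have := Convex.norm_image_sub_le_of_norm_hasDerivWithin_le (s := Set.Icc (0 : ℝ) 1)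
    (fun t _ => (hd t).hasDerivWithinAt) hbound (convex_Icc 0 1)
    (Set.left_mem_Icc.2 zero_le_one) (Set.right_mem_Icc.2 zero_le_one)
  simpa using this

theorem integral_rpow_sub_one {α d : ℝ} (hα : 0 < α) :
    ∫ s in (0 : ℝ)..d, s ^ (α - 1) = d ^ α / α := by
  rw [integral_rpow (Or.inl (by linarith))]
  simp [Real.zero_rpow hα.ne']

theorem intervalIntegrable_rpow_sub_one {α d : ℝ} (hα : 0 < α) :
    IntervalIntegrable (fun s : ℝ => s ^ (α - 1)) volume 0 d :=
  intervalIntegral.intervalIntegrable_rpow' (by linarith)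

theorem norm_add_smul_sub_le {n : ℕ} {x x₀ y : En n} {s r₁ r₂ : ℝ} (hx : ‖x - x₀‖ ≤ r₁)
    (hs : 0 ≤ s) (hsr : s ≤ r₂) (hy : ‖y‖ ≤ 1) : ‖x + s • y - x₀‖ ≤ r₁ + r₂ := by
  have : x + s • y - x₀ = (x - x₀) + s • y := by abel
  rw [this]
  refine (norm_add_le _ _).trans (add_le_add hx ?_)
  rw [norm_smul, Real.norm_of_nonneg hs]
  nlinarith [norm_nonneg y]

set_option maxHeartbeats 1000000 in
theorem KerPair.schauder_component {n : ℕ} (p : KerPair n) {α : ℝ} (hα : 0 < α) (hα1 : α < 1)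
    (a b : En n) : ∃ C > 0, ∀ h : En n → ℝ, ContDiff ℝ ∞ h → ∀ (x₀ : En n) (S M A : ℝ), 0 < S →
      0 ≤ M → 0 ≤ A → (∀ z, ‖z - x₀‖ ≤ 2 * S → |h z| ≤ M) →
      (∀ z z', ‖z - x₀‖ ≤ 2 * S → ‖z' - x₀‖ ≤ 2 * S →
        |lap h z - lap h z'| ≤ A * ‖z - z'‖ ^ α) →
      (∀ x, ‖x - x₀‖ ≤ S → |pd a (pd b h) x| ≤ C * (A + M / S ^ (2 + α)) * S ^ α) ∧
      ∀ x x', ‖x - x₀‖ ≤ S → ‖x' - x₀‖ ≤ S →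
        |pd a (pd b h) x - pd a (pd b h) x'| ≤ C * (A + M / S ^ (2 + α)) * ‖x - x'‖ ^ α := by
  set χ := pd a (pd b p.φ) with hχ
  set κ := pd a (pd b p.ψ) with hκ
  have kχ : Ker χ := (p.kφ.dir b).dir a
  have kκ : Ker κ := (p.kψ.dir b).dir a
  set c₁ := ∫ y, |χ y| with hc₁
  set c₂ := ∫ y, |κ y| with hc₂
  have c₁0 : 0 ≤ c₁ := integral_nonneg fun _ => abs_nonneg _
  have c₂0 : 0 ≤ c₂ := integral_nonneg fun _ => abs_nonneg _
  have d₁0 := dirMass_nonneg χ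
  have d₂0 := dirMass_nonneg κ
  set C₁ := c₁ + c₂ / α with hC₁
  set C₂ := dirMass χ + 2 * c₂ / α + dirMass κ / (1 - α) with hC₂
  have h1α : 0 < 1 - α := by linarith
  have C₁0 : 0 ≤ C₁ := by positivity
  have C₂0 : 0 ≤ C₂ := by positivity
  refine ⟨2 * C₁ + C₂ + 1, by positivity, ?_⟩
  intro h hh x₀ S M A hS hM hA hhM hlap
  have hpS : S ^ (2 + α) = S ^ 2 * S ^ α := by
    rw [Real.rpow_add hS]; norm_num
  have hSα : 0 < S ^ α := Real.rpow_pos_of_pos hS _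
  set D := A + M / S ^ (2 + α) with hD
  have hD0 : 0 ≤ D := by positivity
  have hAD : A ≤ D := by rw [hD]; linarith [show 0 ≤ M / S ^ (2 + α) by positivity]
  have hMD : M / S ^ 2 ≤ D * S ^ α := by
    rw [hD, add_mul, hpS]
    have : M / (S ^ 2 * S ^ α) * S ^ α = M / S ^ 2 := by field_simp
    rw [this]
    linarith [mul_nonneg hA hSα.le]
  have hosc : ∀ z, ‖z - x₀‖ ≤ S → ∀ s, 0 < s → s ≤ S → ∀ y : En n, ‖y‖ ≤ 1 →
      |lap h (z + s • y) - lap h z| ≤ A * s ^ α := by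
    intro z hz s hs hsS y hy
    have h1 := hlap (z + s • y) z (by
      have := norm_add_smul_sub_le hz hs.le hsS hy; linarith) (by linarith)
    refine h1.trans (mul_le_mul_of_nonneg_left ?_ hA)
    refine Real.rpow_le_rpow (norm_nonneg _) ?_ hα.le
    rw [add_sub_cancel_left, norm_smul, Real.norm_of_nonneg hs.le]
    nlinarith [norm_nonneg y]
  have hcut : ∀ z, ‖z - x₀‖ ≤ S → ∀ y : En n, ‖y‖ ≤ 1 → |h (z + S • y)| ≤ M := by
    intro z hz y hy
    exact hhM _ (by have := norm_add_smul_sub_le hz hS.le le_rfl hy; linarith)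
  have hdens : ∀ z, ‖z - x₀‖ ≤ S → ∀ s, 0 < s → s ≤ S →
      |p.density h a b z s| ≤ c₂ * A * s ^ (α - 1) := by
    intro z hz s hs hsS
    rw [p.density_eq hh _ _ _ hs.ne', abs_mul, abs_of_pos (inv_pos.2 hs), Real.rpow_sub_one hs.ne']
    have := kκ.abs_scaleAvg_le_osc ((p.kψ.dir b).integral_pd a) (lap_contDiff hh).continuous
      (hosc z hz s hs hsS)
    calc s⁻¹ * |scaleAvg κ (lap h) s z| ≤ s⁻¹ * (c₂ * (A * s ^ α)) :=
          mul_le_mul_of_nonneg_left this (inv_pos.2 hs).le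
      _ = _ := by field_simp
  have hint : ∀ z, ‖z - x₀‖ ≤ S → ∀ d, 0 ≤ d → d ≤ S →
      |∫ s in (0 : ℝ)..d, p.density h a b z s| ≤ c₂ * A * (d ^ α / α) := by
    intro z hz d hd hdS
    rw [← integral_rpow_sub_one hα, ← intervalIntegral.integral_const_mul, ← Real.norm_eq_abs]
    refine intervalIntegral.norm_integral_le_of_norm_le hd (Eventually.of_forall fun s hs => ?_)
      ((intervalIntegrable_rpow_sub_one hα).const_mul _)
    exact hdens z hz s hs.1 (hs.2.trans hdS)
  have hsup : ∀ x, ‖x - x₀‖ ≤ S → |pd a (pd b h) x| ≤ C₁ * D * S ^ α := by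
    intro x hx
    rw [p.hessian_representation hh a b x hS]
    refine (abs_sub _ _).trans ?_
    have h1 : |(S ^ 2)⁻¹ * scaleAvg χ h S x| ≤ c₁ * (D * S ^ α) := by
      rw [abs_mul, abs_of_pos (by positivity)]
      calc (S ^ 2)⁻¹ * |scaleAvg χ h S x| ≤ (S ^ 2)⁻¹ * (c₁ * M) :=
            mul_le_mul_of_nonneg_left (kχ.abs_integral_le (hcut x hx)) (by positivity)
        _ = c₁ * (M / S ^ 2) := by ring
        _ ≤ _ := mul_le_mul_of_nonneg_left hMD c₁0
    have h2 : c₂ * A * (S ^ α / α) ≤ c₂ * D * (S ^ α / α) := by gcongr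
    calc _ ≤ c₁ * (D * S ^ α) + c₂ * D * (S ^ α / α) :=
          add_le_add h1 ((hint x hx S hS.le le_rfl).trans h2)
      _ = _ := by rw [hC₁]; ring
  refine ⟨fun x hx => (hsup x hx).trans ?_, ?_⟩
  · have : 0 ≤ D * S ^ α := by positivity
    nlinarith
  intro x x' hx hx'
  set d := ‖x - x'‖ with hd
  have hd0 : 0 ≤ d := norm_nonneg _
  rcases le_or_gt S d with hSd | hdS
  · have h1 := hsup x hx
    have h2 := hsup x' hx'
    have h3 : S ^ α ≤ d ^ α := Real.rpow_le_rpow hS.le hSd hα.le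
    have h4 : 0 ≤ D * d ^ α := by positivity
    calc |pd a (pd b h) x - pd a (pd b h) x'| ≤ C₁ * D * S ^ α + C₁ * D * S ^ α :=
          (abs_sub _ _).trans (add_le_add h1 h2)
      _ ≤ C₁ * D * d ^ α + C₁ * D * d ^ α := by gcongr
      _ ≤ _ := by nlinarith
  rcases hd0.eq_or_lt with hd00 | hdpos
  · have : x = x' := sub_eq_zero.1 (norm_eq_zero.1 hd00.symm)
    rw [this, sub_self, abs_zero]
    positivity
  have hseg : ∀ t ∈ Set.Icc (0 : ℝ) 1, ‖x' + t • (x - x') - x₀‖ ≤ S := by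
    intro t ht
    have h1 := (convex_closedBall x₀ S).add_smul_sub_mem (x := x') (y := x)
      (by simpa [dist_eq_norm] using hx') (by simpa [dist_eq_norm] using hx) ht
    simpa [dist_eq_norm] using h1
  rw [p.hessian_representation hh a b x hS, p.hessian_representation hh a b x' hS]
  have hI : ∀ z u v, IntervalIntegrable (p.density h a b z) volume u v := fun z u v =>
    (p.continuous_density hh a b z).intervalIntegrable u v
  rw [← intervalIntegral.integral_add_adjacent_intervals (hI x 0 d) (hI x d S),
    ← intervalIntegral.integral_add_adjacent_intervals (hI x' 0 d) (hI x' d S)]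
  have hT1 : |(S ^ 2)⁻¹ * scaleAvg χ h S x - (S ^ 2)⁻¹ * scaleAvg χ h S x'|
      ≤ dirMass χ * D * d ^ α := by
    rw [← mul_sub, abs_mul, abs_of_pos (by positivity)]
    have h1 := kχ.abs_scaleAvg_sub_le hh hS hM (x := x) (x' := x')
      fun t ht e => (kχ.dir e).abs_integral_le (hcut _ (hseg t ht))
    have h2 : d / S ≤ d ^ α / S ^ α := by
      rw [← Real.div_rpow hd0 hS.le]
      have hq : d / S ≤ 1 := (div_le_one hS).2 hdS.le
      have hq0 : 0 < d / S := by positivity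
      calc d / S = (d / S) ^ (1 : ℝ) := (Real.rpow_one _).symm
        _ ≤ _ := Real.rpow_le_rpow_of_exponent_ge hq0 hq hα1.le
    calc (S ^ 2)⁻¹ * |scaleAvg χ h S x - scaleAvg χ h S x'|
        ≤ (S ^ 2)⁻¹ * (dirMass χ * M * (d ^ α / S ^ α)) := by
          refine mul_le_mul_of_nonneg_left (h1.trans ?_) (by positivity)
          exact mul_le_mul_of_nonneg_left h2 (by positivity)
      _ = dirMass χ * (M / S ^ 2 / S ^ α) * d ^ α := by field_simp
      _ ≤ _ := by
          gcongr
          rw [div_le_iff₀ hSα]; exact hMD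
  have hT2 : |(∫ s in d..S, p.density h a b x s) - ∫ s in d..S, p.density h a b x' s|
      ≤ dirMass κ / (1 - α) * D * d ^ α := by
    rw [← intervalIntegral.integral_sub (hI _ _ _) (hI _ _ _)]
    have hnot : (0 : ℝ) ∉ Set.uIcc d S := by
      rw [Set.uIcc_of_le hdS.le]; exact fun h => absurd h.1 (not_le.2 hdpos)
    have hle : ‖∫ s in d..S, (p.density h a b x s - p.density h a b x' s)‖
        ≤ ∫ s in d..S, dirMass κ * A * d * s ^ (α - 2) := by
      refine intervalIntegral.norm_integral_le_of_norm_le hdS.le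
        (Eventually.of_forall fun s hs => ?_)
        ((intervalIntegral.intervalIntegrable_rpow (Or.inr hnot)).const_mul _)
      have hs0 : 0 < s := hdpos.trans hs.1
      rw [p.density_eq hh _ _ _ hs0.ne', p.density_eq hh _ _ _ hs0.ne', ← mul_sub, norm_mul,
        Real.norm_of_nonneg (inv_pos.2 hs0).le, Real.norm_eq_abs]
      have h1 := kκ.abs_scaleAvg_sub_le (lap_contDiff hh) hs0
        (mul_nonneg hA (Real.rpow_nonneg hs0.le α)) (x := x) (x' := x')
        fun t ht e => (kκ.dir e).abs_scaleAvg_le_osc (kκ.integral_pd e)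
          (lap_contDiff hh).continuous (hosc _ (hseg t ht) s hs0 hs.2)
      calc _ ≤ s⁻¹ * _ := mul_le_mul_of_nonneg_left h1 (inv_pos.2 hs0).le
        _ = _ := by
          rw [Real.rpow_sub hs0]
          norm_num
          field_simp
          rw [hd]
    rw [← Real.norm_eq_abs]
    refine hle.trans ?_
    rw [intervalIntegral.integral_const_mul,
      integral_rpow (Or.inr ⟨by linarith, hnot⟩)]
    have hS' : 0 ≤ S ^ (α - 1) := Real.rpow_nonneg hS.le _
    have hdd : d * d ^ (α - 1) = d ^ α := by
      rw [Real.rpow_sub_one hdpos.ne']; field_simp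
    have e1 : α - 2 + 1 = α - 1 := by ring
    rw [e1]
    calc dirMass κ * A * d * ((S ^ (α - 1) - d ^ (α - 1)) / (α - 1))
        = dirMass κ * A * d * ((d ^ (α - 1) - S ^ (α - 1)) / (1 - α)) := by
          rw [← neg_sub (1 : ℝ) α, div_neg, ← neg_div]; ring_nf
      _ ≤ dirMass κ * D * d * (d ^ (α - 1) / (1 - α)) := by
          refine mul_le_mul (by gcongr) (by gcongr; linarith) ?_ (by positivity)
          refine div_nonneg (sub_nonneg.2 ?_) h1α.le
          exact Real.rpow_le_rpow_of_nonpos hdpos hdS.le (by linarith)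
      _ = dirMass κ / (1 - α) * D * (d * d ^ (α - 1)) := by ring
      _ = _ := by rw [hdd]
  have h3 := hint x hx d hd0 hdS.le
  have h4 := hint x' hx' d hd0 hdS.le
  have h5 : c₂ * A * (d ^ α / α) ≤ c₂ * D * (d ^ α / α) := by gcongr
  have h6 : c₂ * D * (d ^ α / α) = c₂ / α * D * d ^ α := by ring
  have h7 : 0 ≤ D * d ^ α := by positivity
  have h8 : 0 ≤ C₁ * (D * d ^ α) := by positivity
  calc _ ≤ dirMass χ * D * d ^ α + 2 * (c₂ / α * D * d ^ α)
        + dirMass κ / (1 - α) * D * d ^ α := by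
        rw [abs_le] at *
        constructor <;> linarith [h3.1, h3.2, h4.1, h4.2, hT1.1, hT1.2, hT2.1, hT2.2]
    _ = C₂ * (D * d ^ α) := by rw [hC₂]; ring
    _ ≤ _ := by nlinarith

theorem schauder_local {n : ℕ} (hn : 0 < n) {α : ℝ} (hα : 0 < α) (hα1 : α < 1) :
    ∃ C > 0, ∀ h : En n → ℝ, ContDiff ℝ ∞ h → ∀ (x₀ : En n) (S M A : ℝ), 0 < S →
      0 ≤ M → 0 ≤ A → (∀ z, ‖z - x₀‖ ≤ 2 * S → |h z| ≤ M) →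
      (∀ z z', ‖z - x₀‖ ≤ 2 * S → ‖z' - x₀‖ ≤ 2 * S →
        |lap h z - lap h z'| ≤ A * ‖z - z'‖ ^ α) →
      (∀ x, ‖x - x₀‖ ≤ S → ‖hes h x‖ ≤ C * (A + M / S ^ (2 + α)) * S ^ α) ∧
      ∀ x x', ‖x - x₀‖ ≤ S → ‖x' - x₀‖ ≤ S →
        ‖hes h x - hes h x'‖ ≤ C * (A + M / S ^ (2 + α)) * ‖x - x'‖ ^ α := by
  obtain ⟨p⟩ := exists_kerPair hn
  choose C hC hest using fun i j : Fin n => p.schauder_component hα hα1 (stdVec i) (stdVec j)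
  have : Nonempty (Fin n) := ⟨⟨0, hn⟩⟩
  have hle : ∀ i j, C i j ≤ ∑ i, ∑ j, C i j := fun i j =>
    (Finset.single_le_sum (f := fun j => C i j) (fun j _ => (hC i j).le) (Finset.mem_univ j)).trans
      (Finset.single_le_sum (f := fun i => ∑ j, C i j)
        (fun i _ => Finset.sum_nonneg fun j _ => (hC i j).le) (Finset.mem_univ i))
  refine ⟨∑ i, ∑ j, C i j, lt_of_lt_of_le (hC ⟨0, hn⟩ ⟨0, hn⟩) (hle _ _), ?_⟩
  intro h hh x₀ S M A hS hM hA h1 h2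
  have hD : 0 ≤ A + M / S ^ (2 + α) := by positivity
  have hC0 : 0 ≤ ∑ i, ∑ j, C i j := (hC ⟨0, hn⟩ ⟨0, hn⟩).le.trans (hle _ _)
  refine ⟨fun x hx => ?_, fun x x' hx hx' => ?_⟩
  · refine (pi_norm_le_iff_of_nonneg (by positivity)).2 fun i =>
      (pi_norm_le_iff_of_nonneg (by positivity)).2 fun j => ?_
    refine ((hest i j h hh x₀ S M A hS hM hA h1 h2).1 x hx).trans ?_
    have := hle i j
    gcongr
  · refine (pi_norm_le_iff_of_nonneg (by positivity)).2 fun i =>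
      (pi_norm_le_iff_of_nonneg (by positivity)).2 fun j => ?_
    refine ((hest i j h hh x₀ S M A hS hM hA h1 h2).2 x x' hx hx').trans ?_
    have := hle i j
    gcongr

/-- Hölder continuity of the Hessian, on a closed ball, with the given bounds. -/
def HessBound {n : ℕ} (h : En n → ℝ) (α : ℝ) (x₀ : En n) (ρ N : ℝ) : Prop :=
  (∀ z, ‖z - x₀‖ ≤ ρ → ‖hes h z‖ ≤ N) ∧
  ∀ z z', ‖z - x₀‖ ≤ ρ → ‖z' - x₀‖ ≤ ρ → ‖hes h z - hes h z'‖ ≤ N * ‖z - z'‖ ^ α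

/-- The weighted interior `C^{2,α}` bound on the ball of radius `r`. -/
def WeightedBound {n : ℕ} (h : En n → ℝ) (r α N : ℝ) : Prop :=
  (∀ x, ‖x‖ < r → ‖hes h x‖ * (r - ‖x‖) ^ 2 ≤ N) ∧
  ∀ x x' ρ, 0 < ρ → ρ ≤ r - ‖x‖ → ρ ≤ r - ‖x'‖ →
    ‖hes h x - hes h x'‖ * ρ ^ (2 + α) ≤ N * ‖x - x'‖ ^ α

theorem exists_weightedBound {n : ℕ} {h : En n → ℝ} (hh : ContDiff ℝ ∞ h) {r α : ℝ} (hr : 0 < r)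
    (hr1 : r ≤ 1) (hα : 0 < α) (hα1 : α < 1) : ∃ N ≥ 0, WeightedBound h r α N := by
  have hc := hes_contDiff hh
  have hK : IsCompact (Metric.closedBall (0 : En n) r) := isCompact_closedBall _ _
  obtain ⟨B, hB⟩ := hK.exists_bound_of_continuousOn hc.continuous.continuousOn
  obtain ⟨L, hL⟩ := hK.exists_bound_of_continuousOn
    (hc.continuous_fderiv (by simp)).continuousOn
  have hB0 : 0 ≤ B := (norm_nonneg _).trans (hB 0 (by simp [hr.le]))
  have hL0 : 0 ≤ L := (norm_nonneg _).trans (hL 0 (by simp [hr.le]))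
  refine ⟨B + 2 * L, by positivity, fun x hx => ?_, fun x x' ρ hρ hx hx' => ?_⟩
  · have h1 := hB x (by simpa using hx.le)
    have h2 : (r - ‖x‖) ^ 2 ≤ 1 := by
      have := norm_nonneg x
      rw [sq_le_one_iff_abs_le_one, abs_le]; constructor <;> linarith
    nlinarith [norm_nonneg (hes h x), sq_nonneg (r - ‖x‖)]
  · have hxr : x ∈ Metric.closedBall (0 : En n) r := by simp; linarith
    have hxr' : x' ∈ Metric.closedBall (0 : En n) r := by simp; linarith
    have h1 : ‖hes h x - hes h x'‖ ≤ L * ‖x - x'‖ :=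
      (convex_closedBall (0 : En n) r).norm_image_sub_le_of_norm_fderiv_le
        (fun y _ => (hc.differentiable (by simp)).differentiableAt) hL hxr' hxr
    have h2 : ‖x - x'‖ ≤ 2 := by
      simp at hxr hxr'
      linarith [norm_sub_le x x']
    have h3 : ‖x - x'‖ ≤ 2 * ‖x - x'‖ ^ α := by
      rcases (norm_nonneg (x - x')).eq_or_lt with h0 | h0
      · rw [← h0]; positivity
      · have e : ‖x - x'‖ = ‖x - x'‖ ^ (1 - α) * ‖x - x'‖ ^ α := by
          rw [← Real.rpow_add h0]; simp
        have : ‖x - x'‖ ^ (1 - α) ≤ 2 := by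
          calc ‖x - x'‖ ^ (1 - α) ≤ 2 ^ (1 - α) := by gcongr
            _ ≤ 2 ^ (1 : ℝ) := Real.rpow_le_rpow_of_exponent_le (by norm_num) (by linarith)
            _ = 2 := by norm_num
        conv_lhs => rw [e]
        gcongr
    have hρ1 : ρ ^ (2 + α) ≤ 1 :=
      Real.rpow_le_one hρ.le (by linarith [norm_nonneg x]) (by linarith)
    calc ‖hes h x - hes h x'‖ * ρ ^ (2 + α) ≤ (L * ‖x - x'‖) * 1 := by gcongr
      _ ≤ (L * (2 * ‖x - x'‖ ^ α)) * 1 := by gcongr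
      _ ≤ _ := by nlinarith [mul_nonneg hB0 (Real.rpow_nonneg (norm_nonneg (x - x')) α)]

/-- Interior estimate for the Laplacian with a small perturbation depending on the Hessian. -/
theorem schauder_absorb {n : ℕ} (hn : 0 < n) {α : ℝ} (hα : 0 < α) (hα1 : α < 1) :
    ∃ μ > 0, ∀ r : ℝ, 0 < r → r ≤ 1 → ∃ C > 0, ∀ h : En n → ℝ, ContDiff ℝ ∞ h → ∀ M A : ℝ,
      0 ≤ M → 0 ≤ A → (∀ z, ‖z‖ ≤ r → |h z| ≤ M) →
      (∀ x₀ ρ N, 0 < ρ → ‖x₀‖ + ρ ≤ r → 0 ≤ N → HessBound h α x₀ ρ N →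
        ∀ z z', ‖z - x₀‖ ≤ ρ → ‖z' - x₀‖ ≤ ρ →
          |lap h z - lap h z'| ≤ (A + μ * N) * ‖z - z'‖ ^ α) →
      HessBound h α 0 (r / 2) (C * (M + A)) := by
  obtain ⟨C, hC, hS⟩ := schauder_local hn hα hα1
  refine ⟨1 / (128 * C), by positivity, fun r hr hr1 => ⟨1024 * C * (2 / r) ^ 3, by positivity, ?_⟩⟩
  intro h hh M A hM hA hhM hlap
  set D := 512 * C * (M + A) with hD
  have hD0 : 0 ≤ D := by positivity
  have step : ∀ N, 0 ≤ N → WeightedBound h r α N → WeightedBound h r α (N / 2 + D) := by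
    intro N hN hV
    have key : ∀ x, ‖x‖ < r → ∀ x', ‖x' - x‖ ≤ (r - ‖x‖) / 4 →
        ‖hes h x‖ * (r - ‖x‖) ^ 2 ≤ (N / 2 + D) / 8 ∧
        ‖hes h x - hes h x'‖ * (r - ‖x‖) ^ (2 + α) ≤ (N / 2 + D) / 8 * ‖x - x'‖ ^ α := by
      intro x hx x' hx'
      set d := r - ‖x‖ with hd
      have hd0 : 0 < d := by rw [hd]; linarith
      have hd1 : d ≤ 1 := by rw [hd]; linarith [norm_nonneg x]
      have hP : 0 < d ^ (2 + α) := Real.rpow_pos_of_pos hd0 _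
      have hP1 : d ^ (2 + α) ≤ d ^ 2 := by
        rw [← Real.rpow_natCast]
        exact Real.rpow_le_rpow_of_exponent_ge hd0 hd1 (by norm_num; linarith)
      have hhalf : (d / 2) ^ (2 + α) = d ^ (2 + α) / 2 ^ (2 + α) := Real.div_rpow hd0.le (by norm_num) _
      have h2α : (2 : ℝ) ^ (2 + α) ≤ 8 := by
        calc (2 : ℝ) ^ (2 + α) ≤ 2 ^ (3 : ℝ) :=
              Real.rpow_le_rpow_of_exponent_le (by norm_num) (by linarith)
          _ = 8 := by norm_num
      have h4α : (4 : ℝ) ^ (2 + α) ≤ 64 := by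
        calc (4 : ℝ) ^ (2 + α) ≤ 4 ^ (3 : ℝ) :=
              Real.rpow_le_rpow_of_exponent_le (by norm_num) (by linarith)
          _ = 64 := by norm_num
      have hin : ∀ z, ‖z - x‖ ≤ d / 2 → d / 2 ≤ r - ‖z‖ := by
        intro z hz
        have := norm_le_norm_add_norm_sub' z x
        rw [hd] at *; linarith
      have hHB : HessBound h α x (d / 2) (8 * N / d ^ (2 + α)) := by
        refine ⟨fun z hz => ?_, fun z z' hz hz' => ?_⟩
        · have h1 := hV.1 z (by linarith [hin z hz])
          have h2 : (d / 2) ^ 2 ≤ (r - ‖z‖) ^ 2 := by gcongr; exact hin z hz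
          rw [le_div_iff₀ hP]
          have h3 : ‖hes h z‖ * (d / 2) ^ 2 ≤ N := le_trans (by gcongr) h1
          have h4 : ‖hes h z‖ * d ^ (2 + α) ≤ ‖hes h z‖ * d ^ 2 := by gcongr
          nlinarith
        · have h1 := hV.2 z z' (d / 2) (by positivity) (hin z hz) (hin z' hz')
          rw [hhalf, mul_div_assoc', div_le_iff₀ (by positivity)] at h1
          rw [div_mul_eq_mul_div, le_div_iff₀ hP]
          refine h1.trans ?_
          have : 0 ≤ N * ‖z - z'‖ ^ α := by positivity
          nlinarith
      have hlap' := hlap x (d / 2) (8 * N / d ^ (2 + α)) (by positivity) (by rw [hd]; linarith)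
        (by positivity) hHB
      have hd2 : 2 * (d / 4) = d / 2 := by ring
      obtain ⟨s1, s2⟩ := hS h hh x (d / 4) M (A + 1 / (128 * C) * (8 * N / d ^ (2 + α)))
        (by positivity) hM (by positivity)
        (fun z hz => hhM z (by rw [hd2] at hz; linarith [hin z hz]))
        (by rw [hd2]; exact hlap')
      have hbd : C * (A + 1 / (128 * C) * (8 * N / d ^ (2 + α)) + M / (d / 4) ^ (2 + α)) *
          d ^ (2 + α) ≤ (N / 2 + D) / 8 := by
        rw [Real.div_rpow hd0.le (by norm_num)]
        have e : C * (A + 1 / (128 * C) * (8 * N / d ^ (2 + α)) +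
            M / (d ^ (2 + α) / 4 ^ (2 + α))) * d ^ (2 + α) =
            C * A * d ^ (2 + α) + N / 16 + C * M * 4 ^ (2 + α) := by
          field_simp
          ring
        rw [e, hD]
        have h1 : C * A * d ^ (2 + α) ≤ C * A * 1 := by
          gcongr; exact Real.rpow_le_one hd0.le hd1 (by linarith)
        have h2 : C * M * 4 ^ (2 + α) ≤ C * M * 64 := by gcongr
        nlinarith [mul_nonneg hC.le hA]
      have hpS : d ^ (2 + α) = d ^ 2 * d ^ α := by
        rw [Real.rpow_add hd0]; norm_num
      set E := C * (A + 1 / (128 * C) * (8 * N / d ^ (2 + α)) + M / (d / 4) ^ (2 + α)) with hE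
      have hE0 : 0 ≤ E := by positivity
      constructor
      · have h1 := s1 x (by simp; positivity)
        have h2 : (d / 4) ^ α ≤ d ^ α := by gcongr; linarith
        calc ‖hes h x‖ * d ^ 2 ≤ (E * d ^ α) * d ^ 2 := by
              gcongr; exact h1.trans (by gcongr)
          _ = E * d ^ (2 + α) := by rw [hpS]; ring
          _ ≤ _ := hbd
      · have h1 := s2 x x' (by simp; positivity) hx'
        calc ‖hes h x - hes h x'‖ * d ^ (2 + α) ≤ (E * ‖x - x'‖ ^ α) * d ^ (2 + α) := by gcongr
          _ = E * d ^ (2 + α) * ‖x - x'‖ ^ α := by ring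
          _ ≤ _ := by gcongr
    set K := (N / 2 + D) / 8 with hK
    have hK0 : 0 ≤ K := by positivity
    have hK8 : N / 2 + D = 8 * K := by rw [hK]; ring
    rw [hK8]
    refine ⟨fun x hx => ?_, fun x x' ρ hρ hx hx' => ?_⟩
    · have := (key x hx x (by simp; linarith)).1
      linarith
    · have hP : 0 < ρ ^ (2 + α) := Real.rpow_pos_of_pos hρ _
      rcases le_or_gt ‖x' - x‖ ((r - ‖x‖) / 4) with hnear | hfar
      · have h1 := (key x (by linarith) x' hnear).2
        have h2 : ρ ^ (2 + α) ≤ (r - ‖x‖) ^ (2 + α) := by gcongr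
        have h3 : 0 ≤ K * ‖x - x'‖ ^ α := by positivity
        calc ‖hes h x - hes h x'‖ * ρ ^ (2 + α) ≤ ‖hes h x - hes h x'‖ * (r - ‖x‖) ^ (2 + α) := by
              gcongr
          _ ≤ _ := by linarith
      · have h1 := (key x (by linarith) x (by simp; linarith)).1
        have h2 := (key x' (by linarith) x' (by simp; linarith)).1
        have h3 : ‖hes h x‖ * ρ ^ 2 ≤ K := le_trans (by gcongr) h1
        have h4 : ‖hes h x'‖ * ρ ^ 2 ≤ K := le_trans (by gcongr) h2
        have h5 : ρ ^ α ≤ 4 * ‖x - x'‖ ^ α := by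
          rw [norm_sub_rev] at hfar
          calc ρ ^ α ≤ (4 * ‖x - x'‖) ^ α := by gcongr; linarith
            _ = 4 ^ α * ‖x - x'‖ ^ α := Real.mul_rpow (by norm_num) (norm_nonneg _)
            _ ≤ 4 * ‖x - x'‖ ^ α := by
              gcongr
              calc (4 : ℝ) ^ α ≤ 4 ^ (1 : ℝ) :=
                    Real.rpow_le_rpow_of_exponent_le (by norm_num) hα1.le
                _ = 4 := by norm_num
        have hpS : ρ ^ (2 + α) = ρ ^ 2 * ρ ^ α := by
          rw [Real.rpow_add hρ]; norm_num
        have h6 := norm_sub_le (hes h x) (hes h x')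
        calc ‖hes h x - hes h x'‖ * ρ ^ (2 + α)
            ≤ (‖hes h x‖ + ‖hes h x'‖) * (ρ ^ 2 * ρ ^ α) := by rw [hpS]; gcongr
          _ = (‖hes h x‖ * ρ ^ 2 + ‖hes h x'‖ * ρ ^ 2) * ρ ^ α := by ring
          _ ≤ (K + K) * (4 * ‖x - x'‖ ^ α) := by gcongr
          _ = _ := by ring
  obtain ⟨N, hN0, hN⟩ := exists_weightedBound hh hr hr1 hα hα1
  have iter : ∀ k : ℕ, WeightedBound h r α (N * (1 / 2) ^ k + 2 * D) := by
    intro k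
    induction k with
    | zero =>
      simp only [pow_zero, mul_one]
      refine ⟨fun x hx => (hN.1 x hx).trans (by linarith), fun x x' ρ hρ hx hx' =>
        (hN.2 x x' ρ hρ hx hx').trans ?_⟩
      gcongr
      linarith
    | succ k ih =>
      have := step _ (by positivity) ih
      convert this using 1
      rw [pow_succ]; ring
  have hlim : Tendsto (fun k : ℕ => N * (1 / 2 : ℝ) ^ k + 2 * D) atTop (nhds (2 * D)) := by
    have := (tendsto_pow_atTop_nhds_zero_of_lt_one (r := (1 / 2 : ℝ)) (by norm_num)
      (by norm_num)).const_mul N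
    simpa using this.add_const (2 * D)
  have hfin : WeightedBound h r α (2 * D) := by
    refine ⟨fun x hx => ge_of_tendsto' hlim fun k => (iter k).1 x hx,
      fun x x' ρ hρ hx hx' => ge_of_tendsto' (hlim.mul_const _) fun k => (iter k).2 x x' ρ hρ hx hx'⟩
  have hr2 : 0 < (r / 2) ^ (2 + α) := by positivity
  have hpow : (r / 2) ^ 3 ≤ (r / 2) ^ (2 + α) := by
    rw [← Real.rpow_natCast]
    exact Real.rpow_le_rpow_of_exponent_ge (by linarith) (by linarith) (by norm_num; linarith)
  have hCeq : 1024 * C * (2 / r) ^ 3 * (M + A) = 2 * D / (r / 2) ^ 3 := by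
    rw [hD]; field_simp; ring
  rw [hCeq]
  have hr3 : 0 < (r / 2) ^ 3 := by positivity
  refine ⟨fun x hx => ?_, fun x x' hx hx' => ?_⟩
  · rw [sub_zero] at hx
    have h1 := hfin.1 x (by linarith)
    rw [le_div_iff₀ hr3]
    refine le_trans ?_ h1
    gcongr
    calc (r / 2) ^ 3 ≤ (r / 2) ^ 2 := pow_le_pow_of_le_one (by linarith) (by linarith) (by norm_num)
      _ ≤ _ := by gcongr; linarith
  · rw [sub_zero] at hx hx'
    have h1 := hfin.2 x x' (r / 2) (by linarith) (by linarith) (by linarith)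
    rw [div_mul_eq_mul_div, le_div_iff₀ hr3]
    refine le_trans ?_ h1
    gcongr

/-- The determinant of the identity plus the given array. -/
def detOne {n : ℕ} (m : Fin n → Fin n → ℝ) : ℝ := (1 + Matrix.of m).det

/-- The part of `detOne` of order at least two. -/
def detRem {n : ℕ} (m : Fin n → Fin n → ℝ) : ℝ := detOne m - 1 - ∑ i, m i i

theorem contDiff_detOne {n : ℕ} : ContDiff ℝ ∞ (detOne (n := n)) := by
  unfold detOne
  simp only [Matrix.det_apply]
  refine ContDiff.sum fun σ _ => ContDiff.const_smul _ ?_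
  refine contDiff_prod fun i _ => ?_
  simp only [Matrix.add_apply, Matrix.of_apply]
  exact contDiff_const.add (by fun_prop)

theorem contDiff_detRem {n : ℕ} : ContDiff ℝ ∞ (detRem (n := n)) := by
  unfold detRem
  refine (contDiff_detOne.sub contDiff_const).sub (ContDiff.sum fun i _ => ?_)
  fun_prop

theorem detRem_zero {n : ℕ} : detRem (0 : Fin n → Fin n → ℝ) = 0 := by
  have : (Matrix.of (0 : Fin n → Fin n → ℝ)) = 0 := rfl
  simp [detRem, detOne, this]

theorem fderiv_detRem_zero {n : ℕ} : fderiv ℝ (detRem (n := n)) 0 = 0 := by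
  ext m
  have h1 : HasDerivAt (fun t : ℝ => detRem (t • m)) (fderiv ℝ detRem 0 m) 0 := by
    have hf : HasFDerivAt (detRem (n := n)) (fderiv ℝ detRem 0) ((0 : ℝ) • m) := by
      rw [zero_smul]
      exact ((contDiff_detRem (n := n)).differentiable (by simp) 0).hasFDerivAt
    have := hf.comp_hasDerivAt (0 : ℝ) ((hasDerivAt_id (0 : ℝ)).smul_const m)
    simpa [Function.comp_def] using this
  obtain ⟨p, hp⟩ : ∃ p : Polynomial ℝ, ∀ t : ℝ, detRem (t • m) = t ^ 2 * p.eval t := by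
    refine ⟨(Matrix.det (1 + (Polynomial.X : Polynomial ℝ) • (Matrix.of m).map Polynomial.C)
      ).divX.divX, fun t => ?_⟩
    have e := Matrix.det_one_add_smul t (Matrix.of m)
    have h2 : detOne (t • m) = (1 + t • Matrix.of m).det := rfl
    rw [detRem, h2, e]
    simp [Matrix.trace, ← Finset.mul_sum]
    ring
  have h2 : HasDerivAt (fun t : ℝ => detRem (t • m)) 0 0 := by
    have : (fun t : ℝ => detRem (t • m)) = fun t => t ^ 2 * p.eval t := funext hp
    rw [this]
    have := ((hasDerivAt_id (0 : ℝ)).fun_pow 2).fun_mul (p.hasDerivAt 0)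
    simpa using this
  simpa using h1.unique h2

theorem exists_second_order_bounds {E : Type*} [NormedAddCommGroup E] [NormedSpace ℝ E]
    [FiniteDimensional ℝ E] {q : E → ℝ} (hq : ContDiff ℝ ∞ q) (hq0 : fderiv ℝ q 0 = 0) :
    ∃ L ≥ 1, ∀ m m' : E, ‖m‖ ≤ 1 → ‖m'‖ ≤ 1 →
    ‖fderiv ℝ q m - fderiv ℝ q m'‖ ≤ L * ‖m - m'‖ ∧
    ‖fderiv ℝ (fderiv ℝ q) m‖ ≤ L ∧
    ‖fderiv ℝ (fderiv ℝ q) m - fderiv ℝ (fderiv ℝ q) m'‖ ≤ L * ‖m - m'‖ ∧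
    ‖fderiv ℝ q m‖ ≤ L * ‖m‖ ∧
    ∀ μ, ‖m‖ ≤ μ → ‖m'‖ ≤ μ → μ ≤ 1 → |q m - q m'| ≤ L * μ * ‖m - m'‖ := by
  have hq1 : ContDiff ℝ ∞ (fderiv ℝ q) := hq.fderiv_right (by simp)
  have hq2 : ContDiff ℝ ∞ (fderiv ℝ (fderiv ℝ q)) := hq1.fderiv_right (by simp)
  have : ProperSpace E := FiniteDimensional.proper ℝ E
  have hK : IsCompact (Metric.closedBall (0 : E) 1) := isCompact_closedBall _ _
  obtain ⟨L2, hL2⟩ := hK.exists_bound_of_continuousOn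
    (f := fderiv ℝ (fderiv ℝ q)) hq2.continuous.continuousOn
  obtain ⟨L3, hL3⟩ := hK.exists_bound_of_continuousOn
    (hq2.continuous_fderiv (by simp)).continuousOn
  have hmem : ∀ m : E, ∀ μ, ‖m‖ ≤ μ → m ∈ Metric.closedBall (0 : E) μ :=
    fun m μ hm => by simpa using hm
  have a1 : ∀ m m' : E, ‖m‖ ≤ 1 → ‖m'‖ ≤ 1 →
      ‖fderiv ℝ q m - fderiv ℝ q m'‖ ≤ L2 * ‖m - m'‖ := fun m m' hm hm' =>
    (convex_closedBall (0 : E) 1).norm_image_sub_le_of_norm_fderiv_le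
        (fun y _ => (hq1.differentiable (by simp)).differentiableAt) hL2 (hmem _ _ hm')
        (hmem _ _ hm)
  have hL : L2 ≤ max 1 (max L2 L3) := (le_max_left _ _).trans (le_max_right _ _)
  have hL' : L3 ≤ max 1 (max L2 L3) := (le_max_right _ _).trans (le_max_right _ _)
  have a4 : ∀ m : E, ‖m‖ ≤ 1 → ‖fderiv ℝ q m‖ ≤ max 1 (max L2 L3) * ‖m‖ := by
    intro m hm
    have := a1 m 0 hm (by simp)
    rw [hq0, sub_zero, sub_zero] at this
    exact this.trans (by gcongr)
  refine ⟨max 1 (max L2 L3), le_max_left _ _, fun m m' hm hm' =>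
    ⟨(a1 m m' hm hm').trans (by gcongr), (hL2 m (hmem _ _ hm)).trans hL, ?_, a4 m hm, ?_⟩⟩
  · refine ((convex_closedBall (0 : E) 1).norm_image_sub_le_of_norm_fderiv_le
        (fun y _ => (hq2.differentiable (by simp)).differentiableAt) hL3 (hmem _ _ hm')
        (hmem _ _ hm)).trans (by gcongr)
  · intro μ hμ hμ' hμ1
    rw [← Real.norm_eq_abs]
    refine (convex_closedBall (0 : E) μ).norm_image_sub_le_of_norm_fderiv_le
        (fun y _ => (hq.differentiable (by simp)).differentiableAt) (fun y hy => ?_)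
        (hmem _ _ hμ') (hmem _ _ hμ)
    have hy' : ‖y‖ ≤ μ := by simpa using hy
    exact (a4 y (hy'.trans hμ1)).trans (by gcongr)

theorem exists_detRem_bounds (n : ℕ) : ∃ L ≥ 1, ∀ m m' : Fin n → Fin n → ℝ, ‖m‖ ≤ 1 → ‖m'‖ ≤ 1 →
    ‖fderiv ℝ detRem m - fderiv ℝ detRem m'‖ ≤ L * ‖m - m'‖ ∧
    ‖fderiv ℝ (fderiv ℝ (detRem (n := n))) m‖ ≤ L ∧
    ‖fderiv ℝ (fderiv ℝ detRem) m - fderiv ℝ (fderiv ℝ detRem) m'‖ ≤ L * ‖m - m'‖ ∧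
    ‖fderiv ℝ detRem m‖ ≤ L * ‖m‖ ∧
    ∀ μ, ‖m‖ ≤ μ → ‖m'‖ ≤ μ → μ ≤ 1 → |detRem m - detRem m'| ≤ L * μ * ‖m - m'‖ :=
  exists_second_order_bounds contDiff_detRem fderiv_detRem_zero

theorem lap_eq_sub_detRem {n : ℕ} (W : En n → ℝ) (x : En n) :
    lap W x = detOne (hes W x) - 1 - detRem (hes W x) := by
  simp [detRem, lap, hes]

theorem hasFDerivAt_hes {n : ℕ} {W : En n → ℝ} (hW : ContDiff ℝ ∞ W) (x a : En n) :
    fderiv ℝ (hes W) x a = hes (pd a W) x := by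
  have hd : DifferentiableAt ℝ (hes W) x := (hes_contDiff hW).differentiable (by simp) x
  funext i j
  have h1 : fderiv ℝ (hes W) x a i j = fderiv ℝ (fun y => hes W y i j) x a := by
    rw [differentiableAt_pi] at hd
    have h2 : ∀ i, DifferentiableAt ℝ (fun y => hes W y i) x := hd
    rw [fderiv_pi h2]
    have h3 := fun j => differentiableAt_pi.1 (h2 i) j
    simp only [ContinuousLinearMap.pi_apply]
    rw [fderiv_pi h3]
    simp
  rw [h1]
  change pd a (pd (stdVec i) (pd (stdVec j) W)) x = _
  rw [pd_comm (pd_contDiff hW _), pd_comm hW]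
  rfl

theorem pd_detRem_hes {n : ℕ} {W : En n → ℝ} (hW : ContDiff ℝ ∞ W) (x a : En n) :
    pd a (fun y => detRem (hes W y)) x = fderiv ℝ detRem (hes W x) (hes (pd a W) x) := by
  have h1 : DifferentiableAt ℝ (detRem (n := n)) (hes W x) :=
    contDiff_detRem.differentiable (by simp) _
  have h2 : DifferentiableAt ℝ (hes W) x := (hes_contDiff hW).differentiable (by simp) x
  rw [pd, show (fun y => detRem (hes W y)) = detRem ∘ hes W from rfl, fderiv_comp _ h1 h2]
  simp [hasFDerivAt_hes hW]

theorem pd_pd_detRem_hes {n : ℕ} {W : En n → ℝ} (hW : ContDiff ℝ ∞ W) (x a b : En n) :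
    pd b (pd a (fun y => detRem (hes W y))) x =
      fderiv ℝ (fderiv ℝ detRem) (hes W x) (hes (pd b W) x) (hes (pd a W) x) +
      fderiv ℝ detRem (hes W x) (hes (pd b (pd a W)) x) := by
  have e : pd a (fun y => detRem (hes W y)) =
      fun y => fderiv ℝ detRem (hes W y) (hes (pd a W) y) := funext fun y => pd_detRem_hes hW y a
  have hWa := pd_contDiff hW a
  have h1 : DifferentiableAt ℝ (fderiv ℝ (detRem (n := n))) (hes W x) :=
    (contDiff_detRem.fderiv_right (m := ∞) (by simp)).differentiable (by simp) _
  have h2 : DifferentiableAt ℝ (hes W) x := (hes_contDiff hW).differentiable (by simp) x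
  have h3 : DifferentiableAt ℝ (hes (pd a W)) x := (hes_contDiff hWa).differentiable (by simp) x
  have h4 : HasFDerivAt (fun y => fderiv ℝ detRem (hes W y))
      ((fderiv ℝ (fderiv ℝ detRem) (hes W x)).comp (fderiv ℝ (hes W) x)) x :=
    h1.hasFDerivAt.comp x h2.hasFDerivAt
  rw [e, pd, (h4.clm_apply h3.hasFDerivAt).fderiv]
  simp [hasFDerivAt_hes hW, hasFDerivAt_hes hWa]
  ring

theorem pd_sub_const {n : ℕ} (h : En n → ℝ) (c : ℝ) (a : En n) :
    pd a (fun x => h x - c) = pd a h := by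
  funext x
  simp [pd, fderiv_sub_const]

theorem hes_sub_const {n : ℕ} (h : En n → ℝ) (c : ℝ) : hes (fun x => h x - c) = hes h := by
  funext x i j
  simp only [hes, pd_sub_const]

theorem lap_sub_const {n : ℕ} (h : En n → ℝ) (c : ℝ) : lap (fun x => h x - c) = lap h := by
  funext x
  simp only [lap, pd_sub_const]

theorem abs_pd_le_of_basis {n : ℕ} {g : En n → ℝ} {x : En n} {B : ℝ} (e : En n)
    (hB : ∀ i, |pd (stdVec i) g x| ≤ B) : |pd e g x| ≤ n * B * ‖e‖ := by
  rw [pd_eq_sum_stdVec]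
  refine (Finset.abs_sum_le_sum_abs _ _).trans ?_
  calc ∑ i, |e i * pd (stdVec i) g x| ≤ ∑ i : Fin n, ‖e‖ * B := by
        refine Finset.sum_le_sum fun i _ => ?_
        rw [abs_mul]
        exact mul_le_mul (by simpa using PiLp.norm_apply_le e i) (hB i) (abs_nonneg _)
          (norm_nonneg _)
    _ = _ := by simp; ring

theorem abs_sub_le_of_abs_pd_le {n : ℕ} {g : En n → ℝ} (hg : ContDiff ℝ ∞ g) {s : Set (En n)}
    (hs : Convex ℝ s) {B : ℝ} (hB0 : 0 ≤ B) (hB : ∀ i, ∀ x ∈ s, |pd (stdVec i) g x| ≤ B)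
    {x x' : En n} (hx : x ∈ s) (hx' : x' ∈ s) : |g x - g x'| ≤ n * B * ‖x - x'‖ := by
  rw [← Real.norm_eq_abs]
  refine hs.norm_image_sub_le_of_norm_fderiv_le
    (fun y _ => (hg.differentiable (by simp)).differentiableAt) (fun y hy => ?_) hx' hx
  refine ContinuousLinearMap.opNorm_le_bound _ (by positivity) fun e => ?_
  exact abs_pd_le_of_basis e fun i => hB i y hy

theorem le_two_mul_rpow {t α : ℝ} (ht : 0 ≤ t) (ht2 : t ≤ 2) (hα : 0 < α) (hα1 : α < 1) :
    t ≤ 2 * t ^ α := by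
  rcases ht.eq_or_lt with h0 | h0
  · rw [← h0]; positivity
  · have e : t = t ^ (1 - α) * t ^ α := by
      rw [← Real.rpow_add h0]; simp
    have : t ^ (1 - α) ≤ 2 := by
      calc t ^ (1 - α) ≤ 2 ^ (1 - α) := by gcongr
        _ ≤ 2 ^ (1 : ℝ) := Real.rpow_le_rpow_of_exponent_le (by norm_num) (by linarith)
        _ = 2 := by norm_num
    conv_lhs => rw [e]
    gcongr

theorem HessBound.mono {n : ℕ} {h : En n → ℝ} {α ρ N ρ' N' : ℝ} {x₀ x₁ : En n}
    (H : HessBound h α x₀ ρ N) (hρ : ‖x₁ - x₀‖ + ρ' ≤ ρ) (hN : N ≤ N') : HessBound h α x₁ ρ' N' := by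
  have hin : ∀ z, ‖z - x₁‖ ≤ ρ' → ‖z - x₀‖ ≤ ρ := fun z hz => by
    have := norm_sub_le_norm_sub_add_norm_sub z x₁ x₀
    linarith
  refine ⟨fun z hz => (H.1 z (hin z hz)).trans hN, fun z z' hz hz' =>
    (H.2 z z' (hin z hz) (hin z' hz')).trans ?_⟩
  gcongr

theorem norm_sub_le_of_mem_ball {n : ℕ} {x₀ z : En n} {ρ r : ℝ} (hz : ‖z - x₀‖ ≤ ρ)
    (h : ‖x₀‖ + ρ ≤ r) : ‖z‖ ≤ r := by
  linarith [norm_le_norm_add_norm_sub' z x₀]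

theorem norm_clm_apply_sub_le {E F : Type*} [NormedAddCommGroup E] [NormedSpace ℝ E]
    [NormedAddCommGroup F] [NormedSpace ℝ F] (A A' : E →L[ℝ] F) (p p' : E) :
    ‖A p - A' p'‖ ≤ ‖A‖ * ‖p - p'‖ + ‖A - A'‖ * ‖p'‖ := by
  have e : A p - A' p' = A (p - p') + (A - A') p' := by simp
  rw [e]
  exact (norm_add_le _ _).trans (add_le_add (A.le_opNorm _) ((A - A').le_opNorm _))

set_option maxHeartbeats 2000000 in
/-- Interior estimates up to order `4 + α` for small solutions of `det (1 + D²W) = F`. -/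
theorem small_solution_estimate {n : ℕ} (hn : 0 < n) {α : ℝ} (hα : 0 < α) (hα1 : α < 1) :
    ∃ δ₀ > 0, ∃ C > 0, ∀ W : En n → ℝ, ContDiff ℝ ∞ W → ∀ δ, 0 ≤ δ → δ ≤ δ₀ →
      (∀ x, ‖x‖ ≤ 1 → |W x| ≤ δ ∧ ‖hes W x‖ ≤ δ₀) →
      (∀ x, ‖x‖ ≤ 1 → ∀ i j k, |pd (stdVec i) (fun y => detOne (hes W y)) x| ≤ δ ∧
        |pd (stdVec i) (pd (stdVec j) fun y => detOne (hes W y)) x| ≤ δ ∧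
        |pd (stdVec i) (pd (stdVec j) (pd (stdVec k) fun y => detOne (hes W y))) x| ≤ δ) →
      HessBound W α 0 (1 / 8) (C * δ) ∧ ∀ i, HessBound (pd (stdVec i) W) α 0 (1 / 8) (C * δ) ∧
        ∀ j, HessBound (pd (stdVec j) (pd (stdVec i) W)) α 0 (1 / 8) (C * δ) := by
  obtain ⟨μ, hμ, hS⟩ := schauder_absorb hn hα hα1
  obtain ⟨C₁, hC₁, hS₁⟩ := hS 1 (by norm_num) (by norm_num)
  obtain ⟨C₂, hC₂, hS₂⟩ := hS (1 / 2) (by norm_num) (by norm_num)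
  obtain ⟨C₃, hC₃, hS₃⟩ := hS (1 / 2 / 2) (by norm_num) (by norm_num)
  obtain ⟨L, hL, hq⟩ := exists_detRem_bounds n
  have hL0 : 0 < L := by linarith
  set K₁ := C₁ * (1 + 2 * n) with hK₁
  set K₂ := C₂ * (n * K₁ + 2 * n) with hK₂
  set G := L * K₁ * K₂ ^ 2 + 2 * L * K₂ ^ 2 with hG
  set K₃ := C₃ * (n * K₂ + (2 * n + G)) with hK₃
  have hn0 : (0 : ℝ) < n := by exact_mod_cast hn
  have hK₁0 : 0 < K₁ := by positivity
  have hK₂0 : 0 < K₂ := by positivity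
  have hK₃0 : 0 < K₃ := by positivity
  refine ⟨min 1 (min (μ / (2 * L)) (μ / (2 * L * K₁))), by positivity, K₁ + K₂ + K₃, by positivity, ?_⟩
  intro W hW δ hδ hδ₀ hWb hF
  set δ₀ := min 1 (min (μ / (2 * L)) (μ / (2 * L * K₁)))
  have hδ₀0 : 0 ≤ δ₀ := hδ.trans hδ₀
  have hδ₀1 : δ₀ ≤ 1 := min_le_left _ _
  have hLδ : L * δ₀ ≤ μ / 2 := by
    have : δ₀ ≤ μ / (2 * L) := (min_le_right _ _).trans (min_le_left _ _)
    rw [le_div_iff₀ (by positivity)] at this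
    linarith
  have hLKδ : L * (K₁ * δ) ≤ μ / 2 := by
    have : δ₀ ≤ μ / (2 * L * K₁) := (min_le_right _ _).trans (min_le_right _ _)
    rw [le_div_iff₀ (by positivity)] at this
    nlinarith [mul_le_mul_of_nonneg_left hδ₀ (by positivity : 0 ≤ 2 * L * K₁)]
  set F := fun y => detOne (hes W y) with hFdef
  set q := fun y => detRem (hes W y) with hqdef
  have hFc : ContDiff ℝ ∞ F := contDiff_detOne.comp (hes_contDiff hW)
  have hqc : ContDiff ℝ ∞ q := contDiff_detRem.comp (hes_contDiff hW)
  have hFhol : ∀ g : En n → ℝ, ContDiff ℝ ∞ g → (∀ i, ∀ x, ‖x‖ ≤ 1 → |pd (stdVec i) g x| ≤ δ) →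
      ∀ z z', ‖z‖ ≤ 1 → ‖z'‖ ≤ 1 → |g z - g z'| ≤ 2 * n * δ * ‖z - z'‖ ^ α := by
    intro g hg hgi z z' hz hz'
    have h1 := abs_sub_le_of_abs_pd_le hg (convex_closedBall (0 : En n) 1) hδ
      (fun i x hx => hgi i x (by simpa using hx)) (x := z) (x' := z') (by simpa using hz)
      (by simpa using hz')
    have h2 := le_two_mul_rpow (norm_nonneg (z - z'))
      (by linarith [norm_sub_le z z']) hα hα1
    calc _ ≤ n * δ * ‖z - z'‖ := h1
      _ ≤ n * δ * (2 * ‖z - z'‖ ^ α) := by gcongr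
      _ = _ := by ring
  have hlapW : lap W = fun x => F x - 1 - q x := funext fun x => lap_eq_sub_detRem W x
  have hH1 : ∀ z, ‖z‖ ≤ 1 → ‖hes W z‖ ≤ 1 := fun z hz => (hWb z hz).2.trans hδ₀1
  have b₁ : HessBound W α 0 (1 / 2) (K₁ * δ) := by
    have := hS₁ W hW δ (2 * n * δ) hδ (by positivity) (fun z hz => (hWb z hz).1) ?_
    · convert this using 1; rw [hK₁]; ring
    intro x₀ ρ N hρ hx₀ hN hB z z' hz hz'
    have hz1 := norm_sub_le_of_mem_ball hz hx₀
    have hz1' := norm_sub_le_of_mem_ball hz' hx₀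
    have h1 := hFhol F hFc (fun i x hx => (hF x hx i i i).1) z z' hz1 hz1'
    have h2 := (hq (hes W z) (hes W z') (hH1 z hz1) (hH1 z' hz1')).2.2.2.2 δ₀ (hWb z hz1).2
      (hWb z' hz1').2 hδ₀1
    have h3 := hB.2 z z' hz hz'
    have e : lap W z - lap W z' = (F z - F z') - (q z - q z') := by rw [hlapW]; ring
    rw [e]
    refine (abs_sub _ _).trans ?_
    have h4 : L * δ₀ * ‖hes W z - hes W z'‖ ≤ μ / 2 * (N * ‖z - z'‖ ^ α) := by gcongr
    have h5 : 0 ≤ μ * (N * ‖z - z'‖ ^ α) := by positivity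
    linarith
  have hWi : ∀ i, ContDiff ℝ ∞ (pd (stdVec i) W) := fun i => pd_contDiff hW _
  have hdist : ∀ g : En n → ℝ, ContDiff ℝ ∞ g → ∀ r K, 0 ≤ r → r ≤ 1 → 0 ≤ K →
      (∀ i, ∀ x, ‖x‖ ≤ r → |pd (stdVec i) g x| ≤ K) → ∀ z, ‖z‖ ≤ r → |g z - g 0| ≤ n * K := by
    intro g hg r K hr hr1 hK hgi z hz
    have h1 := abs_sub_le_of_abs_pd_le hg (convex_closedBall (0 : En n) r) hK
      (fun i x hx => hgi i x (by simpa using hx)) (x := z) (x' := 0) (by simpa using hz)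
      (by simpa using hr)
    rw [sub_zero] at h1
    have h2 : 0 ≤ n * K := by positivity
    nlinarith
  have hcomp : ∀ (g : En n → ℝ) (x : En n) (i j : Fin n),
      |pd (stdVec i) (pd (stdVec j) g) x| ≤ ‖hes g x‖ := fun g x i j =>
    (norm_le_pi_norm (hes g x i) j).trans (norm_le_pi_norm (hes g x) i)
  have hlin : ∀ (P : En n → ℝ) (x₀ : En n) (ρ N : ℝ), ‖x₀‖ + ρ ≤ 1 / 2 → 0 ≤ N →
      HessBound P α x₀ ρ N → ∀ z z', ‖z - x₀‖ ≤ ρ → ‖z' - x₀‖ ≤ ρ →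
      |fderiv ℝ detRem (hes W z) (hes P z) - fderiv ℝ detRem (hes W z') (hes P z')| ≤
        μ * N * ‖z - z'‖ ^ α := by
    intro P x₀ ρ N hx₀ hN hB z z' hz hz'
    have hz2 := norm_sub_le_of_mem_ball hz hx₀
    have hz2' := norm_sub_le_of_mem_ball hz' hx₀
    have hz1 : ‖z‖ ≤ 1 := by linarith
    have hz1' : ‖z'‖ ≤ 1 := by linarith
    obtain ⟨q1, -, -, q4, -⟩ := hq (hes W z) (hes W z') (hH1 z hz1) (hH1 z' hz1')
    have h1 := norm_clm_apply_sub_le (fderiv ℝ detRem (hes W z)) (fderiv ℝ detRem (hes W z'))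
      (hes P z) (hes P z')
    rw [Real.norm_eq_abs] at h1
    have h2 := hB.2 z z' hz hz'
    have h3 := hB.1 z' hz'
    have h4 := b₁.2 z z' (by simpa using hz2) (by simpa using hz2')
    have h5 := (hWb z hz1).2
    have ht : 0 ≤ ‖z - z'‖ ^ α := by positivity
    refine h1.trans ?_
    calc _ ≤ (L * δ₀) * (N * ‖z - z'‖ ^ α) + (L * (K₁ * δ * ‖z - z'‖ ^ α)) * N := by
          gcongr
          · exact q4.trans (by gcongr)
          · exact q1.trans (by gcongr)
      _ = (L * δ₀) * (N * ‖z - z'‖ ^ α) + (L * (K₁ * δ)) * (N * ‖z - z'‖ ^ α) := by ring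
      _ ≤ μ / 2 * (N * ‖z - z'‖ ^ α) + μ / 2 * (N * ‖z - z'‖ ^ α) := by gcongr
      _ = _ := by ring
  have b₂ : ∀ i, HessBound (pd (stdVec i) W) α 0 (1 / 2 / 2) (K₂ * δ) := by
    intro i
    have hgc : ContDiff ℝ ∞ (fun x => pd (stdVec i) W x - pd (stdVec i) W 0) :=
      (hWi i).sub contDiff_const
    have := hS₂ _ hgc (n * (K₁ * δ)) (2 * n * δ) (by positivity) (by positivity)
      (fun z hz => hdist _ (hWi i) (1 / 2) (K₁ * δ) (by norm_num) (by norm_num) (by positivity)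
        (fun j x hx => (hcomp W x j i).trans (b₁.1 x (by simpa using hx))) z hz) ?_
    · have e : K₂ * δ = C₂ * (n * (K₁ * δ) + 2 * n * δ) := by rw [hK₂]; ring
      rw [e]
      simpa only [HessBound, hes_sub_const] using this
    intro x₀ ρ N hρ hx₀ hN hB z z' hz hz'
    simp only [HessBound, hes_sub_const] at hB
    have h1 := hlin _ x₀ ρ N hx₀ hN hB z z' hz hz'
    have h2 := hFhol (pd (stdVec i) F) (pd_contDiff hFc _) (fun j x hx => (hF x hx j i i).2.1) z z'
      (by linarith [norm_sub_le_of_mem_ball hz hx₀]) (by linarith [norm_sub_le_of_mem_ball hz' hx₀])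
    have e : ∀ x, lap (pd (stdVec i) W) x = pd (stdVec i) F x -
        fderiv ℝ detRem (hes W x) (hes (pd (stdVec i) W) x) := by
      intro x
      rw [← pd_lap hW, hlapW, pd_sub (hFc.sub contDiff_const) hqc, pd_sub_const,
        ← pd_detRem_hes hW]
    rw [lap_sub_const, e, e]
    rw [abs_le] at *
    constructor <;> linarith [h1.1, h1.2, h2.1, h2.2]
  have b₃ : ∀ i j, HessBound (pd (stdVec j) (pd (stdVec i) W)) α 0 (1 / 2 / 2 / 2) (K₃ * δ) := by
    intro i j
    have hgc : ContDiff ℝ ∞ (fun x => pd (stdVec j) (pd (stdVec i) W) x -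
        pd (stdVec j) (pd (stdVec i) W) 0) := (pd_contDiff (hWi i) _).sub contDiff_const
    have := hS₃ _ hgc (n * (K₂ * δ)) ((2 * n + G) * δ) (by positivity) (by positivity)
      (fun z hz => hdist _ (pd_contDiff (hWi i) _) (1 / 2 / 2) (K₂ * δ) (by norm_num) (by norm_num)
        (by positivity) (fun k x hx => (hcomp (pd (stdVec i) W) x k j).trans
          ((b₂ i).1 x (by simpa using hx))) z hz) ?_
    · have e : K₃ * δ = C₃ * (n * (K₂ * δ) + (2 * n + G) * δ) := by rw [hK₃]; ring
      rw [e]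
      simpa only [HessBound, hes_sub_const] using this
    intro x₀ ρ N hρ hx₀ hN hB z z' hz hz'
    simp only [HessBound, hes_sub_const] at hB
    have h1 := hlin _ x₀ ρ N (by linarith) hN hB z z' hz hz'
    have hz2 := norm_sub_le_of_mem_ball hz hx₀
    have hz2' := norm_sub_le_of_mem_ball hz' hx₀
    have h2 := hFhol (pd (stdVec j) (pd (stdVec i) F)) (pd_contDiff (pd_contDiff hFc _) _)
      (fun k x hx => (hF x hx k j i).2.2) z z' (by linarith) (by linarith)
    obtain ⟨-, q2, q3, -, -⟩ := hq (hes W z) (hes W z') (hH1 z (by linarith))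
      (hH1 z' (by linarith))
    have q2' := (hq (hes W z') (hes W z') (hH1 z' (by linarith)) (hH1 z' (by linarith))).2.1
    have hz3 : ‖z - 0‖ ≤ 1 / 2 / 2 := by simpa using hz2
    have hz3' : ‖z' - 0‖ ≤ 1 / 2 / 2 := by simpa using hz2'
    have h3 : |fderiv ℝ (fderiv ℝ detRem) (hes W z) (hes (pd (stdVec j) W) z)
          (hes (pd (stdVec i) W) z) - fderiv ℝ (fderiv ℝ detRem) (hes W z')
          (hes (pd (stdVec j) W) z') (hes (pd (stdVec i) W) z')| ≤ G * δ * ‖z - z'‖ ^ α := by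
      set T := fderiv ℝ (fderiv ℝ (detRem (n := n))) (hes W z)
      set T' := fderiv ℝ (fderiv ℝ (detRem (n := n))) (hes W z')
      set p := hes (pd (stdVec j) W) z
      set p' := hes (pd (stdVec j) W) z'
      set r := hes (pd (stdVec i) W) z
      set r' := hes (pd (stdVec i) W) z'
      set t := ‖z - z'‖ ^ α
      have ht : 0 ≤ t := by positivity
      have k1 := norm_clm_apply_sub_le (T p) (T' p') r r'
      have k2 := norm_clm_apply_sub_le T T' p p'
      have k3 := T.le_opNorm p
      have k4 : ‖p‖ ≤ K₂ * δ := (b₂ j).1 z hz3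
      have k4' : ‖p'‖ ≤ K₂ * δ := (b₂ j).1 z' hz3'
      have k5 : ‖r'‖ ≤ K₂ * δ := (b₂ i).1 z' hz3'
      have k6 : ‖p - p'‖ ≤ K₂ * δ * t := (b₂ j).2 z z' hz3 hz3'
      have k7 : ‖r - r'‖ ≤ K₂ * δ * t := (b₂ i).2 z z' hz3 hz3'
      have k8 := b₁.2 z z' (by linarith) (by linarith)
      have k9 : ‖T - T'‖ ≤ L * (K₁ * δ * t) := q3.trans (by gcongr)
      have hδ1 : δ ≤ 1 := hδ₀.trans hδ₀1
      rw [← Real.norm_eq_abs]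
      refine k1.trans ?_
      calc _ ≤ (L * (K₂ * δ)) * (K₂ * δ * t) +
            (L * (K₂ * δ * t) + L * (K₁ * δ * t) * (K₂ * δ)) * (K₂ * δ) := by
            gcongr
            · exact k3.trans (by gcongr)
            · exact k2.trans (by gcongr)
        _ = (2 * L * K₂ ^ 2) * (δ * δ) * t + (L * K₁ * K₂ ^ 2) * (δ * δ * δ) * t := by ring
        _ ≤ (2 * L * K₂ ^ 2) * δ * t + (L * K₁ * K₂ ^ 2) * δ * t := by
            have d2 : δ * δ ≤ δ := by nlinarith
            have d3 : δ * δ * δ ≤ δ := by nlinarith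
            gcongr
        _ = _ := by rw [hG]; ring
    have e : ∀ x, lap (pd (stdVec j) (pd (stdVec i) W)) x = pd (stdVec j) (pd (stdVec i) F) x -
        (fderiv ℝ (fderiv ℝ detRem) (hes W x) (hes (pd (stdVec j) W) x)
          (hes (pd (stdVec i) W) x) +
        fderiv ℝ detRem (hes W x) (hes (pd (stdVec j) (pd (stdVec i) W)) x)) := by
      intro x
      rw [← pd_lap (hWi i), ← pd_lap hW, hlapW, pd_sub (hFc.sub contDiff_const) hqc, pd_sub_const]
      rw [pd_sub (pd_contDiff hFc _) (pd_contDiff hqc _), ← pd_pd_detRem_hes hW]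
    rw [lap_sub_const, e, e]
    rw [abs_le] at *
    constructor <;> linarith [h1.1, h1.2, h2.1, h2.2, h3.1, h3.2]
  refine ⟨b₁.mono (by norm_num) (by nlinarith), fun i => ⟨(b₂ i).mono (by norm_num) (by nlinarith),
    fun j => (b₃ i j).mono (by norm_num) (by nlinarith)⟩⟩

theorem pd_pd_eq_sum {n : ℕ} {W : En n → ℝ} (hW : ContDiff ℝ ∞ W) (a c x : En n) :
    pd a (pd c W) x = ∑ i, ∑ j, a i * c j * hes W x i j := by
  have e : pd c W = fun y => ∑ j, c j * pd (stdVec j) W y := funext fun y => pd_eq_sum_stdVec W c y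
  have e2 : ∀ b, pd b (pd c W) x = ∑ j, c j * pd b (pd (stdVec j) W) x := by
    intro b
    rw [e, pd_sum (h := fun j y => c j * pd (stdVec j) W y) _
      fun j _ => contDiff_const.mul (pd_contDiff hW _)]
    refine Finset.sum_congr rfl fun j _ => ?_
    rw [pd_const_mul (pd_contDiff hW _)]
  rw [pd_eq_sum_stdVec]
  refine Finset.sum_congr rfl fun i _ => ?_
  rw [e2, Finset.mul_sum]
  refine Finset.sum_congr rfl fun j _ => ?_
  rw [hes]; ring

/-- Second derivatives in an orthonormal basis. -/
def hesB {n : ℕ} (b : OrthonormalBasis (Fin n) ℝ (En n)) (W : En n → ℝ) (x : En n) :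
    Fin n → Fin n → ℝ :=
  fun i j => pd (b i) (pd (b j) W) x

theorem detOne_hesB {n : ℕ} (b : OrthonormalBasis (Fin n) ℝ (En n)) {W : En n → ℝ}
    (hW : ContDiff ℝ ∞ W) (x : En n) : detOne (hesB b W x) = detOne (hes W x) := by
  set U : Matrix (Fin n) (Fin n) ℝ := Matrix.of fun i j => b i j with hU
  have hUU : U * Uᵀ = 1 := by
    ext i j
    have := b.inner_eq_ite j i
    simp only [PiLp.inner_apply, RCLike.inner_apply, conj_trivial] at this
    simp only [hU, Matrix.mul_apply, Matrix.transpose_apply, Matrix.of_apply, Matrix.one_apply]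
    rw [this]
    simp [eq_comm]
  have hH : Matrix.of (hesB b W x) = U * Matrix.of (hes W x) * Uᵀ := by
    ext i j
    simp only [Matrix.of_apply, hesB, pd_pd_eq_sum hW, Matrix.mul_apply, Matrix.transpose_apply, hU,
      Finset.sum_mul]
    rw [Finset.sum_comm]
    refine Finset.sum_congr rfl fun k _ => Finset.sum_congr rfl fun l _ => ?_
    ring
  have h1 : 1 + Matrix.of (hesB b W x) = U * (1 + Matrix.of (hes W x)) * Uᵀ := by
    rw [hH, Matrix.mul_add, Matrix.add_mul, Matrix.mul_one, hUU]
  rw [detOne, detOne, h1, Matrix.det_mul, Matrix.det_mul]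
  have h2 : U.det * Uᵀ.det = 1 := by rw [← Matrix.det_mul, hUU, Matrix.det_one]
  linear_combination (1 + Matrix.of (hes W x)).det * h2

theorem hes_symm {n : ℕ} {W : En n → ℝ} (hW : ContDiff ℝ ∞ W) (x : En n) (i j : Fin n) :
    hes W x i j = hes W x j i := by
  rw [hes, pd_comm hW]; rfl

theorem exists_eigenbasis {n : ℕ} {W : En n → ℝ} (hW : ContDiff ℝ ∞ W) (x : En n) :
    ∃ (b : OrthonormalBasis (Fin n) ℝ (En n)) (lam : Fin n → ℝ),
      ∀ i j, hesB b W x i j = if i = j then lam i - 1 else 0 := by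
  have hH : (Matrix.of (hes W x)).IsHermitian := by
    ext i j
    simp only [Matrix.conjTranspose_apply, Matrix.of_apply, star_trivial]
    exact hes_symm hW x j i
  refine ⟨hH.eigenvectorBasis, fun i => hH.eigenvalues i + 1, fun i j => ?_⟩
  rw [hesB, pd_pd_eq_sum hW]
  have h1 := hH.mulVec_eigenvectorBasis j
  have h2 := hH.eigenvectorBasis.inner_eq_ite j i
  simp only [PiLp.inner_apply, RCLike.inner_apply, conj_trivial] at h2
  have h3 : ∀ k, ∑ l, hes W x k l * hH.eigenvectorBasis j l =
      hH.eigenvalues j * hH.eigenvectorBasis j k := by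
    intro k
    have := congrFun h1 k
    simpa [Matrix.mulVec, dotProduct] using this
  calc ∑ k, ∑ l, hH.eigenvectorBasis i k * hH.eigenvectorBasis j l * hes W x k l
      = ∑ k, hH.eigenvectorBasis i k * ∑ l, hes W x k l * hH.eigenvectorBasis j l := by
        refine Finset.sum_congr rfl fun k _ => ?_
        rw [Finset.mul_sum]
        exact Finset.sum_congr rfl fun l _ => by ring
    _ = hH.eigenvalues j * ∑ k, hH.eigenvectorBasis i k * hH.eigenvectorBasis j k := by
        simp_rw [h3, Finset.mul_sum]
        exact Finset.sum_congr rfl fun l _ => by ring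
    _ = _ := by
        rw [h2]
        by_cases hij : i = j
        · simp [hij]
        · simp [hij, Ne.symm hij]

theorem detOne_diag {n : ℕ} {m : Fin n → Fin n → ℝ} {lam : Fin n → ℝ}
    (hm : ∀ i j, m i j = if i = j then lam i - 1 else 0) : detOne m = ∏ i, lam i := by
  have : 1 + Matrix.of m = Matrix.diagonal lam := by
    ext i j
    by_cases hij : i = j
    · subst hij; simp [hm]
    · simp [hm, hij]
  rw [detOne, this, Matrix.det_diagonal]

theorem detOne_smul_expansion {n : ℕ} (m : Fin n → Fin n → ℝ) :
    ∃ p : Polynomial ℝ, (∀ t : ℝ, detRem (t • m) = t ^ 2 * p.eval t) ∧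
      2 * p.eval 0 = (∑ i, m i i) ^ 2 - ∑ i, ∑ j, m i j * m j i := by
  set N : Matrix (Fin n) (Fin n) ℝ := Matrix.of m
  set p : Polynomial ℝ := (Matrix.det (1 + (Polynomial.X : Polynomial ℝ) • N.map Polynomial.C)
    ).divX.divX
  set q : Polynomial ℝ := (Matrix.det (1 + (Polynomial.X : Polynomial ℝ) •
    (N * N).map Polynomial.C)).divX.divX
  have hp : ∀ t : ℝ, (1 + t • N).det = 1 + N.trace * t + p.eval t * t ^ 2 := fun t =>
    Matrix.det_one_add_smul t N
  have hq : ∀ t : ℝ, (1 + t • (N * N)).det = 1 + (N * N).trace * t + q.eval t * t ^ 2 := fun t =>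
    Matrix.det_one_add_smul t (N * N)
  refine ⟨p, fun t => ?_, ?_⟩
  · have h2 : detOne (t • m) = (1 + t • N).det := rfl
    rw [detRem, h2, hp]
    simp [N, Matrix.trace, ← Finset.mul_sum]
    ring
  have key : ∀ t : ℝ, t ≠ 0 → p.eval t * (1 - N.trace * t) + p.eval (-t) * (1 + N.trace * t)
      - N.trace ^ 2 + p.eval t * p.eval (-t) * t ^ 2 + (N * N).trace
      - q.eval (-t ^ 2) * t ^ 2 = 0 := by
    intro t ht
    have h1 : (1 + t • N) * (1 + (-t) • N) = 1 + (-t ^ 2) • (N * N) := by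
      simp only [mul_add, add_mul, one_mul, mul_one, Matrix.smul_mul, Matrix.mul_smul, smul_smul]
      rw [neg_smul, neg_smul, show -t * t = -t ^ 2 by ring, neg_smul]
      abel
    have h2 := congrArg Matrix.det h1
    rw [Matrix.det_mul, hp, hp, hq] at h2
    have h3 : t ^ 2 ≠ 0 := pow_ne_zero _ ht
    apply mul_left_cancel₀ h3
    linear_combination h2
  set g : ℝ → ℝ := fun t => p.eval t * (1 - N.trace * t) + p.eval (-t) * (1 + N.trace * t)
      - N.trace ^ 2 + p.eval t * p.eval (-t) * t ^ 2 + (N * N).trace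
      - q.eval (-t ^ 2) * t ^ 2 with hg
  have hgc : Continuous g := by
    have hp' : Continuous fun t => p.eval t := p.continuous
    have hq' : Continuous fun t => q.eval t := q.continuous
    fun_prop
  have h0 : g 0 = 0 := by
    have : (fun _ : ℝ => (0 : ℝ)) = g := by
      refine Continuous.ext_on (dense_compl_singleton (0 : ℝ)) continuous_const hgc fun t ht => ?_
      exact (key t ht).symm
    rw [← this]
  have htr : N.trace = ∑ i, m i i := rfl
  have htr2 : (N * N).trace = ∑ i, ∑ j, m i j * m j i := rfl
  rw [← htr, ← htr2]
  simp [hg] at h0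
  linarith

theorem hasDerivAt_comp_path {E : Type*} [NormedAddCommGroup E] [NormedSpace ℝ E] {q : E → ℝ}
    (hq : ContDiff ℝ ∞ q) {γ : ℝ → E} {γ₁ : E} {t : ℝ} (h1 : HasDerivAt γ γ₁ t) :
    HasDerivAt (fun t => q (γ t)) (fderiv ℝ q (γ t) γ₁) t :=
  ((hq.differentiable (by simp) (γ t)).hasFDerivAt).comp_hasDerivAt t h1

theorem hasDerivAt_fderiv_comp_path {E : Type*} [NormedAddCommGroup E] [NormedSpace ℝ E]
    {q : E → ℝ} (hq : ContDiff ℝ ∞ q) {γ γ₁ : ℝ → E} {γ₂ : E} {t : ℝ}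
    (h1 : HasDerivAt γ (γ₁ t) t) (h2 : HasDerivAt γ₁ γ₂ t) :
    HasDerivAt (fun t => fderiv ℝ q (γ t) (γ₁ t))
      (fderiv ℝ (fderiv ℝ q) (γ t) (γ₁ t) (γ₁ t) + fderiv ℝ q (γ t) γ₂) t := by
  have hq1 : ContDiff ℝ ∞ (fderiv ℝ q) := hq.fderiv_right (by simp)
  have h3 : HasDerivAt (fun t => fderiv ℝ q (γ t)) (fderiv ℝ (fderiv ℝ q) (γ t) (γ₁ t)) t :=
    ((hq1.differentiable (by simp) (γ t)).hasFDerivAt).comp_hasDerivAt t h1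
  exact h3.clm_apply h2

theorem fderiv_fderiv_detRem_zero {n : ℕ} (m : Fin n → Fin n → ℝ) :
    fderiv ℝ (fderiv ℝ detRem) 0 m m = (∑ i, m i i) ^ 2 - ∑ i, ∑ j, m i j * m j i := by
  obtain ⟨p, hp, hp0⟩ := detOne_smul_expansion m
  have hline : ∀ t : ℝ, HasDerivAt (fun t : ℝ => t • m) m t := fun t => by
    simpa using (hasDerivAt_id t).smul_const m
  have h1 : ∀ t : ℝ, HasDerivAt (fun t : ℝ => detRem (t • m)) (fderiv ℝ detRem (t • m) m) t :=
    fun t => hasDerivAt_comp_path contDiff_detRem (hline t)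
  have h2 : HasDerivAt (fun t : ℝ => fderiv ℝ detRem (t • m) m)
      (fderiv ℝ (fderiv ℝ detRem) 0 m m) 0 := by
    have := hasDerivAt_fderiv_comp_path (contDiff_detRem (n := n)) (hline 0)
      (hasDerivAt_const (0 : ℝ) m)
    rw [zero_smul, map_zero, add_zero] at this
    exact this
  have h3 : ∀ t : ℝ, HasDerivAt (fun t : ℝ => detRem (t • m))
      (2 * t * p.eval t + t ^ 2 * p.derivative.eval t) t := by
    intro t
    have : (fun t : ℝ => detRem (t • m)) = fun t => t ^ 2 * p.eval t := funext hp
    rw [this]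
    have := ((hasDerivAt_id t).fun_pow 2).fun_mul (p.hasDerivAt t)
    simpa using this
  have h4 : (fun t : ℝ => fderiv ℝ detRem (t • m) m) =
      fun t => 2 * t * p.eval t + t ^ 2 * p.derivative.eval t :=
    funext fun t => (h1 t).unique (h3 t)
  have h5 : HasDerivAt (fun t : ℝ => 2 * t * p.eval t + t ^ 2 * p.derivative.eval t)
      (2 * p.eval 0) 0 := by
    have := (((hasDerivAt_id (0 : ℝ)).const_mul 2).fun_mul (p.hasDerivAt 0)).fun_add
      (((hasDerivAt_id (0 : ℝ)).fun_pow 2).fun_mul (p.derivative.hasDerivAt 0))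
    simpa using this
  rw [h4] at h2
  rw [h2.unique h5, hp0]

/-- The second derivative of `log det D²u` in a basis diagonalising `D²u`. -/
theorem sum_fourth_derivatives {n : ℕ} {W : En n → ℝ} (hW : ContDiff ℝ ∞ W)
    (b : OrthonormalBasis (Fin n) ℝ (En n)) (x e : En n) {lam : Fin n → ℝ} (hpos : ∀ i, 0 < lam i)
    (hdiag : ∀ i j, hesB b W x i j = if i = j then lam i - 1 else 0) :
    ∑ i, pd e (pd e (pd (b i) (pd (b i) W))) x / lam i =
      pd e (pd e fun y => detOne (hes W y)) x / detOne (hes W x) -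
      (pd e (fun y => detOne (hes W y)) x / detOne (hes W x)) ^ 2 +
      ∑ i, ∑ j, pd e (pd (b i) (pd (b j) W)) x ^ 2 / (lam i * lam j) := by
  set P := ∏ i, lam i with hP
  have hP0 : 0 < P := Finset.prod_pos fun i _ => hpos i
  have hFP : detOne (hes W x) = P := by rw [← detOne_hesB b hW, detOne_diag hdiag]
  set F := fun y => detOne (hes W y) with hF
  have hFc : ContDiff ℝ ∞ F := contDiff_detOne.comp (hes_contDiff hW)
  set γ : ℝ → Fin n → Fin n → ℝ := fun t i j =>
    (hesB b W (x + t • e) i j - (if i = j then lam i - 1 else 0)) / lam i with hγ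
  set γ₁ : ℝ → Fin n → Fin n → ℝ := fun t i j =>
    pd e (pd (b i) (pd (b j) W)) (x + t • e) / lam i with hγ₁
  set γ₂ : ℝ → Fin n → Fin n → ℝ := fun t i j =>
    pd e (pd e (pd (b i) (pd (b j) W))) (x + t • e) / lam i with hγ₂
  have hbb : ∀ i j, ContDiff ℝ ∞ (pd (b i) (pd (b j) W)) := fun i j =>
    pd_contDiff (pd_contDiff hW _) _
  have d1 : ∀ t, HasDerivAt γ (γ₁ t) t := fun t => by
    refine hasDerivAt_pi.2 fun i => hasDerivAt_pi.2 fun j => ?_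
    exact ((hasDerivAt_line (hbb i j) x e t).sub_const _).div_const _
  have d2 : ∀ t, HasDerivAt γ₁ (γ₂ t) t := fun t => by
    refine hasDerivAt_pi.2 fun i => hasDerivAt_pi.2 fun j => ?_
    exact (hasDerivAt_line (pd_contDiff (hbb i j) e) x e t).div_const _
  have hγ0 : γ 0 = 0 := by
    funext i j
    simp [hγ, hdiag]
  have hFγ : ∀ t : ℝ, F (x + t • e) = P * (1 + ∑ i, γ t i i + detRem (γ t)) := by
    intro t
    have h1 : (1 + Matrix.of (hesB b W (x + t • e))) =
        Matrix.diagonal lam * (1 + Matrix.of (γ t)) := by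
      ext i j
      rw [Matrix.diagonal_mul]
      have := (hpos i).ne'
      by_cases hij : i = j
      · subst hij
        simp only [Matrix.add_apply, Matrix.one_apply_eq, Matrix.of_apply, hγ, if_true]
        field_simp
        ring
      · simp only [Matrix.add_apply, Matrix.one_apply_ne hij, Matrix.of_apply, hγ, if_neg hij]
        field_simp
        ring
    have h2 : F (x + t • e) = detOne (hesB b W (x + t • e)) := (detOne_hesB b hW _).symm
    rw [h2, detOne, h1, Matrix.det_mul, Matrix.det_diagonal, detRem, detOne]
    ring
  have tr1 : ∀ t, HasDerivAt (fun t => ∑ i, γ t i i) (∑ i, γ₁ t i i) t := fun t =>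
    HasDerivAt.fun_sum fun i _ => hasDerivAt_pi.1 (hasDerivAt_pi.1 (d1 t) i) i
  have tr2 : ∀ t, HasDerivAt (fun t => ∑ i, γ₁ t i i) (∑ i, γ₂ t i i) t := fun t =>
    HasDerivAt.fun_sum fun i _ => hasDerivAt_pi.1 (hasDerivAt_pi.1 (d2 t) i) i
  have e1 : ∀ t : ℝ, pd e F (x + t • e) = P * (∑ i, γ₁ t i i + fderiv ℝ detRem (γ t) (γ₁ t)) := by
    intro t
    refine (hasDerivAt_line hFc x e t).unique ?_
    simp_rw [hFγ]
    exact (((tr1 t).const_add 1).fun_add (hasDerivAt_comp_path contDiff_detRem (d1 t))).const_mul P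
  have e2 : pd e (pd e F) x = P * (∑ i, γ₂ 0 i i +
      ((∑ i, γ₁ 0 i i) ^ 2 - ∑ i, ∑ j, γ₁ 0 i j * γ₁ 0 j i)) := by
    have h1 := hasDerivAt_line (pd_contDiff hFc e) x e 0
    rw [zero_smul, add_zero] at h1
    refine h1.unique ?_
    simp_rw [e1]
    have h2 := hasDerivAt_fderiv_comp_path (contDiff_detRem (n := n)) (d1 0) (d2 0)
    rw [hγ0, fderiv_fderiv_detRem_zero, fderiv_detRem_zero] at h2
    simp only [_root_.zero_apply, add_zero] at h2
    exact ((tr2 0).fun_add h2).const_mul P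
  have e1' := e1 0
  rw [hγ0, fderiv_detRem_zero] at e1'
  simp only [zero_smul, add_zero, _root_.zero_apply] at e1'
  have hsym : ∀ i j, pd e (pd (b i) (pd (b j) W)) x = pd e (pd (b j) (pd (b i) W)) x := by
    intro i j; rw [pd_comm hW]
  have e3 : ∑ i, ∑ j, pd e (pd (b i) (pd (b j) W)) x ^ 2 / (lam i * lam j) =
      ∑ i, ∑ j, γ₁ 0 i j * γ₁ 0 j i := by
    refine Finset.sum_congr rfl fun i _ => Finset.sum_congr rfl fun j _ => ?_
    simp only [hγ₁, zero_smul, add_zero]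
    rw [hsym j i, div_mul_div_comm, sq]
  have e4 : ∑ i, pd e (pd e (pd (b i) (pd (b i) W))) x / lam i = ∑ i, γ₂ 0 i i := by
    simp [hγ₂]
  rw [e3, e4, hFP, e2, e1']
  field_simp
  ring

theorem second_derivative_nonpos {f f₁ : ℝ → ℝ} {f₂ : ℝ}
    (h1 : ∀ᶠ t in nhds (0 : ℝ), HasDerivAt f (f₁ t) t) (h2 : HasDerivAt f₁ f₂ 0)
    (hmax : IsLocalMax f 0) : f₁ 0 = 0 ∧ f₂ ≤ 0 := by
  have h0 : f₁ 0 = 0 := hmax.hasDerivAt_eq_zero h1.self_of_nhds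
  refine ⟨h0, ?_⟩
  by_contra! hpos
  have e1 : deriv f =ᶠ[nhds 0] f₁ := h1.mono fun t ht => ht.deriv
  have e2 : deriv (deriv f) 0 = f₂ := by rw [e1.deriv_eq, h2.deriv]
  have hmin := isLocalMin_of_deriv_deriv_pos (by rw [e2]; exact hpos)
    (by rw [e1.self_of_nhds, h0]) h1.self_of_nhds.continuousAt
  have hconst : f =ᶠ[nhds 0] fun _ => f 0 := by
    filter_upwards [hmax, hmin] with t ht ht' using le_antisymm ht ht'
  have e3 : deriv f =ᶠ[nhds 0] fun _ => 0 := by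
    filter_upwards [hconst.eventuallyEq_nhds] with t ht
    rw [ht.deriv_eq]; simp
  rw [e3.deriv_eq] at e2
  simp at e2
  linarith

theorem test_log_function {η η₁ E E₁ w w₁ : ℝ → ℝ} {η₂ E₂ w₂ p K : ℝ}
    (dη : ∀ t, HasDerivAt η (η₁ t) t) (dη₁ : HasDerivAt η₁ η₂ 0)
    (dE : ∀ t, HasDerivAt E (E₁ t) t) (dE₁ : HasDerivAt E₁ E₂ 0)
    (dw : ∀ t, HasDerivAt w (w₁ t) t) (dw₁ : HasDerivAt w₁ w₂ 0)
    (hη : 0 < η 0) (hE : 0 < E 0)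
    (hmax : IsLocalMax (fun t => p * Real.log (η t) + Real.log (E t) - K * w t) 0) :
    p * (η₁ 0 / η 0) + E₁ 0 / E 0 - K * w₁ 0 = 0 ∧
    p * (η₂ / η 0 - (η₁ 0 / η 0) ^ 2) + (E₂ / E 0 - (E₁ 0 / E 0) ^ 2) - K * w₂ ≤ 0 := by
  refine second_derivative_nonpos
    (f₁ := fun t => p * (η₁ t / η t) + E₁ t / E t - K * w₁ t) ?_ ?_ hmax
  · filter_upwards [(dη 0).continuousAt.eventually_ne hη.ne',
      (dE 0).continuousAt.eventually_ne hE.ne'] with t h1 h2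
    exact ((((dη t).log h1).const_mul p).fun_add ((dE t).log h2)).fun_sub ((dw t).const_mul K)
  · have h1 := dη₁.fun_div (dη 0) hη.ne'
    have h2 := dE₁.fun_div (dE 0) hE.ne'
    have h3 := ((h1.const_mul p).fun_add h2).fun_sub (dw₁.const_mul K)
    have := hη.ne'
    have := hE.ne'
    refine h3.congr_deriv ?_
    field_simp

/-- Gradient bound for a semiconvex function that is uniformly small. -/
theorem abs_pd_le_of_semiconvex {n : ℕ} {W : En n → ℝ} (hW : ContDiff ℝ ∞ W) {κ : ℝ} (hκ : 0 < κ)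
    (hκ8 : κ ≤ 1 / 8) (hb : ∀ x, ‖x‖ ≤ 1 → |W x| ≤ κ ^ 2)
    (hconv : ∀ x a, ‖x‖ ≤ 1 → ‖a‖ = 1 → 0 ≤ 1 + pd a (pd a W) x) {x e : En n} (hx : ‖x‖ ≤ 3 / 4)
    (he : ‖e‖ = 1) : |pd e W x| ≤ 2 * κ := by
  have key : ∀ e : En n, ‖e‖ = 1 → pd e W x ≤ 2 * κ := by
    intro e he
    have hin : ∀ t ∈ Set.Icc (0 : ℝ) (2 * κ), ‖x + t • e‖ ≤ 1 := by
      intro t ht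
      refine (norm_add_le _ _).trans ?_
      rw [norm_smul, he, Real.norm_of_nonneg ht.1]
      linarith [ht.2]
    have d1 : ∀ t : ℝ, HasDerivAt (fun t : ℝ => pd e W (x + t • e) + t)
        (pd e (pd e W) (x + t • e) + 1) t := fun t =>
      (hasDerivAt_line (pd_contDiff hW e) x e t).add (hasDerivAt_id t)
    have d0 : ∀ t : ℝ, HasDerivAt (fun t : ℝ => W (x + t • e) + t ^ 2 / 2 - t * pd e W x)
        (pd e W (x + t • e) + t - pd e W x) t := fun t => by
      have h := ((hasDerivAt_line hW x e t).fun_add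
        (((hasDerivAt_id t).fun_pow 2).div_const 2)).fun_sub
        ((hasDerivAt_id t).mul_const (pd e W x))
      exact h.congr_deriv (by simp)
    have m1 : MonotoneOn (fun t : ℝ => pd e W (x + t • e) + t) (Set.Icc 0 (2 * κ)) := by
      refine monotoneOn_of_deriv_nonneg (convex_Icc _ _)
        (fun t _ => (d1 t).continuousAt.continuousWithinAt)
        (fun t _ => (d1 t).differentiableAt.differentiableWithinAt) fun t ht => ?_
      rw [(d1 t).deriv]
      rw [interior_Icc] at ht
      linarith [hconv _ e (hin t ⟨ht.1.le, ht.2.le⟩) he]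
    have m0 : MonotoneOn (fun t : ℝ => W (x + t • e) + t ^ 2 / 2 - t * pd e W x)
        (Set.Icc 0 (2 * κ)) := by
      refine monotoneOn_of_deriv_nonneg (convex_Icc _ _)
        (fun t _ => (d0 t).continuousAt.continuousWithinAt)
        (fun t _ => (d0 t).differentiableAt.differentiableWithinAt) fun t ht => ?_
      rw [(d0 t).deriv]
      rw [interior_Icc] at ht
      have := m1 (Set.left_mem_Icc.2 (by positivity)) ⟨ht.1.le, ht.2.le⟩ ht.1.le
      simp at this
      linarith
    have h := m0 (Set.left_mem_Icc.2 (by positivity)) (Set.right_mem_Icc.2 (by positivity))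
      (by positivity : (0 : ℝ) ≤ 2 * κ)
    simp only [zero_smul, add_zero, zero_mul, sub_zero] at h
    have h1 := abs_le.1 (hb x (by linarith))
    have h2 := abs_le.1 (hb _ (hin _ (Set.right_mem_Icc.2 (by positivity))))
    have h3 : 2 * κ * pd e W x ≤ 2 * κ * (2 * κ) := by nlinarith
    exact le_of_mul_le_mul_left h3 (by positivity)
  refine abs_le.2 ⟨?_, key e he⟩
  have h := key (-e) (by rw [norm_neg, he])
  have h2 : pd (-e) W x = -pd e W x := by simp [pd]
  linarith

theorem pd_pd_eq_sum_basis {n : ℕ} {W : En n → ℝ} (hW : ContDiff ℝ ∞ W)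
    (b : OrthonormalBasis (Fin n) ℝ (En n)) (a c x : En n) :
    pd a (pd c W) x = ∑ i, ∑ j, ⟪b i, a⟫ * ⟪b j, c⟫ * hesB b W x i j := by
  have lin : ∀ (e : En n) (h : En n → ℝ) (y : En n), pd e h y = ∑ i, ⟪b i, e⟫ * pd (b i) h y := by
    intro e h y
    have := congrArg (fderiv ℝ h y) (b.sum_repr' e)
    rw [map_sum] at this
    simp only [map_smul, smul_eq_mul] at this
    exact this.symm
  have e1 : pd c W = fun y => ∑ j, ⟪b j, c⟫ * pd (b j) W y := funext fun y => lin c W y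
  rw [lin]
  refine Finset.sum_congr rfl fun i _ => ?_
  rw [e1, pd_sum (h := fun j y => ⟪b j, c⟫ * pd (b j) W y) _
      fun j _ => contDiff_const.mul (pd_contDiff hW _), Finset.mul_sum]
  refine Finset.sum_congr rfl fun j _ => ?_
  rw [pd_const_mul (pd_contDiff hW _), hesB]
  ring

theorem continuous_pd_pd {n : ℕ} {W : En n → ℝ} (hW : ContDiff ℝ ∞ W) :
    Continuous fun z : En n × En n => pd z.2 (pd z.2 W) z.1 := by
  simp_rw [pd_pd_eq_sum hW]
  refine continuous_finsetSum _ fun i _ => continuous_finsetSum _ fun j _ => ?_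
  have h1 : Continuous fun x => hes W x i j := (pd_contDiff (pd_contDiff hW _) _).continuous
  have h2 : ∀ i : Fin n, Continuous fun z : En n × En n => z.2 i := fun i => by fun_prop
  exact ((h2 i).mul (h2 j)).mul (h1.comp continuous_fst)

/-- The cut-off function of the Pogorelov argument. -/
def pogCut {n : ℕ} (W : En n → ℝ) (x : En n) : ℝ := 1 / 4 - ‖x‖ ^ 2 / 2 - W x

theorem exists_pogorelov_max {n : ℕ} {W : En n → ℝ} (hW : ContDiff ℝ ∞ W) {κ : ℝ}
    (hκ8 : κ ≤ 1 / 8) (hκ : 0 < κ) (hb : ∀ x, ‖x‖ ≤ 1 → |W x| ≤ κ ^ 2)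
    (hconv : ∀ x a, ‖x‖ ≤ 1 → ‖a‖ = 1 → 0 ≤ 1 + pd a (pd a W) x)
    (hF : ∀ x, ‖x‖ ≤ 1 → 0 < detOne (hes W x))
    {e₀ : En n} (he₀ : ‖e₀‖ = 1) (hpos : 0 ≤ pd e₀ (pd e₀ W) 0) {p : ℕ} (hp : 0 < p) (K : ℝ) :
    ∃ (x : En n) (b : OrthonormalBasis (Fin n) ℝ (En n)) (lam : Fin n → ℝ) (o : Fin n),
      ‖x‖ < 3 / 4 ∧ 0 < pogCut W x ∧ (∀ i j, hesB b W x i j = if i = j then lam i - 1 else 0) ∧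
      (∀ i, 0 < lam i) ∧
      (∀ a : En n, IsLocalMax (fun t : ℝ => (p : ℝ) * Real.log (pogCut W (x + t • a)) +
        Real.log (1 + pd (b o) (pd (b o) W) (x + t • a)) - K * W (x + t • a)) 0) ∧
      pogCut W 0 ^ p * (1 + pd e₀ (pd e₀ W) 0) * Real.exp (-(K * W 0)) ≤
        pogCut W x ^ p * lam o * Real.exp (-(K * W x)) := by
  have hκ2 : κ ^ 2 ≤ 1 / 64 := by nlinarith
  set Ψ : En n × En n → ℝ := fun z =>
    max (pogCut W z.1) 0 ^ p * (1 + pd z.2 (pd z.2 W) z.1) * Real.exp (-(K * W z.1)) with hΨ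
  have hηc : Continuous (pogCut W) := by
    have := hW.continuous
    unfold pogCut
    fun_prop
  have hΨc : Continuous Ψ := by
    have h1 := continuous_pd_pd hW
    have h2 := hW.continuous
    exact ((((hηc.comp continuous_fst).max continuous_const).pow p).mul
      (continuous_const.add h1)).mul
      (Real.continuous_exp.comp (continuous_const.mul (h2.comp continuous_fst)).neg)
  obtain ⟨⟨x, e⟩, ⟨hx, he⟩, hmax⟩ :=
    ((isCompact_closedBall (0 : En n) 1).prod (isCompact_sphere (0 : En n) 1)).exists_isMaxOn
      ⟨(0, e₀), by simp, by simpa using he₀⟩ hΨc.continuousOn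
  simp only [Metric.mem_closedBall, dist_zero_right, mem_sphere_iff_norm, sub_zero] at hx he
  have hmax' : ∀ y a : En n, ‖y‖ ≤ 1 → ‖a‖ = 1 → Ψ (y, a) ≤ Ψ (x, e) := fun y a hy ha =>
    hmax ⟨by simpa using hy, by simpa using ha⟩
  have hη0 : 0 < pogCut W 0 := by
    have := (abs_le.1 (hb 0 (by simp))).2
    simp only [pogCut, norm_zero]; linarith
  have hΨ0 : 0 < Ψ (0, e₀) := by
    have h1 : 0 < max (pogCut W 0) 0 := lt_max_of_lt_left hη0
    simp only [hΨ]; positivity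
  have hΨx : 0 < Ψ (x, e) := hΨ0.trans_le (hmax' 0 e₀ (by simp) he₀)
  have hηx : 0 < pogCut W x := by
    by_contra! h
    simp only [hΨ, max_eq_right h, zero_pow hp.ne', zero_mul, lt_irrefl] at hΨx
  have hx34 : ‖x‖ < 3 / 4 := by
    by_contra! h
    have := (abs_le.1 (hb x hx)).1
    simp only [pogCut] at hηx
    nlinarith
  obtain ⟨b, lam, hdiag⟩ := exists_eigenbasis hW x
  have hlam : ∀ i, lam i = 1 + pd (b i) (pd (b i) W) x := by
    intro i
    have := hdiag i i
    simp only [hesB, if_true] at this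
    linarith
  have hprod : 0 < ∏ i, lam i := by
    rw [← detOne_diag hdiag, detOne_hesB b hW]; exact hF x hx
  have hlam0 : ∀ i, 0 ≤ lam i := fun i => by
    rw [hlam]; exact hconv x _ hx (b.norm_eq_one i)
  have hlampos : ∀ i, 0 < lam i := fun i => (hlam0 i).lt_of_ne fun h =>
    hprod.ne' (Finset.prod_eq_zero (Finset.mem_univ i) h.symm)
  have hquad : ∀ a : En n, ‖a‖ = 1 → 1 + pd a (pd a W) x = ∑ i, ⟪b i, a⟫ ^ 2 * lam i := by
    intro a ha
    have h1 : ∑ i, ⟪b i, a⟫ ^ 2 = 1 := by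
      have := b.sum_sq_norm_inner_right a
      simpa [ha] using this
    rw [pd_pd_eq_sum_basis hW b]
    conv_lhs => rw [← h1]
    rw [← Finset.sum_add_distrib]
    refine Finset.sum_congr rfl fun i _ => ?_
    simp only [hdiag, mul_ite, mul_zero, Finset.sum_ite_eq, Finset.mem_univ, if_true]
    ring
  have : Nonempty (Fin n) := by
    by_contra h
    rw [not_nonempty_iff] at h
    have : e = 0 := Subsingleton.elim _ _
    simp [this] at he
  obtain ⟨o, ho⟩ := Finite.exists_max lam
  have hle : ∀ a : En n, ‖a‖ = 1 → 1 + pd a (pd a W) x ≤ lam o := by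
    intro a ha
    rw [hquad a ha]
    calc ∑ i, ⟪b i, a⟫ ^ 2 * lam i ≤ ∑ i, ⟪b i, a⟫ ^ 2 * lam o :=
          Finset.sum_le_sum fun i _ => mul_le_mul_of_nonneg_left (ho i) (sq_nonneg _)
      _ = lam o := by
          have := b.sum_sq_norm_inner_right a
          rw [← Finset.sum_mul]
          simp only [Real.norm_eq_abs, sq_abs, ha] at this
          rw [this]; ring
  have hval : ∀ y a : En n, ‖y‖ ≤ 1 → ‖a‖ = 1 →
      Ψ (y, a) ≤ pogCut W x ^ p * lam o * Real.exp (-(K * W x)) := by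
    intro y a hy ha
    refine (hmax' y a hy ha).trans ?_
    simp only [hΨ, max_eq_left hηx.le]
    have := hle e he
    gcongr
  refine ⟨x, b, lam, o, hx34, hηx, hdiag, hlampos, fun a => ?_, ?_⟩
  · have hl : Continuous fun t : ℝ => x + t • a := by fun_prop
    have hE : Continuous (pd (b o) (pd (b o) W)) := (pd_contDiff (pd_contDiff hW _) _).continuous
    have n1 : ∀ᶠ t in nhds (0 : ℝ), ‖x + t • a‖ < 1 := by
      refine hl.norm.continuousAt.eventually_lt continuousAt_const ?_
      simp; linarith
    have n2 : ∀ᶠ t in nhds (0 : ℝ), 0 < pogCut W (x + t • a) := by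
      refine continuousAt_const.eventually_lt (hηc.comp hl).continuousAt ?_
      simpa using hηx
    have n3 : ∀ᶠ t in nhds (0 : ℝ), 0 < 1 + pd (b o) (pd (b o) W) (x + t • a) := by
      refine continuousAt_const.eventually_lt
        (continuous_const.add (hE.comp hl)).continuousAt ?_
      have := hlampos o
      rw [hlam] at this
      simpa using this
    have hlog : ∀ A B C : ℝ, 0 < A → 0 < B →
        Real.log (A ^ p * B * Real.exp (-(K * C))) = p * Real.log A + Real.log B - K * C := by
      intro A B C hA hB
      rw [Real.log_mul (by positivity) (Real.exp_pos _).ne', Real.log_mul (by positivity) hB.ne',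
        Real.log_pow, Real.log_exp]
      ring
    filter_upwards [n1, n2, n3] with t h1 h2 h3
    have h4 := hval _ (b o) h1.le (b.norm_eq_one o)
    simp only [hΨ, max_eq_left h2.le] at h4
    have h5 := Real.log_le_log (by positivity) h4
    rw [hlog _ _ _ h2 h3, hlog _ _ _ hηx (hlampos o)] at h5
    simpa [hlam o] using h5
  · have := hval 0 e₀ (by simp) he₀
    simpa only [hΨ, max_eq_left hη0.le] using this

theorem hasDerivAt_pogCut {n : ℕ} {W : En n → ℝ} (hW : ContDiff ℝ ∞ W) (x a : En n) (t : ℝ) :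
    HasDerivAt (fun t : ℝ => pogCut W (x + t • a))
      (-(⟪x, a⟫ + t * ‖a‖ ^ 2) - pd a W (x + t • a)) t := by
  have e : (fun t : ℝ => pogCut W (x + t • a)) = fun t : ℝ =>
      1 / 4 - (‖x‖ ^ 2 + 2 * (t * ⟪x, a⟫) + t ^ 2 * ‖a‖ ^ 2) / 2 - W (x + t • a) := by
    funext t
    rw [pogCut, norm_add_sq_real, norm_smul, inner_smul_right, mul_pow, Real.norm_eq_abs, sq_abs]
  rw [e]
  have h1 : HasDerivAt (fun t : ℝ => ‖x‖ ^ 2 + 2 * (t * ⟪x, a⟫) + t ^ 2 * ‖a‖ ^ 2)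
      (2 * (1 * ⟪x, a⟫) + 2 * t * ‖a‖ ^ 2) t := by
    have := (((hasDerivAt_id t).mul_const ⟪x, a⟫).const_mul 2).const_add (‖x‖ ^ 2)
    have h2 := this.fun_add (((hasDerivAt_id t).fun_pow 2).mul_const (‖a‖ ^ 2))
    exact h2.congr_deriv (by simp)
  exact (((h1.div_const 2).const_sub (1 / 4)).fun_sub (hasDerivAt_line hW x a t)).congr_deriv
    (by ring)

/-- The algebra of the Pogorelov estimate at an interior maximum. -/
theorem pogorelov_algebra {n : ℕ} {κ η p R : ℝ} (hp : 2 ≤ p) (hκ : 0 < κ) (hκ8 : κ ≤ 1 / 8)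
    (hη : 0 < η) (hη1 : η ≤ 1) {lam D B r w : Fin n → ℝ} {A : Fin n → Fin n → ℝ} {o : Fin n}
    (hlam : ∀ i, 0 < lam i) (ho : 1 ≤ lam o) (hAs : ∀ i j, A i j = A j i)
    (hD : ∀ i, D i = A i o)
    (hB : ∑ i, B i / lam i = R + ∑ i, ∑ j, A i j ^ 2 / (lam i * lam j)) (hR : -3 ≤ R)
    (hr : |r o| ≤ 1 / η) (hw : ∀ i, |w i| ≤ 2 * κ)
    (first : ∀ i, p * r i + D i / lam o - κ⁻¹ * w i = 0)
    (second : ∀ i, p * (-lam i / η - r i ^ 2) + (B i / lam o - (D i / lam o) ^ 2) -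
      κ⁻¹ * (lam i - 1) ≤ 0) :
    (∑ i, (lam i)⁻¹) * (1 - 4 * κ) ≤ n + (p * n + p + 3) * κ / η ^ 2 := by
  set T := ∑ i, (lam i)⁻¹ with hT
  have ho0 := hlam o
  set s : Fin n → ℝ := fun i => D i / lam o with hs
  -- sum of the second order inequalities
  have h1 : ∑ i, ((lam i)⁻¹ * (p * (-lam i / η - r i ^ 2) + (B i / lam o - s i ^ 2) -
      κ⁻¹ * (lam i - 1))) ≤ 0 :=
    Finset.sum_nonpos fun i _ => mul_nonpos_of_nonneg_of_nonpos (inv_pos.2 (hlam i)).le (second i)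
  have h2 : ∑ i, ((lam i)⁻¹ * (p * (-lam i / η - r i ^ 2) + (B i / lam o - s i ^ 2) -
      κ⁻¹ * (lam i - 1))) =
      -(p * n / η) - p * (∑ i, r i ^ 2 / lam i) + (∑ i, B i / lam i) / lam o
        - (∑ i, s i ^ 2 / lam i) - κ⁻¹ * n + κ⁻¹ * T := by
    have e : ∀ i, (lam i)⁻¹ * (p * (-lam i / η - r i ^ 2) + (B i / lam o - s i ^ 2) -
      κ⁻¹ * (lam i - 1)) = -(p / η) - p * (r i ^ 2 / lam i) + (B i / lam i) / lam o
        - s i ^ 2 / lam i - κ⁻¹ + κ⁻¹ * (lam i)⁻¹ := by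
      intro i
      have := (hlam i).ne'
      have := ho0.ne'
      field_simp
      ring
    simp only [e, Finset.sum_add_distrib, Finset.sum_sub_distrib, Finset.sum_const,
      Finset.card_univ, Fintype.card_fin, nsmul_eq_mul, ← Finset.mul_sum, ← Finset.sum_div]
    ring
  have h3 : lam o * (∑ i, s i ^ 2 / lam i + ∑ i ∈ Finset.univ.erase o, s i ^ 2 / lam i) ≤
      ∑ i, ∑ j, A i j ^ 2 / (lam i * lam j) := by
    have e1 : ∀ i, lam o * (s i ^ 2 / lam i) = A i o ^ 2 / (lam i * lam o) := by
      intro i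
      rw [hs, ← hD i]
      have := (hlam i).ne'
      field_simp
    have e2 : ∀ i, lam o * (s i ^ 2 / lam i) = A o i ^ 2 / (lam o * lam i) := by
      intro i
      rw [e1, hAs i o, mul_comm (lam i)]
    rw [mul_add, Finset.mul_sum, Finset.mul_sum, ← Finset.add_sum_erase _ _ (Finset.mem_univ o),
      ← Finset.add_sum_erase Finset.univ (fun i => ∑ j, A i j ^ 2 / (lam i * lam j))
        (Finset.mem_univ o)]
    have h4 : lam o * (s o ^ 2 / lam o) + ∑ i ∈ Finset.univ.erase o, lam o * (s i ^ 2 / lam i) ≤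
        ∑ j, A o j ^ 2 / (lam o * lam j) := by
      rw [← Finset.add_sum_erase Finset.univ (fun j => A o j ^ 2 / (lam o * lam j))
        (Finset.mem_univ o)]
      simp only [e2]
      exact le_rfl
    have h5 : ∑ i ∈ Finset.univ.erase o, lam o * (s i ^ 2 / lam i) ≤
        ∑ i ∈ Finset.univ.erase o, ∑ j, A i j ^ 2 / (lam i * lam j) := by
      refine Finset.sum_le_sum fun i _ => ?_
      rw [e1]
      exact Finset.single_le_sum (f := fun j => A i j ^ 2 / (lam i * lam j))
        (fun j _ => by have := hlam i; have := hlam j; positivity) (Finset.mem_univ o)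
    linarith
  have h4 : R / lam o + ∑ i, s i ^ 2 / lam i + ∑ i ∈ Finset.univ.erase o, s i ^ 2 / lam i ≤
      (∑ i, B i / lam i) / lam o := by
    rw [hB, le_div_iff₀ ho0]
    have : (R / lam o) * lam o = R := by field_simp
    nlinarith
  have h5 : -3 ≤ R / lam o := by
    rw [le_div_iff₀ ho0]; nlinarith
  have h6 : ∀ i, p * r i ^ 2 ≤ s i ^ 2 + 4 := by
    intro i
    have e : p * r i = κ⁻¹ * w i - s i := by linarith [first i]
    have hb : |κ⁻¹ * w i| ≤ 2 := by
      rw [abs_mul, abs_of_pos (inv_pos.2 hκ), inv_mul_le_iff₀ hκ]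
      linarith [hw i]
    have hb2 : (κ⁻¹ * w i) ^ 2 ≤ 4 := by
      have := sq_le_sq' (by linarith [(abs_le.1 hb).1]) (abs_le.1 hb).2
      linarith
    have e2 : p * (p * r i ^ 2) ≤ p * (s i ^ 2 + 4) := by
      have : p * (p * r i ^ 2) = (κ⁻¹ * w i - s i) ^ 2 := by rw [← e]; ring
      rw [this]
      nlinarith [sq_nonneg (κ⁻¹ * w i + s i), sq_nonneg (s i)]
    exact le_of_mul_le_mul_left e2 (by linarith)
  have h7 : p * (∑ i, r i ^ 2 / lam i) ≤
      p / η ^ 2 + ∑ i ∈ Finset.univ.erase o, s i ^ 2 / lam i + 4 * T := by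
    rw [← Finset.add_sum_erase _ _ (Finset.mem_univ o), mul_add, Finset.mul_sum]
    have g1 : p * (r o ^ 2 / lam o) ≤ p / η ^ 2 := by
      have : r o ^ 2 ≤ 1 / η ^ 2 := by
        have := sq_le_sq' (by linarith [(abs_le.1 hr).1]) (abs_le.1 hr).2
        rwa [div_pow, one_pow] at this
      have g2 : r o ^ 2 / lam o ≤ r o ^ 2 := div_le_self (sq_nonneg _) ho
      calc p * (r o ^ 2 / lam o) ≤ p * (1 / η ^ 2) :=
            mul_le_mul_of_nonneg_left (g2.trans this) (by linarith)
        _ = _ := by ring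
    have g2 : ∑ i ∈ Finset.univ.erase o, p * (r i ^ 2 / lam i) ≤
        ∑ i ∈ Finset.univ.erase o, (s i ^ 2 / lam i + 4 * (lam i)⁻¹) := by
      refine Finset.sum_le_sum fun i _ => ?_
      have := h6 i
      have h := hlam i
      rw [← div_eq_mul_inv, ← add_div, ← mul_div_assoc]
      gcongr
    have g3 : ∑ i ∈ Finset.univ.erase o, 4 * (lam i)⁻¹ ≤ 4 * T := by
      rw [hT, Finset.mul_sum]
      exact Finset.sum_le_sum_of_subset_of_nonneg (Finset.erase_subset _ _)
        fun i _ _ => by have := hlam i; positivity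
    rw [Finset.sum_add_distrib] at g2
    linarith
  have h8 : κ⁻¹ * T ≤ κ⁻¹ * n + p * n / η + p / η ^ 2 + 3 + 4 * T := by
    rw [h2] at h1; linarith
  have h9 : T ≤ n + κ * (p * n / η + p / η ^ 2 + 3) + 4 * κ * T := by
    have := mul_le_mul_of_nonneg_left h8 hκ.le
    have e : κ * κ⁻¹ = 1 := mul_inv_cancel₀ hκ.ne'
    have e1 : κ * (κ⁻¹ * T) = T := by rw [← mul_assoc, e, one_mul]
    have e2 : κ * (κ⁻¹ * n) = (n : ℝ) := by rw [← mul_assoc, e, one_mul]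
    nlinarith
  have h10 : p * n / η + p / η ^ 2 + 3 ≤ (p * n + p + 3) / η ^ 2 := by
    have hη2 : 0 < η ^ 2 := by positivity
    rw [add_div, add_div]
    have a1 : p * n / η ≤ p * n / η ^ 2 := by
      have : η ^ 2 ≤ η := by nlinarith
      have hn0 : (0 : ℝ) ≤ n := Nat.cast_nonneg n
      gcongr
    have a2 : 3 ≤ 3 / η ^ 2 := by
      rw [le_div_iff₀ hη2]; nlinarith
    linarith
  have h11 := mul_le_mul_of_nonneg_left h10 hκ.le
  have e3 : (p * n + p + 3) * κ / η ^ 2 = κ * ((p * n + p + 3) / η ^ 2) := by ring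
  rw [e3]
  nlinarith

theorem sum_inv_sub_card_add_log_prod {n : ℕ} {lam : Fin n → ℝ} (hlam : ∀ i, 0 < lam i)
    (o : Fin n) :
    (lam o)⁻¹ - 1 + Real.log (lam o) ≤ ∑ i, (lam i)⁻¹ - n + Real.log (∏ i, lam i) := by
  have e : ∑ i, (lam i)⁻¹ - n + Real.log (∏ i, lam i) =
      ∑ i, ((lam i)⁻¹ - 1 + Real.log (lam i)) := by
    rw [Real.log_prod fun i _ => (hlam i).ne']
    simp [Finset.sum_add_distrib]
  rw [e]
  refine Finset.single_le_sum (f := fun i => (lam i)⁻¹ - 1 + Real.log (lam i))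
    (fun i _ => ?_) (Finset.mem_univ o)
  have := Real.log_le_sub_one_of_pos (inv_pos.2 (hlam i))
  rw [Real.log_inv] at this
  linarith

theorem le_prod_mul_pow_sum_inv {n : ℕ} {lam : Fin n → ℝ} (hlam : ∀ i, 0 < lam i) (o : Fin n) :
    lam o ≤ (∏ i, lam i) * (∑ i, (lam i)⁻¹) ^ (n - 1) := by
  have h1 : ∏ i ∈ Finset.univ.erase o, (lam i)⁻¹ ≤ (∑ i, (lam i)⁻¹) ^ (n - 1) := by
    have hc : (Finset.univ.erase o).card = n - 1 := by simp
    rw [← hc, ← Finset.prod_const]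
    refine Finset.prod_le_prod (fun i _ => (inv_pos.2 (hlam i)).le) fun i _ => ?_
    exact Finset.single_le_sum (f := fun i => (lam i)⁻¹) (fun i _ => (inv_pos.2 (hlam i)).le)
      (Finset.mem_univ i)
  have h2 : lam o = (∏ i, lam i) * ∏ i ∈ Finset.univ.erase o, (lam i)⁻¹ := by
    rw [← Finset.mul_prod_erase _ _ (Finset.mem_univ o), mul_assoc, ← Finset.prod_mul_distrib,
      Finset.prod_congr rfl fun i _ => mul_inv_cancel₀ (hlam i).ne']
    simp
  calc lam o = _ := h2
    _ ≤ _ := mul_le_mul_of_nonneg_left h1 (Finset.prod_pos fun i _ => hlam i).le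

/-- The hypotheses under which the Pogorelov estimate is run on the unit ball. -/
structure NearQuadratic {n : ℕ} (W : En n → ℝ) (κ : ℝ) : Prop where
  smooth : ContDiff ℝ ∞ W
  pos : 0 < κ
  le_eighth : κ ≤ 1 / 8
  bound : ∀ x, ‖x‖ ≤ 1 → |W x| ≤ κ ^ 2
  semiconvex : ∀ x a, ‖x‖ ≤ 1 → ‖a‖ = 1 → 0 ≤ 1 + pd a (pd a W) x
  det_sub_one : ∀ x, ‖x‖ ≤ 1 → |detOne (hes W x) - 1| ≤ κ ^ 2
  det_deriv : ∀ x e, ‖x‖ ≤ 1 → ‖e‖ = 1 → |pd e (fun y => detOne (hes W y)) x| ≤ 1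
  det_deriv₂ : ∀ x e, ‖x‖ ≤ 1 → ‖e‖ = 1 → |pd e (pd e fun y => detOne (hes W y)) x| ≤ 1

theorem NearQuadratic.pogorelov {n : ℕ} {W : En n → ℝ} {κ : ℝ} (h : NearQuadratic W κ)
    {e₀ : En n} (he₀ : ‖e₀‖ = 1) (hpos : 0 ≤ pd e₀ (pd e₀ W) 0) {p : ℕ} (hp : 2 ≤ p) :
    ∃ η T f lam : ℝ, 0 < η ∧ η ≤ 1 / 4 + κ ^ 2 ∧ 0 < lam ∧ |f - 1| ≤ κ ^ 2 ∧
      (1 / 4 - κ ^ 2) ^ p * Real.exp (-κ) * (1 + pd e₀ (pd e₀ W) 0) ≤ η ^ p * Real.exp κ * lam ∧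
      lam⁻¹ - 1 + Real.log lam ≤ T - n + Real.log f ∧
      lam ≤ f * T ^ (n - 1) ∧ 0 ≤ T ∧
      (1 ≤ lam → T * (1 - 4 * κ) ≤ n + (p * n + p + 3) * κ / η ^ 2) := by
  obtain ⟨hW, hκ, hκ8, hb, hconv, hdet, hdet1, hdet2⟩ := h
  have hκ2 : κ ^ 2 ≤ 1 / 64 := by nlinarith
  have hFpos : ∀ x, ‖x‖ ≤ 1 → 63 / 64 ≤ detOne (hes W x) := fun x hx => by
    linarith [(abs_le.1 (hdet x hx)).1]
  obtain ⟨x, b, lam, o, hx, hη, hdiag, hlam, hmax, hval⟩ := exists_pogorelov_max hW hκ8 hκ hb hconv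
    (fun x hx => by linarith [hFpos x hx]) he₀ hpos (by omega : 0 < p) κ⁻¹
  have hx1 : ‖x‖ ≤ 1 := by linarith
  have hf : detOne (hes W x) = ∏ i, lam i := by rw [← detOne_hesB b hW, detOne_diag hdiag]
  have hbx := abs_le.1 (hb x hx1)
  have hb0 := abs_le.1 (hb 0 (by simp))
  have hηle : pogCut W x ≤ 1 / 4 + κ ^ 2 := by
    rw [pogCut]; nlinarith [sq_nonneg ‖x‖]
  have hexp : ∀ y, |W y| ≤ κ ^ 2 → |κ⁻¹ * W y| ≤ κ := by
    intro y hy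
    rw [abs_mul, abs_of_pos (inv_pos.2 hκ), inv_mul_le_iff₀ hκ]
    linarith
  refine ⟨pogCut W x, ∑ i, (lam i)⁻¹, ∏ i, lam i, lam o, hη, hηle, hlam o, ?_, ?_,
    sum_inv_sub_card_add_log_prod hlam o, le_prod_mul_pow_sum_inv hlam o,
    Finset.sum_nonneg fun i _ => (inv_pos.2 (hlam i)).le, fun ho => ?_⟩
  · rw [← hf]; exact hdet x hx1
  · have g0 : 1 / 4 - κ ^ 2 ≤ pogCut W 0 := by
      simp only [pogCut, norm_zero]; linarith
    have g1 : -κ ≤ -(κ⁻¹ * W 0) := by linarith [(abs_le.1 (hexp 0 (hb 0 (by simp)))).2]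
    have g2 : -(κ⁻¹ * W x) ≤ κ := by linarith [(abs_le.1 (hexp x (hb x hx1))).1]
    have g3 : 0 ≤ 1 / 4 - κ ^ 2 := by linarith
    have hlo := hlam o
    have g4 : 0 ≤ pogCut W 0 := g3.trans g0
    calc (1 / 4 - κ ^ 2) ^ p * Real.exp (-κ) * (1 + pd e₀ (pd e₀ W) 0)
        ≤ pogCut W 0 ^ p * Real.exp (-(κ⁻¹ * W 0)) * (1 + pd e₀ (pd e₀ W) 0) := by gcongr
      _ = pogCut W 0 ^ p * (1 + pd e₀ (pd e₀ W) 0) * Real.exp (-(κ⁻¹ * W 0)) := by ring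
      _ ≤ pogCut W x ^ p * lam o * Real.exp (-(κ⁻¹ * W x)) := hval
      _ ≤ pogCut W x ^ p * lam o * Real.exp κ := by gcongr
      _ = _ := by ring
  · have hgrad : ∀ a : En n, ‖a‖ = 1 → |pd a W x| ≤ 2 * κ := fun a ha =>
      abs_pd_le_of_semiconvex hW hκ hκ8 hb hconv (by linarith) ha
    have hE : ContDiff ℝ ∞ (pd (b o) (pd (b o) W)) := pd_contDiff (pd_contDiff hW _) _
    have hEo : 1 + pd (b o) (pd (b o) W) x = lam o := by
      have := hdiag o o
      simp only [hesB, if_true] at this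
      linarith
    have htest : ∀ i, (p : ℝ) * ((-⟪x, b i⟫ - pd (b i) W x) / pogCut W x) +
        pd (b i) (pd (b o) (pd (b o) W)) x / lam o - κ⁻¹ * pd (b i) W x = 0 ∧
        (p : ℝ) * ((-1 - pd (b i) (pd (b i) W) x) / pogCut W x -
          ((-⟪x, b i⟫ - pd (b i) W x) / pogCut W x) ^ 2) +
        (pd (b i) (pd (b i) (pd (b o) (pd (b o) W))) x / lam o -
          (pd (b i) (pd (b o) (pd (b o) W)) x / lam o) ^ 2) -
        κ⁻¹ * pd (b i) (pd (b i) W) x ≤ 0 := by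
      intro i
      have dη₁ : HasDerivAt (fun t : ℝ => -(⟪x, b i⟫ + t * ‖b i‖ ^ 2) - pd (b i) W (x + t • b i))
          (-1 - pd (b i) (pd (b i) W) x) 0 := by
        have h1 := (((hasDerivAt_id (0 : ℝ)).mul_const (‖b i‖ ^ 2)).const_add ⟪x, b i⟫).fun_neg
        have h2 := hasDerivAt_line (pd_contDiff hW (b i)) x (b i) 0
        refine (h1.fun_sub h2).congr_deriv ?_
        simp
      have dE₁ := hasDerivAt_line (pd_contDiff hE (b i)) x (b i) 0
      have dw₁ := hasDerivAt_line (pd_contDiff hW (b i)) x (b i) 0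
      have h := test_log_function (fun t => hasDerivAt_pogCut hW x (b i) t) dη₁
        (fun t => (hasDerivAt_line hE x (b i) t).const_add 1) dE₁
        (fun t => hasDerivAt_line hW x (b i) t) dw₁ (by simpa using hη)
        (by simpa [hEo] using hlam o) (hmax (b i))
      simpa [hEo] using h
    have hlamE : ∀ i, pd (b i) (pd (b i) W) x = lam i - 1 := by
      intro i
      have := hdiag i i
      simpa only [hesB, if_true] using this
    have hFsum := sum_fourth_derivatives hW b x (b o) hlam hdiag
    refine pogorelov_algebra (A := fun i j => pd (b o) (pd (b i) (pd (b j) W)) x)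
      (B := fun i => pd (b i) (pd (b i) (pd (b o) (pd (b o) W))) x)
      (D := fun i => pd (b i) (pd (b o) (pd (b o) W)) x)
      (r := fun i => (-⟪x, b i⟫ - pd (b i) W x) / pogCut W x)
      (w := fun i => pd (b i) W x) (o := o)
      (R := pd (b o) (pd (b o) fun y => detOne (hes W y)) x / detOne (hes W x) -
      (pd (b o) (fun y => detOne (hes W y)) x / detOne (hes W x)) ^ 2)
      (by exact_mod_cast hp) hκ hκ8 hη (by linarith) hlam ho
      (fun i j => by simp only [pd_comm hW]) (fun i => ?_) ?_ ?_ ?_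
      (fun i => hgrad _ (b.norm_eq_one i)) (fun i => (htest i).1) (fun i => ?_)
    · exact congrFun (pd_comm (pd_contDiff hW (b o)) (b i) (b o)) x
    · rw [← hFsum]
      refine Finset.sum_congr rfl fun i _ => ?_
      congr 1
      have c1 : pd (b i) (pd (b o) (pd (b o) W)) = pd (b o) (pd (b o) (pd (b i) W)) := by
        rw [pd_comm (pd_contDiff hW (b o)), pd_comm hW (b i)]
      rw [c1, pd_comm (pd_contDiff (pd_contDiff hW _) _),
        pd_comm (pd_contDiff hW (b i)) (b i)]
    · have hF := hFpos x hx1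
      have hF0 : 0 < detOne (hes W x) := by linarith
      have a1 := (abs_le.1 (hdet2 x (b o) hx1 (b.norm_eq_one o))).1
      have a2 := hdet1 x (b o) hx1 (b.norm_eq_one o)
      have g1 : -(64 / 63) ≤ pd (b o) (pd (b o) fun y => detOne (hes W y)) x /
          detOne (hes W x) := by
        rw [le_div_iff₀ hF0]; linarith
      have g2 : |pd (b o) (fun y => detOne (hes W y)) x / detOne (hes W x)| ≤ 64 / 63 := by
        rw [abs_div, abs_of_pos hF0, div_le_iff₀ hF0]; linarith
      have g3 := sq_le_sq' (by linarith [(abs_le.1 g2).1]) (abs_le.1 g2).2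
      norm_num at g3 g1 ⊢
      linarith
    · rw [abs_div, abs_of_pos hη]
      gcongr
      have a1 := hgrad (b o) (b.norm_eq_one o)
      have a2 : |⟪x, b o⟫| ≤ 3 / 4 := by
        refine (abs_real_inner_le_norm _ _).trans ?_
        rw [b.norm_eq_one, mul_one]; exact hx.le
      have a3 := abs_sub (-⟪x, b o⟫) (pd (b o) W x)
      rw [abs_neg] at a3
      linarith
    · have := (htest i).2
      simp only [hlamE] at this ⊢
      have e : (-1 - (lam i - 1)) / pogCut W x = -lam i / pogCut W x := by ring
      rw [e] at this
      exact this

theorem inv_sub_one_add_log_mono {a b : ℝ} (ha : 1 ≤ a) (hab : a ≤ b) :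
    a⁻¹ - 1 + Real.log a ≤ b⁻¹ - 1 + Real.log b := by
  have ha0 : 0 < a := by linarith
  have hb0 : 0 < b := by linarith
  have h := Real.log_le_sub_one_of_pos (div_pos ha0 hb0)
  rw [Real.log_div ha0.ne' hb0.ne'] at h
  have h2 : 0 ≤ b⁻¹ - a⁻¹ + (1 - a / b) := by
    have : b⁻¹ - a⁻¹ + (1 - a / b) = (b - a) * (a - 1) / (a * b) := by
      field_simp; ring
    rw [this]
    have h3 : 0 ≤ b - a := by linarith
    have h4 : 0 ≤ a - 1 := by linarith
    positivity
  linarith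

theorem inv_sub_one_add_log_pos {a : ℝ} (ha : 1 < a) : 0 < a⁻¹ - 1 + Real.log a := by
  have ha0 : 0 < a := by linarith
  have := Real.log_lt_sub_one_of_pos (inv_pos.2 ha0) (by
    rw [ne_eq, inv_eq_one]; exact ha.ne')
  rw [Real.log_inv] at this
  linarith

set_option maxHeartbeats 1000000 in
theorem second_derivative_upper_bound {n : ℕ} (hn : 0 < n) {ν : ℝ} (hν : 0 < ν) :
    ∃ κ₀ > 0, ∀ (W : En n → ℝ) (κ : ℝ), NearQuadratic W κ → κ ≤ κ₀ →
      ∀ e : En n, ‖e‖ = 1 → pd e (pd e W) 0 ≤ ν := by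
  set p : ℕ := 2 * n with hp
  set P : ℝ := p * n + p + 3 with hP
  have hP0 : 0 < P := by positivity
  set m₀ : ℝ := (15 / 64) ^ p * Real.exp (-1) with hm₀
  have hm0 : 0 < m₀ := by positivity
  set Q : ℝ := Real.exp 1 * (2 * (2 * (n + P)) ^ (n - 1)) with hQ
  have hQ0 : 0 < Q := by positivity
  set c : ℝ := m₀ / Q with hc
  have hc0 : 0 < c := by positivity
  set ratio : ℝ → ℝ := fun κ =>
    (1 / 4 + κ ^ 2) ^ p * Real.exp κ / ((1 / 4 - κ ^ 2) ^ p * Real.exp (-κ)) with hratio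
  set σ : ℝ → ℝ := fun κ => (n + P * κ / c) / (1 - 4 * κ) - n + κ ^ 2 with hσ
  have c1 : ContinuousAt (fun κ => ratio κ * (1 + ν / 2)) 0 := by
    refine ContinuousAt.mul (ContinuousAt.div (by fun_prop) (by fun_prop) ?_) continuousAt_const
    simp
  have c2 : ContinuousAt σ 0 := by
    refine ContinuousAt.add (ContinuousAt.sub (ContinuousAt.div (by fun_prop) (by fun_prop) ?_)
      continuousAt_const) (by fun_prop)
    simp
  have e1 := c1.eventually_lt_const (u := 1 + ν) (by simp [hratio]; linarith)
  have e2 := c2.eventually_lt_const (u := (1 + ν / 2)⁻¹ - 1 + Real.log (1 + ν / 2))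
    (by simpa [hσ] using inv_sub_one_add_log_pos (by linarith : 1 < 1 + ν / 2))
  obtain ⟨δ, hδ, hδ'⟩ := Metric.eventually_nhds_iff.1 (e1.and e2)
  refine ⟨δ / 2, by positivity, fun W κ h hκδ e he => ?_⟩
  have hκ := h.pos
  have hκ8 := h.le_eighth
  have hκ2 : κ ^ 2 ≤ 1 / 64 := by nlinarith
  obtain ⟨hr, hs⟩ := hδ' (y := κ) (by
    rw [Real.dist_eq, sub_zero, abs_of_pos hκ]; linarith)
  by_contra! hlt
  obtain ⟨η, T, f, lam, hη, hη1, hlam, hf, hval, hlog, hlamT, hT0, hT⟩ :=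
    h.pogorelov he (hν.le.trans hlt.le) (p := p) (by omega)
  have hD : 0 < (1 / 4 - κ ^ 2) ^ p * Real.exp (-κ) := by
    have : 0 < 1 / 4 - κ ^ 2 := by linarith
    positivity
  have hη2 : η ≤ 1 := by linarith
  have hbound : lam ≤ 1 + ν / 2 → False := by
    intro hl
    have h1 : η ^ p * Real.exp κ * lam ≤ (1 / 4 + κ ^ 2) ^ p * Real.exp κ * (1 + ν / 2) := by
      gcongr
    have h2 : ratio κ * (1 + ν / 2) * ((1 / 4 - κ ^ 2) ^ p * Real.exp (-κ)) =
        (1 / 4 + κ ^ 2) ^ p * Real.exp κ * (1 + ν / 2) := by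
      simp only [hratio]
      rw [div_mul_eq_mul_div, div_mul_cancel₀ _ hD.ne']
    have h3 : (1 / 4 - κ ^ 2) ^ p * Real.exp (-κ) * (1 + ν) ≤
        ratio κ * (1 + ν / 2) * ((1 / 4 - κ ^ 2) ^ p * Real.exp (-κ)) := by
      rw [h2]
      refine le_trans ?_ (hval.trans h1)
      gcongr
    nlinarith
  rcases le_total lam 1 with hl | hl
  · exact hbound (by linarith)
  have hT1 := hT hl
  -- a universal lower bound for the cut-off
  have hf2 : f ≤ 2 := by linarith [(abs_le.1 hf).2]
  have hf0 : 0 < f := by linarith [(abs_le.1 hf).1]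
  have hηsq : 0 < η ^ 2 := by positivity
  have hηsq1 : η ^ 2 ≤ 1 := by nlinarith
  have hTb : T ≤ 2 * (n + P) / η ^ 2 := by
    have a1 : T * (1 / 2) ≤ T * (1 - 4 * κ) := by
      apply mul_le_mul_of_nonneg_left _ hT0; linarith
    have a2 : (n : ℝ) ≤ n / η ^ 2 := by
      rw [le_div_iff₀ hηsq]
      exact mul_le_of_le_one_right (Nat.cast_nonneg n) hηsq1
    have a3 : P * κ / η ^ 2 ≤ P / η ^ 2 := by
      gcongr
      exact mul_le_of_le_one_right hP0.le (by linarith)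
    have : 2 * (n + P) / η ^ 2 = 2 * (n / η ^ 2 + P / η ^ 2) := by ring
    rw [this]
    linarith
  have hcη : c ≤ η ^ 2 := by
    have b1 : m₀ ≤ (1 / 4 - κ ^ 2) ^ p * Real.exp (-κ) * (1 + pd e (pd e W) 0) := by
      have d1 : m₀ ≤ (1 / 4 - κ ^ 2) ^ p * Real.exp (-κ) := by
        have d0 : 0 ≤ 1 / 4 - κ ^ 2 := by linarith
        rw [hm₀]
        gcongr
        · linarith
        · linarith
      exact d1.trans (le_mul_of_one_le_right hD.le (by linarith))
    have b2 : lam ≤ 2 * (2 * (n + P) / η ^ 2) ^ (n - 1) := by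
      refine hlamT.trans ?_
      gcongr
    have b3 : η ^ p * Real.exp κ * lam ≤
        η ^ p * Real.exp 1 * (2 * (2 * (n + P) / η ^ 2) ^ (n - 1)) := by
      gcongr
      linarith
    have b4 : η ^ p * Real.exp 1 * (2 * (2 * (n + P) / η ^ 2) ^ (n - 1)) = Q * η ^ 2 := by
      have hpp : η ^ p = (η ^ 2) ^ (n - 1) * η ^ 2 := by
        rw [← pow_succ, ← pow_mul, hp]
        congr 2
        omega
      rw [hpp, div_pow, hQ]
      field_simp
    rw [hc, div_le_iff₀ hQ0]
    linarith
  have hTσ : T - n + Real.log f ≤ σ κ := by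
    have a0 : 0 < 1 - 4 * κ := by linarith
    have a1 : T ≤ (n + P * κ / c) / (1 - 4 * κ) := by
      rw [le_div_iff₀ a0]
      refine hT1.trans ?_
      gcongr
    have a2 : Real.log f ≤ κ ^ 2 :=
      (Real.log_le_sub_one_of_pos hf0).trans (abs_le.1 hf).2
    simp only [hσ]
    linarith
  refine hbound ?_
  by_contra! hgt
  have := inv_sub_one_add_log_mono (by linarith : 1 ≤ 1 + ν / 2) hgt.le
  linarith

/-- Smallness of a convex solution forces smallness of its Hessian. -/
theorem hes_small_of_nearQuadratic {n : ℕ} (hn : 0 < n) {μ : ℝ} (hμ : 0 < μ) :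
    ∃ κ₀ > 0, ∀ (W : En n → ℝ) (κ : ℝ), NearQuadratic W κ → κ ≤ κ₀ →
      ∀ i j, |hes W 0 i j| ≤ μ := by
  set μ' := μ / n with hμ'
  have hn0 : (0 : ℝ) < n := by exact_mod_cast hn
  have hμ'0 : 0 < μ' := by positivity
  obtain ⟨ν, hν, hνμ, hνlow⟩ : ∃ ν > 0, ν ≤ μ' ∧ (1 - μ') * (1 + ν) ^ (n - 1) < 1 - ν ^ 2 := by
    have c1 : ContinuousAt (fun ν : ℝ => (1 - μ') * (1 + ν) ^ (n - 1) - (1 - ν ^ 2)) 0 := by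
      fun_prop
    have e1 := c1.eventually_lt_const (u := 0) (by simp; linarith)
    obtain ⟨δ, hδ, hδ'⟩ := Metric.eventually_nhds_iff.1 e1
    refine ⟨min (δ / 2) μ', by positivity, min_le_right _ _, ?_⟩
    have hm : 0 < min (δ / 2) μ' := by positivity
    have := hδ' (y := min (δ / 2) μ') (by
      rw [Real.dist_eq, sub_zero, abs_of_pos hm]
      linarith [min_le_left (δ / 2) μ'])
    linarith
  obtain ⟨κ₁, hκ₁, hup⟩ := second_derivative_upper_bound hn hν
  refine ⟨min κ₁ ν, by positivity, fun W κ h hκ i j => ?_⟩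
  obtain ⟨b, lam, hdiag⟩ := exists_eigenbasis h.smooth (0 : En n)
  have hlamE : ∀ k, pd (b k) (pd (b k) W) 0 = lam k - 1 := by
    intro k
    have := hdiag k k
    simpa only [hesB, if_true] using this
  have hle : ∀ k, lam k ≤ 1 + ν := fun k => by
    have := hup W κ h (hκ.trans (min_le_left _ _)) (b k) (b.norm_eq_one k)
    rw [hlamE] at this
    linarith
  have h0 : ∀ k, 0 ≤ lam k := fun k => by
    have := h.semiconvex 0 (b k) (by simp) (b.norm_eq_one k)
    rw [hlamE] at this
    linarith
  have hprod : 1 - ν ^ 2 ≤ ∏ k, lam k := by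
    rw [← detOne_diag hdiag, detOne_hesB b h.smooth]
    have h1 := (abs_le.1 (h.det_sub_one 0 (by simp))).1
    have h2 : κ ≤ ν := hκ.trans (min_le_right _ _)
    have h3 := h.pos
    nlinarith
  have hge : ∀ k, 1 - μ' ≤ lam k := by
    intro k
    by_contra! hlt
    have h1 : ∏ l ∈ Finset.univ.erase k, lam l ≤ (1 + ν) ^ (n - 1) := by
      have hc : (Finset.univ.erase k).card = n - 1 := by simp
      rw [← hc, ← Finset.prod_const]
      exact Finset.prod_le_prod (fun l _ => h0 l) fun l _ => hle l
    rw [← Finset.mul_prod_erase _ _ (Finset.mem_univ k)] at hprod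
    have h2 : lam k * ∏ l ∈ Finset.univ.erase k, lam l ≤ lam k * (1 + ν) ^ (n - 1) :=
      mul_le_mul_of_nonneg_left h1 (h0 k)
    have h3 : lam k * (1 + ν) ^ (n - 1) ≤ (1 - μ') * (1 + ν) ^ (n - 1) := by
      have : 0 < (1 + ν) ^ (n - 1) := by positivity
      gcongr
    linarith
  have hunit : ∀ k l, |⟪b k, stdVec l⟫| ≤ 1 := fun k l => by
    refine (abs_real_inner_le_norm _ _).trans ?_
    simp [stdVec]
  rw [hes, pd_pd_eq_sum_basis h.smooth b]
  simp only [hdiag, mul_ite, mul_zero, Finset.sum_ite_eq, Finset.mem_univ, if_true]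
  calc _ ≤ ∑ k, |⟪b k, stdVec i⟫ * ⟪b k, stdVec j⟫ * (lam k - 1)| := Finset.abs_sum_le_sum_abs _ _
    _ ≤ ∑ _k : Fin n, μ' := by
        refine Finset.sum_le_sum fun k _ => ?_
        rw [abs_mul, abs_mul]
        have h1 : |lam k - 1| ≤ μ' := abs_le.2 ⟨by linarith [hge k], by linarith [hle k]⟩
        calc |⟪b k, stdVec i⟫| * |⟪b k, stdVec j⟫| * |lam k - 1| ≤ 1 * 1 * μ' := by
              gcongr
              · exact hunit k i
              · exact hunit k j
          _ = μ' := by ring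
    _ = μ := by
        rw [Finset.sum_const, Finset.card_univ, Fintype.card_fin, nsmul_eq_mul, hμ']
        field_simp

/-- The quadratic rescaling `y ↦ r⁻² W(x₀ + r y)`. -/
def rescale {n : ℕ} (W : En n → ℝ) (x₀ : En n) (r : ℝ) : En n → ℝ :=
  fun y => (r ^ 2)⁻¹ * W (x₀ + r • y)

theorem rescale_contDiff {n : ℕ} {W : En n → ℝ} (hW : ContDiff ℝ ∞ W) (x₀ : En n) (r : ℝ) :
    ContDiff ℝ ∞ (rescale W x₀ r) :=
  contDiff_const.mul (contDiff_comp_affine hW x₀ r)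

theorem pd_rescale {n : ℕ} {W : En n → ℝ} (hW : ContDiff ℝ ∞ W) (x₀ a : En n) {r : ℝ}
    (hr : r ≠ 0) : pd a (rescale W x₀ r) = fun y => r⁻¹ * pd a W (x₀ + r • y) := by
  unfold rescale
  rw [pd_const_mul (contDiff_comp_affine hW x₀ r), pd_comp_affine hW]
  funext y
  field_simp

theorem pd_pd_rescale {n : ℕ} {W : En n → ℝ} (hW : ContDiff ℝ ∞ W) (x₀ a b : En n) {r : ℝ}
    (hr : r ≠ 0) : pd a (pd b (rescale W x₀ r)) = fun y => pd a (pd b W) (x₀ + r • y) := by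
  rw [pd_rescale hW x₀ b hr, pd_const_mul (contDiff_comp_affine (pd_contDiff hW b) x₀ r),
    pd_comp_affine (pd_contDiff hW b)]
  funext y
  field_simp

theorem hes_rescale {n : ℕ} {W : En n → ℝ} (hW : ContDiff ℝ ∞ W) (x₀ : En n) {r : ℝ}
    (hr : r ≠ 0) (y : En n) : hes (rescale W x₀ r) y = hes W (x₀ + r • y) := by
  funext i j
  simp only [hes, pd_pd_rescale hW x₀ _ _ hr]

/-- The function `det (1 + D²W)`. -/
def detHes {n : ℕ} (W : En n → ℝ) : En n → ℝ := fun y => detOne (hes W y)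

theorem detHes_contDiff {n : ℕ} {W : En n → ℝ} (hW : ContDiff ℝ ∞ W) :
    ContDiff ℝ ∞ (detHes W) := contDiff_detOne.comp (hes_contDiff hW)

theorem detHes_rescale {n : ℕ} {W : En n → ℝ} (hW : ContDiff ℝ ∞ W) (x₀ : En n) {r : ℝ}
    (hr : r ≠ 0) : detHes (rescale W x₀ r) = fun y => detHes W (x₀ + r • y) := by
  funext y
  simp only [detHes, hes_rescale hW x₀ hr]

theorem scaled_estimate {n : ℕ} (hn : 0 < n) {α : ℝ} (hα : 0 < α) (hα1 : α < 1) :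
    ∃ δ₀ > 0, ∃ C > 0, ∀ (W : En n → ℝ), ContDiff ℝ ∞ W → ∀ (x₀ : En n) (r δ : ℝ), 0 < r →
      0 ≤ δ → δ ≤ δ₀ →
      (∀ x, ‖x - x₀‖ ≤ r → |W x| ≤ δ * r ^ 2 ∧ ‖hes W x‖ ≤ δ₀) →
      (∀ x, ‖x - x₀‖ ≤ r → ∀ i j k : Fin n,
        r * |pd (stdVec i) (detHes W) x| ≤ δ ∧
        r ^ 2 * |pd (stdVec i) (pd (stdVec j) (detHes W)) x| ≤ δ ∧
        r ^ 3 * |pd (stdVec i) (pd (stdVec j) (pd (stdVec k) (detHes W))) x| ≤ δ) →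
      ∀ x x', ‖x - x₀‖ ≤ r / 8 → ‖x' - x₀‖ ≤ r / 8 →
        ‖hes W x‖ ≤ C * δ ∧ (∀ i, r * ‖hes (pd (stdVec i) W) x‖ ≤ C * δ) ∧
        ∀ i j, r ^ 2 * ‖hes (pd (stdVec i) (pd (stdVec j) W)) x‖ ≤ C * δ ∧
          r ^ 2 * ‖hes (pd (stdVec i) (pd (stdVec j) W)) x
            - hes (pd (stdVec i) (pd (stdVec j) W)) x'‖ ≤ C * δ * (‖x - x'‖ / r) ^ α := by
  obtain ⟨δ₀, hδ₀, C, hC, H⟩ := small_solution_estimate hn hα hα1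
  refine ⟨δ₀, hδ₀, C, hC, fun W hW x₀ r δ hr hδ hδδ h1 h2 => ?_⟩
  have hr0 := hr.ne'
  have hmem : ∀ y : En n, ‖y‖ ≤ 1 → ‖x₀ + r • y - x₀‖ ≤ r := by
    intro y hy
    rw [add_sub_cancel_left, norm_smul, Real.norm_of_nonneg hr.le]
    nlinarith
  have hF := detHes_contDiff hW
  have hF1 : ∀ i, pd (stdVec i) (detHes (rescale W x₀ r))
      = fun y => r * pd (stdVec i) (detHes W) (x₀ + r • y) := by
    intro i
    rw [detHes_rescale hW x₀ hr0, pd_comp_affine hF]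
  have hF2 : ∀ i j, pd (stdVec i) (pd (stdVec j) (detHes (rescale W x₀ r)))
      = fun y => r ^ 2 * pd (stdVec i) (pd (stdVec j) (detHes W)) (x₀ + r • y) := by
    intro i j
    rw [hF1, pd_const_mul (contDiff_comp_affine (pd_contDiff hF _) x₀ r),
      pd_comp_affine (pd_contDiff hF _)]
    funext y; ring
  have hF3 : ∀ i j k, pd (stdVec i) (pd (stdVec j) (pd (stdVec k) (detHes (rescale W x₀ r))))
      = fun y => r ^ 3 * pd (stdVec i) (pd (stdVec j) (pd (stdVec k) (detHes W)))
          (x₀ + r • y) := by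
    intro i j k
    rw [hF2, pd_const_mul (contDiff_comp_affine (pd_contDiff (pd_contDiff hF _) _) x₀ r),
      pd_comp_affine (pd_contDiff (pd_contDiff hF _) _)]
    funext y; ring
  obtain ⟨A1, A2⟩ := H (rescale W x₀ r) (rescale_contDiff hW x₀ r) δ hδ hδδ (by
    intro y hy
    obtain ⟨hb, hh⟩ := h1 _ (hmem y hy)
    refine ⟨?_, by rwa [hes_rescale hW x₀ hr0]⟩
    rw [rescale, abs_mul, abs_of_pos (by positivity), inv_mul_le_iff₀ (by positivity)]
    linarith) (by
    intro y hy i j k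
    obtain ⟨k1, k2, k3⟩ := h2 _ (hmem y hy) i j k
    change |pd (stdVec i) (detHes (rescale W x₀ r)) y| ≤ δ ∧
      |pd (stdVec i) (pd (stdVec j) (detHes (rescale W x₀ r))) y| ≤ δ ∧
      |pd (stdVec i) (pd (stdVec j) (pd (stdVec k) (detHes (rescale W x₀ r)))) y| ≤ δ
    rw [hF1, hF2, hF3]
    refine ⟨?_, ?_, ?_⟩ <;> rw [abs_mul, abs_of_pos (by positivity)] <;> assumption)
  intro x x' hx hx'
  have key : ∀ z : En n, ‖z - x₀‖ ≤ r / 8 → ‖r⁻¹ • (z - x₀) - 0‖ ≤ 1 / 8 ∧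
      x₀ + r • (r⁻¹ • (z - x₀)) = z := by
    intro z hz
    refine ⟨?_, by rw [smul_inv_smul₀ hr0]; abel⟩
    rw [sub_zero, norm_smul, norm_inv, Real.norm_of_nonneg hr.le, inv_mul_le_iff₀ hr]
    linarith
  obtain ⟨m1, e1⟩ := key x hx
  obtain ⟨m2, e2⟩ := key x' hx'
  have hd1 : ∀ i y, hes (pd (stdVec i) (rescale W x₀ r)) y
      = r • hes (pd (stdVec i) W) (x₀ + r • y) := by
    intro i y
    funext k l
    have := pd_contDiff hW (stdVec i)
    simp only [hes, Pi.smul_apply, smul_eq_mul]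
    rw [pd_rescale hW x₀ _ hr0, pd_const_mul (contDiff_comp_affine this x₀ r),
      pd_comp_affine this, pd_const_mul (contDiff_const.mul (contDiff_comp_affine
        (pd_contDiff this _) x₀ r)), pd_const_mul (contDiff_comp_affine
        (pd_contDiff this _) x₀ r), pd_comp_affine (pd_contDiff this _)]
    field_simp
  have hd2 : ∀ i j y, hes (pd (stdVec i) (pd (stdVec j) (rescale W x₀ r))) y
      = r ^ 2 • hes (pd (stdVec i) (pd (stdVec j) W)) (x₀ + r • y) := by
    intro i j y
    funext k l
    have := pd_contDiff (pd_contDiff hW (stdVec j)) (stdVec i)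
    simp only [hes, Pi.smul_apply, smul_eq_mul]
    rw [pd_pd_rescale hW x₀ _ _ hr0, pd_comp_affine this,
      pd_const_mul (contDiff_comp_affine (pd_contDiff this _) x₀ r),
      pd_comp_affine (pd_contDiff this _)]
    ring
  refine ⟨?_, fun i => ?_, fun i j => ?_⟩
  · have := A1.1 _ m1
    rwa [hes_rescale hW x₀ hr0, e1] at this
  · have := (A2 i).1.1 _ m1
    rwa [hd1, e1, norm_smul, Real.norm_of_nonneg hr.le] at this
  · have B := (A2 j).2 i
    have B1 := B.1 _ m1
    have B2 := B.2 _ _ m1 m2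
    rw [hd2, e1, norm_smul, Real.norm_of_nonneg (by positivity)] at B1
    rw [hd2, hd2, e1, e2, ← smul_sub, norm_smul, Real.norm_of_nonneg (by positivity),
      ← smul_sub, sub_sub_sub_cancel_right, norm_smul, norm_inv, Real.norm_of_nonneg hr.le,
      inv_mul_eq_div] at B2
    exact ⟨B1, B2⟩

/-- `W` is globally smooth and, outside the ball of radius `ρ`, `W + |x|²/2` is a convex solution
of a Monge–Ampère equation whose right-hand side tends to `1`, with `W` of growth `2 - ε`. -/
structure ExtDecay {n : ℕ} (W : En n → ℝ) (ε c ρ : ℝ) : Prop where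
  smooth : ContDiff ℝ ∞ W
  growth : ∀ x, ρ ≤ ‖x‖ → |W x| ≤ c * ‖x‖ ^ (2 - ε)
  semiconvex : ∀ x a, ρ ≤ ‖x‖ → ‖a‖ = 1 → 0 ≤ 1 + pd a (pd a W) x
  det_sub_one : ∀ x, ρ ≤ ‖x‖ → ‖x‖ * |detHes W x - 1| ≤ c
  det_deriv : ∀ x a, ρ ≤ ‖x‖ → ‖a‖ = 1 → ‖x‖ ^ 2 * |pd a (detHes W) x| ≤ c
  det_deriv₂ : ∀ x a b, ρ ≤ ‖x‖ → ‖a‖ = 1 → ‖b‖ = 1 →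
    ‖x‖ ^ 3 * |pd a (pd b (detHes W)) x| ≤ c
  det_deriv₃ : ∀ x a b d, ρ ≤ ‖x‖ → ‖a‖ = 1 → ‖b‖ = 1 → ‖d‖ = 1 →
    ‖x‖ ^ 4 * |pd a (pd b (pd d (detHes W))) x| ≤ c

theorem norm_stdVec {n : ℕ} (i : Fin n) : ‖stdVec i‖ = 1 := by
  simp [stdVec]

theorem exists_mul_rpow_neg_le (K : ℝ) {θ η : ℝ} (hθ : 0 < θ) (hη : 0 < η) :
    ∃ R : ℝ, ∀ r ≥ R, K * r ^ (-θ) ≤ η := by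
  have h : Tendsto (fun r : ℝ => K * r ^ (-θ)) atTop (nhds (K * 0)) :=
    (tendsto_rpow_neg_atTop hθ).const_mul K
  rw [mul_zero] at h
  exact eventually_atTop.1 (h.eventually (ge_mem_nhds hη))

theorem rpow_two_sub_le {r t θ : ℝ} (hθ : 0 ≤ θ) (hr : 0 < r) (h1 : r ≤ t)
    (h2 : t ≤ 3 * r) : t ^ (2 - θ) ≤ 9 * (r ^ 2 * r ^ (-θ)) := by
  have ht : 0 < t := hr.trans_le h1
  rw [sub_eq_add_neg, Real.rpow_add ht, Real.rpow_two]
  have e1 : t ^ 2 ≤ 9 * r ^ 2 := by nlinarith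
  have e2 : t ^ (-θ) ≤ r ^ (-θ) := Real.rpow_le_rpow_of_nonpos hr h1 (by linarith)
  calc t ^ 2 * t ^ (-θ) ≤ (9 * r ^ 2) * r ^ (-θ) := by
        exact mul_le_mul e1 e2 (by positivity) (by positivity)
    _ = _ := by ring

theorem norm_mem_of_dist_half {n : ℕ} {x z : En n} {r : ℝ} (hr : ‖x‖ = 2 * r)
    (hz : ‖z - x‖ ≤ r) : r ≤ ‖z‖ ∧ ‖z‖ ≤ 3 * r := by
  have h1 := norm_sub_norm_le x z
  have h2 := norm_sub_norm_le z x
  rw [norm_sub_rev] at h1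
  constructor <;> linarith

theorem mul_le_of_pow_succ_mul_le {r t y c : ℝ} {k : ℕ} (hr : 0 < r) (h1 : r ≤ t) (hy : 0 ≤ y)
    (h : t ^ (k + 1) * y ≤ c) : r ^ k * y ≤ c / r := by
  rw [le_div_iff₀ hr]
  calc r ^ k * y * r = r ^ (k + 1) * y := by ring
    _ ≤ t ^ (k + 1) * y := by gcongr
    _ ≤ c := h

theorem ExtDecay.nearQuadratic_rescale {n : ℕ} {W : En n → ℝ} {ε c ρ : ℝ} (h : ExtDecay W ε c ρ)
    (hε : 0 < ε) (hc : 0 < c) {κ : ℝ} (hκ : 0 < κ) (hκ8 : κ ≤ 1 / 8) {x : En n} {r : ℝ}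
    (hr : 0 < r) (hx : ‖x‖ = 2 * r) (hρ : ρ ≤ r) (h1 : 9 * c * r ^ (-ε) ≤ κ ^ 2)
    (h2 : c / r ≤ κ ^ 2) : NearQuadratic (rescale W x r) κ := by
  have hW := h.smooth
  have hr0 := hr.ne'
  have hmem : ∀ y : En n, ‖y‖ ≤ 1 → r ≤ ‖x + r • y‖ ∧ ‖x + r • y‖ ≤ 3 * r := by
    intro y hy
    refine norm_mem_of_dist_half hx ?_
    rw [add_sub_cancel_left, norm_smul, Real.norm_of_nonneg hr.le]
    nlinarith
  have hF := detHes_contDiff hW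
  have hκ1 : κ ^ 2 ≤ 1 := by nlinarith
  have hF1 : ∀ e, pd e (fun y => detOne (hes (rescale W x r) y))
      = fun y => r * pd e (detHes W) (x + r • y) := by
    intro e
    change pd e (detHes _) = _
    rw [detHes_rescale hW x hr0, pd_comp_affine hF]
  refine ⟨rescale_contDiff hW x r, hκ, hκ8, fun y hy => ?_, fun y a hy ha => ?_, fun y hy => ?_,
    fun y e hy he => ?_, fun y e hy he => ?_⟩
  · obtain ⟨m1, m2⟩ := hmem y hy
    rw [rescale, abs_mul, abs_of_pos (by positivity), inv_mul_le_iff₀ (by positivity)]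
    calc |W (x + r • y)| ≤ c * ‖x + r • y‖ ^ (2 - ε) := h.growth _ (hρ.trans m1)
      _ ≤ c * (9 * (r ^ 2 * r ^ (-ε))) := by gcongr; exact rpow_two_sub_le hε.le hr m1 m2
      _ = r ^ 2 * (9 * c * r ^ (-ε)) := by ring
      _ ≤ r ^ 2 * κ ^ 2 := by gcongr
  · rw [pd_pd_rescale hW x _ _ hr0]
    exact h.semiconvex _ _ (hρ.trans (hmem y hy).1) ha
  · rw [hes_rescale hW x hr0]
    refine le_trans ?_ h2
    have := mul_le_of_pow_succ_mul_le (k := 0) (c := c) hr (hmem y hy).1 (abs_nonneg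
      (detHes W (x + r • y) - 1)) (by simpa using h.det_sub_one _ (hρ.trans (hmem y hy).1))
    rwa [pow_zero, one_mul] at this
  · rw [hF1, abs_mul, abs_of_pos hr]
    have := mul_le_of_pow_succ_mul_le (k := 1) hr (hmem y hy).1 (abs_nonneg _)
      (h.det_deriv _ e (hρ.trans (hmem y hy).1) he)
    rw [pow_one] at this
    linarith
  · rw [hF1, pd_const_mul (contDiff_comp_affine (pd_contDiff hF _) x r),
      pd_comp_affine (pd_contDiff hF _)]
    have := mul_le_of_pow_succ_mul_le (k := 2) hr (hmem y hy).1 (abs_nonneg _)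
      (h.det_deriv₂ _ e e (hρ.trans (hmem y hy).1) he he)
    change |r * (r * pd e (pd e (detHes W)) (x + r • y))| ≤ 1
    rw [← mul_assoc, ← sq, abs_mul, abs_of_pos (by positivity)]
    linarith

theorem ExtDecay.exists_hes_small {n : ℕ} (hn : 0 < n) {ε c : ℝ} (ρ : ℝ) (hε : 0 < ε) (hc : 0 < c)
    {μ : ℝ} (hμ : 0 < μ) : ∃ R : ℝ, 1 ≤ R ∧ ρ ≤ R ∧ ∀ W : En n → ℝ, ExtDecay W ε c ρ →
      ∀ x, R ≤ ‖x‖ → ‖hes W x‖ ≤ μ ∧ ∀ e, ‖e‖ = 1 → |pd e W x| ≤ ‖x‖ := by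
  obtain ⟨κ₀, hκ₀, H⟩ := hes_small_of_nearQuadratic hn hμ
  set κ := min κ₀ (1 / 8) with hκd
  have hκ : 0 < κ := by positivity
  have hκ8 : κ ≤ 1 / 8 := min_le_right _ _
  obtain ⟨R₁, hR₁⟩ := exists_mul_rpow_neg_le (9 * c) hε (η := κ ^ 2) (by positivity)
  set R := 2 * max (max 1 |ρ|) (max R₁ (c / κ ^ 2)) with hR
  have m1 : 2 * 1 ≤ R := by rw [hR]; gcongr; exact (le_max_left _ _).trans (le_max_left _ _)
  have m2 : 2 * |ρ| ≤ R := by rw [hR]; gcongr; exact (le_max_right _ _).trans (le_max_left _ _)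
  have m3 : 2 * R₁ ≤ R := by rw [hR]; gcongr; exact (le_max_left _ _).trans (le_max_right _ _)
  have m4 : 2 * (c / κ ^ 2) ≤ R := by
    rw [hR]; gcongr; exact (le_max_right _ _).trans (le_max_right _ _)
  have hρ := le_abs_self ρ
  have hρ' := abs_nonneg ρ
  refine ⟨R, by linarith, by linarith, fun W h x hx => ?_⟩
  set r := ‖x‖ / 2 with hr
  have hxr : ‖x‖ = 2 * r := by rw [hr]; ring
  have hr1 : 1 ≤ r := by linarith
  have hr0 : 0 < r := by linarith
  have hN : NearQuadratic (rescale W x r) κ :=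
    h.nearQuadratic_rescale hε hc hκ hκ8 hr0 hxr (by linarith) (hR₁ r (by linarith)) (by
      rw [div_le_iff₀ hr0, mul_comm, ← div_le_iff₀ (by positivity)]
      linarith)
  constructor
  · rw [pi_norm_le_iff_of_nonneg hμ.le]
    intro i
    rw [pi_norm_le_iff_of_nonneg hμ.le]
    intro j
    have := H _ _ hN (min_le_left _ _) i j
    rw [hes_rescale h.smooth x hr0.ne'] at this
    simpa using this
  · intro e he
    have := abs_pd_le_of_semiconvex hN.smooth hκ hκ8 hN.bound hN.semiconvex (x := 0) (by norm_num) he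
    rw [pd_rescale h.smooth x e hr0.ne', abs_mul, abs_of_pos (by positivity),
      inv_mul_le_iff₀ hr0] at this
    simp only [smul_zero, add_zero] at this
    nlinarith

theorem ExtDecay.exists_decay {n : ℕ} (hn : 0 < n) {α : ℝ} (hα : 0 < α) (hα1 : α < 1)
    {ε c : ℝ} (ρ : ℝ) (hε : 0 < ε) (hc : 0 < c) {θ A : ℝ} (ρ' : ℝ) (hθ : 0 < θ) (hθ1 : θ ≤ 1)
    (hA : 0 < A) :
    ∃ R, 1 ≤ R ∧ ρ ≤ R ∧ ρ' ≤ R ∧ ∃ C > 0, ∀ W : En n → ℝ, ExtDecay W ε c ρ →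
      (∀ x, ρ' ≤ ‖x‖ → |W x| ≤ A * ‖x‖ ^ (2 - θ)) →
      ∀ x, R ≤ ‖x‖ → ‖hes W x‖ ≤ C * ‖x‖ ^ (-θ) ∧
        (∀ i, ‖x‖ * ‖hes (pd (stdVec i) W) x‖ ≤ C * ‖x‖ ^ (-θ)) ∧
        ∀ i j, ‖x‖ ^ 2 * ‖hes (pd (stdVec i) (pd (stdVec j) W)) x‖ ≤ C * ‖x‖ ^ (-θ) ∧
          ∀ x', ‖x' - x‖ ≤ ‖x‖ / 16 →
            ‖x‖ ^ 2 * ‖hes (pd (stdVec i) (pd (stdVec j) W)) x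
              - hes (pd (stdVec i) (pd (stdVec j) W)) x'‖
              ≤ C * ‖x‖ ^ (-θ) * (‖x - x'‖ / ‖x‖) ^ α := by
  obtain ⟨δ₀, hδ₀, C, hC, H⟩ := scaled_estimate hn hα hα1
  obtain ⟨Rs, hRs1, hRsρ, hRs⟩ := ExtDecay.exists_hes_small hn ρ hε hc hδ₀
  set K := 9 * A + c with hK
  have hK0 : 0 < K := by positivity
  obtain ⟨R₁, hR₁⟩ := exists_mul_rpow_neg_le K hθ hδ₀
  set R := 2 * max Rs (max |ρ'| R₁) with hR
  have m1 : 2 * Rs ≤ R := by rw [hR]; gcongr; exact le_max_left _ _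
  have m2 : 2 * |ρ'| ≤ R := by rw [hR]; gcongr; exact (le_max_left _ _).trans (le_max_right _ _)
  have m3 : 2 * R₁ ≤ R := by rw [hR]; gcongr; exact (le_max_right _ _).trans (le_max_right _ _)
  have hρ := le_abs_self ρ'
  have hρ' := abs_nonneg ρ'
  refine ⟨R, by linarith, by linarith, by linarith, 16 * (C * K), by positivity, ?_⟩
  intro W h hg x hx
  set r := ‖x‖ / 2 with hr
  have hxr : ‖x‖ = 2 * r := by rw [hr]; ring
  have hr1 : 1 ≤ r := by linarith
  have hr0 : 0 < r := by linarith
  have hrθ : 0 < r ^ (-θ) := by positivity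
  have hcr : c / r ≤ K * r ^ (-θ) := by
    have : r⁻¹ ≤ r ^ (-θ) := by
      rw [← Real.rpow_neg_one]
      exact Real.rpow_le_rpow_of_exponent_le hr1 (by linarith)
    calc c / r = c * r⁻¹ := rfl
      _ ≤ c * r ^ (-θ) := by gcongr
      _ ≤ K * r ^ (-θ) := by gcongr; linarith
  have hmem := fun z => norm_mem_of_dist_half (z := z) hxr
  have key := H W h.smooth x r (K * r ^ (-θ)) hr0 (by positivity) (hR₁ r (by linarith)) (by
    intro z hz
    obtain ⟨z1, z2⟩ := hmem z hz
    refine ⟨?_, (hRs W h z (by linarith)).1⟩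
    calc |W z| ≤ A * ‖z‖ ^ (2 - θ) := hg z (by linarith)
      _ ≤ A * (9 * (r ^ 2 * r ^ (-θ))) := by gcongr; exact rpow_two_sub_le hθ.le hr0 z1 z2
      _ = 9 * A * r ^ (-θ) * r ^ 2 := by ring
      _ ≤ K * r ^ (-θ) * r ^ 2 := by gcongr; linarith) (by
    intro z hz i j k
    obtain ⟨z1, z2⟩ := hmem z hz
    have hzρ : ρ ≤ ‖z‖ := by linarith
    refine ⟨?_, ?_, ?_⟩ <;> refine le_trans ?_ hcr
    · have := mul_le_of_pow_succ_mul_le (k := 1) hr0 z1 (abs_nonneg _)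
        (h.det_deriv z (stdVec i) hzρ (norm_stdVec i))
      rwa [pow_one] at this
    · exact mul_le_of_pow_succ_mul_le (k := 2) hr0 z1 (abs_nonneg _)
        (h.det_deriv₂ z (stdVec i) (stdVec j) hzρ (norm_stdVec i) (norm_stdVec j))
    · exact mul_le_of_pow_succ_mul_le (k := 3) hr0 z1 (abs_nonneg _)
        (h.det_deriv₃ z (stdVec i) (stdVec j) (stdVec k) hzρ (norm_stdVec i) (norm_stdVec j)
          (norm_stdVec k)))
  have hx0 : ‖x - x‖ ≤ r / 8 := by simp; positivity
  have hrx : r ^ (-θ) ≤ 2 * ‖x‖ ^ (-θ) := by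
    rw [hxr, Real.mul_rpow (by norm_num) hr0.le, ← mul_assoc]
    have : (1 : ℝ) ≤ 2 * 2 ^ (-θ) := by
      have : (2 : ℝ) ^ (-1 : ℝ) ≤ 2 ^ (-θ) :=
        Real.rpow_le_rpow_of_exponent_le (by norm_num) (by linarith)
      rw [Real.rpow_neg_one] at this
      linarith
    nlinarith
  have hB : C * (K * r ^ (-θ)) ≤ 2 * (C * K) * ‖x‖ ^ (-θ) := by
    calc C * (K * r ^ (-θ)) = C * K * r ^ (-θ) := by ring
      _ ≤ C * K * (2 * ‖x‖ ^ (-θ)) := by gcongr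
      _ = _ := by ring
  have hCK : 0 ≤ C * K * ‖x‖ ^ (-θ) := by positivity
  refine ⟨?_, fun i => ?_, fun i j => ⟨?_, fun x' hx' => ?_⟩⟩
  · have := (key x x hx0 hx0).1
    linarith
  · have := (key x x hx0 hx0).2.1 i
    rw [hxr, mul_assoc, ← hxr]
    linarith
  · have := ((key x x hx0 hx0).2.2 i j).1
    rw [hxr, mul_pow, mul_assoc, ← hxr]
    linarith
  · have := ((key x x' hx0 (by linarith)).2.2 i j).2
    have e : (‖x - x'‖ / r) ^ α ≤ 2 * (‖x - x'‖ / ‖x‖) ^ α := by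
      rw [show ‖x - x'‖ / r = 2 * (‖x - x'‖ / ‖x‖) by rw [hxr]; field_simp,
        Real.mul_rpow (by norm_num) (by positivity)]
      gcongr
      calc (2 : ℝ) ^ α ≤ 2 ^ (1 : ℝ) :=
            Real.rpow_le_rpow_of_exponent_le (by norm_num) hα1.le
        _ = 2 := by norm_num
    have e2 : C * (K * r ^ (-θ)) * (‖x - x'‖ / r) ^ α
        ≤ 2 * (C * K) * ‖x‖ ^ (-θ) * (2 * (‖x - x'‖ / ‖x‖) ^ α) := by gcongr
    calc _ = 4 * (r ^ 2 * ‖hes (pd (stdVec i) (pd (stdVec j) W)) x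
              - hes (pd (stdVec i) (pd (stdVec j) W)) x'‖) := by
            rw [show ‖x‖ ^ 2 = 4 * r ^ 2 by rw [hxr]; ring]; ring
      _ ≤ 4 * (2 * (C * K) * ‖x‖ ^ (-θ) * (2 * (‖x - x'‖ / ‖x‖) ^ α)) :=
            mul_le_mul_of_nonneg_left (this.trans e2) (by norm_num)
      _ = _ := by ring

theorem integrable_norm_rpow_neg_indicator {n : ℕ} (hn : 0 < n) {γ : ℝ} (hγ1 : γ < 1) :
    Integrable fun w : En n => (Set.Iio (1 : ℝ)).indicator (fun t => t ^ (-γ)) ‖w‖ := by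
  have : Nontrivial (En n) := by
    have : Nonempty (Fin n) := ⟨⟨0, hn⟩⟩
    infer_instance
  rw [integrable_fun_norm_addHaar volume]
  have h1 : IntegrableOn (fun t : ℝ => t ^ (-γ)) (Set.Ioo 0 1) := by
    have := (intervalIntegral.intervalIntegrable_rpow' (a := 0) (b := 1) (r := -γ) (by linarith))
    rw [intervalIntegrable_iff_integrableOn_Ioo_of_le zero_le_one] at this
    exact this
  have h2 : IntegrableOn (fun t : ℝ => (Set.Iio (1 : ℝ)).indicator (fun t => t ^ (-γ)) t)
      (Set.Ioi 0) := by
    rw [integrableOn_indicator_iff measurableSet_Iio]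
    rwa [Set.inter_comm, Set.Ioi_inter_Iio]
  refine h2.mono' ?_ ?_
  · refine Measurable.aestronglyMeasurable ?_
    exact (measurable_id.pow_const _).smul
      (Measurable.indicator (measurable_id.pow_const _) measurableSet_Iio)
  · filter_upwards [ae_restrict_mem measurableSet_Ioi] with t ht
    have ht0 : (0 : ℝ) < t := ht
    by_cases h : t < 1
    · rw [Set.indicator_of_mem (by exact h), norm_smul, norm_pow, Real.norm_of_nonneg ht0.le,
        Real.norm_of_nonneg (by positivity)]
      exact mul_le_of_le_one_left (by positivity) (pow_le_one₀ ht0.le h.le)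
    · rw [Set.indicator_of_notMem (by exact h)]
      simp

theorem Ker.exists_abs_scaleAvg_le_rpow {n : ℕ} (hn : 0 < n) {κ : En n → ℝ} (h : Ker κ) {γ : ℝ}
    (hγ0 : 0 < γ) (hγ1 : γ < 1) : ∃ C > 0, ∀ (g : En n → ℝ) (M : ℝ), 0 ≤ M →
      (∀ z, |g z| ≤ M * ‖z‖ ^ (-γ)) → ∀ x s, 0 < s → |scaleAvg κ g s x| ≤ C * M * s ^ (-γ) := by
  obtain ⟨B, hB⟩ := h.hasCompactSupport.exists_bound_of_continuous h.1.continuous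
  have hB0 : 0 ≤ B := (norm_nonneg _).trans (hB 0)
  set G : En n → ℝ := fun w => (Set.Iio (1 : ℝ)).indicator (fun t => t ^ (-γ)) ‖w‖ with hG
  have hGi : Integrable G := integrable_norm_rpow_neg_indicator hn hγ1
  have hG0 : ∀ w, 0 ≤ G w := by
    intro w
    simp only [hG, Set.indicator_apply]
    split_ifs <;> positivity
  have hGle : ∀ w : En n, ‖w‖ ^ (-γ) ≤ 1 + G w := by
    intro w
    by_cases hw : ‖w‖ < 1
    · rw [hG]
      dsimp only
      rw [Set.indicator_of_mem (by exact hw)]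
      linarith
    · have : ‖w‖ ^ (-γ) ≤ 1 := Real.rpow_le_one_of_one_le_of_nonpos (not_lt.1 hw) (by linarith)
      linarith [hG0 w]
  set b : En n → ℝ := (Metric.closedBall (0 : En n) 1).indicator fun _ => (1 : ℝ) with hb
  have hbi : Integrable b := by
    rw [hb, integrable_indicator_iff measurableSet_closedBall]
    simp [measure_closedBall_lt_top]
  set I : ℝ := (∫ y, b y) + ∫ y, G y with hI
  have hI0 : 0 ≤ I := add_nonneg (integral_nonneg fun y => Set.indicator_nonneg (by simp) _)
    (integral_nonneg hG0)
  refine ⟨B * I + 1, by positivity, fun g M hM hg x s hs => ?_⟩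
  have hbound : ∀ y, ‖κ y * g (x + s • y)‖
      ≤ B * M * s ^ (-γ) * (b y + G (s⁻¹ • x + y)) := by
    intro y
    have hsγ : 0 ≤ s ^ (-γ) := by positivity
    by_cases hy : ‖y‖ ≤ 1
    · have hby : b y = 1 := by rw [hb, Set.indicator_of_mem (by simpa using hy)]
      have e : x + s • y = s • (s⁻¹ • x + y) := by rw [smul_add, smul_inv_smul₀ hs.ne']
      rw [norm_mul, hby]
      calc ‖κ y‖ * ‖g (x + s • y)‖ ≤ B * (M * ‖x + s • y‖ ^ (-γ)) := by
            gcongr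
            · exact hB y
            · exact hg _
        _ = B * M * s ^ (-γ) * ‖s⁻¹ • x + y‖ ^ (-γ) := by
            rw [e, norm_smul, Real.norm_of_nonneg hs.le, Real.mul_rpow hs.le (norm_nonneg _)]
            ring
        _ ≤ _ := by gcongr; exact hGle _
    · rw [h.2 y (not_le.1 hy)]
      have : 0 ≤ b y := Set.indicator_nonneg (by simp) _
      have := hG0 (s⁻¹ • x + y)
      simp only [zero_mul, norm_zero]
      positivity
  have hint : Integrable fun y => B * M * s ^ (-γ) * (b y + G (s⁻¹ • x + y)) :=
    (hbi.add (hGi.comp_add_left _)).const_mul _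
  have := norm_integral_le_of_norm_le hint (ae_of_all _ hbound)
  rw [integral_const_mul, integral_add hbi (hGi.comp_add_left _),
    integral_add_left_eq_self (fun y => G y)] at this
  rw [scaleAvg, ← Real.norm_eq_abs]
  refine this.trans ?_
  have e : B * M * s ^ (-γ) * I ≤ (B * I + 1) * M * s ^ (-γ) := by
    have : 0 ≤ M * s ^ (-γ) := by positivity
    linarith [show (B * I + 1) * M * s ^ (-γ) = B * M * s ^ (-γ) * I + M * s ^ (-γ) by ring]
  exact e

theorem integral_rpow_neg_sub_one_le {γ d S : ℝ} (hγ : 0 < γ) (hd : 0 < d) (hdS : d ≤ S) :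
    ∫ s in d..S, s ^ (-γ - 1) ≤ d ^ (-γ) / γ := by
  rw [integral_rpow (Or.inr ⟨by linarith, by
    rw [Set.uIcc_of_le hdS]; exact fun h => absurd h.1 (not_le.2 hd)⟩)]
  have h1 : 0 ≤ S ^ (-γ) := Real.rpow_nonneg (hd.le.trans hdS) _
  rw [show -γ - 1 + 1 = -γ by ring, div_neg, ← neg_div]
  gcongr
  linarith

theorem exists_hessian_decay {n : ℕ} (hn : 0 < n) {γ : ℝ} (hγ0 : 0 < γ) (hγ1 : γ < 1) (a b : En n) :
    ∃ C > 0, ∀ U : En n → ℝ, ContDiff ℝ ∞ U → ∀ M R ε A : ℝ, 0 ≤ M → 0 < R → 0 < ε → ε ≤ 2 →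
      (∀ x, |U x| ≤ A * (1 + ‖x‖) ^ (2 - ε)) → (∀ z, |lap U z| ≤ M * ‖z‖ ^ (-γ)) →
      (∀ z, R ≤ ‖z‖ → ∀ i, |pd (stdVec i) (lap U) z| ≤ M * ‖z‖ ^ (-γ - 1)) →
      ∀ x, 2 * R ≤ ‖x‖ → |pd a (pd b U) x| ≤ C * M * ‖x‖ ^ (-γ) := by
  obtain ⟨p⟩ := exists_kerPair hn
  have hκ : Ker (pd a (pd b p.ψ)) := (p.kψ.dir b).dir a
  obtain ⟨C₁, hC₁, H⟩ := hκ.exists_abs_scaleAvg_le_rpow hn hγ0 hγ1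
  set Kψ := ∫ y, |pd a (pd b p.ψ) y| with hKψ
  set Kφ := ∫ y, |pd a (pd b p.φ) y| with hKφ
  have hKψ0 : 0 ≤ Kψ := integral_nonneg fun _ => abs_nonneg _
  have hKφ0 : 0 ≤ Kφ := integral_nonneg fun _ => abs_nonneg _
  set C₂ := Kψ * n + C₁ / γ with hC₂
  have hC₂0 : 0 < C₂ := by positivity
  refine ⟨2 * C₂, by positivity, fun U hU M R ε A hM hR hε hε2 hUg hlap hdlap x hx => ?_⟩
  have hA : 0 ≤ A := by
    have := (abs_nonneg _).trans (hUg 0)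
    simpa using this
  set d := ‖x‖ / 2 with hd
  have hdR : R ≤ d := by linarith
  have hd0 : 0 < d := by linarith
  have hdγ : 0 < d ^ (-γ) := by positivity
  have hcont := p.continuous_density hU a b x
  have hnear : |∫ s in (0 : ℝ)..d, p.density U a b x s| ≤ Kψ * n * M * d ^ (-γ) := by
    have hb : ∀ s ∈ Set.uIoc 0 d, ‖p.density U a b x s‖ ≤ Kψ * (n * (M * d ^ (-γ - 1))) := by
      intro s hs
      rw [Set.uIoc_of_le hd0.le] at hs
      have hs0 : 0 < s := hs.1
      rw [p.density_eq hU a b x hs0.ne', Real.norm_eq_abs, abs_mul, abs_inv, abs_of_pos hs0,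
        inv_mul_le_iff₀ hs0]
      have := hκ.abs_scaleAvg_le_osc ((p.kψ.dir b).integral_pd a) (lap_contDiff hU).continuous
        (s := s) (x := x) (B := n * (M * d ^ (-γ - 1)) * s) (by
          intro y hy
          have hsy : ‖s • y‖ ≤ s := by
            rw [norm_smul, Real.norm_of_nonneg hs0.le]; nlinarith
          have := abs_sub_le_of_abs_pd_le (lap_contDiff hU) (convex_closedBall x d)
            (B := M * d ^ (-γ - 1)) (by positivity) (fun i z hz => by
              have hz' : d ≤ ‖z‖ := (norm_mem_of_dist_half (x := x) (r := d) (by rw [hd]; ring)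
                (by simpa [dist_eq_norm] using hz)).1
              refine (hdlap z (hdR.trans hz') i).trans ?_
              gcongr M * ?_
              exact Real.rpow_le_rpow_of_nonpos hd0 hz' (by linarith))
            (x := x + s • y) (x' := x) (by
              rw [Metric.mem_closedBall, dist_eq_norm, add_sub_cancel_left]
              exact hsy.trans hs.2) (Metric.mem_closedBall_self hd0.le)
          rw [add_sub_cancel_left] at this
          refine this.trans ?_
          gcongr)
      linarith
    have := intervalIntegral.norm_integral_le_of_norm_le_const hb
    rw [Real.norm_eq_abs, sub_zero, abs_of_pos hd0] at this
    refine this.trans (le_of_eq ?_)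
    rw [Real.rpow_sub_one hd0.ne']
    field_simp
  have hfar : ∀ S, d ≤ S → |∫ s in d..S, p.density U a b x s| ≤ C₁ / γ * M * d ^ (-γ) := by
    intro S hS
    have hb : ∀ s ∈ Set.Ioc d S, ‖p.density U a b x s‖ ≤ C₁ * M * s ^ (-γ - 1) := by
      intro s hs
      have hs0 : 0 < s := hd0.trans hs.1
      rw [p.density_eq hU a b x hs0.ne', Real.norm_eq_abs, abs_mul, abs_inv, abs_of_pos hs0,
        inv_mul_le_iff₀ hs0]
      refine (H _ M hM hlap x s hs0).trans (le_of_eq ?_)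
      rw [Real.rpow_sub_one hs0.ne']
      field_simp
    have hii : IntervalIntegrable (fun s : ℝ => C₁ * M * s ^ (-γ - 1)) volume d S := by
      refine IntervalIntegrable.const_mul (intervalIntegral.intervalIntegrable_rpow (Or.inr ?_)) _
      rw [Set.uIcc_of_le hS]
      exact fun h => absurd h.1 (not_le.2 hd0)
    have := intervalIntegral.norm_integral_le_of_norm_le hS (ae_of_all _ hb) hii
    rw [intervalIntegral.integral_const_mul, Real.norm_eq_abs] at this
    refine this.trans ?_
    calc C₁ * M * ∫ s in d..S, s ^ (-γ - 1) ≤ C₁ * M * (d ^ (-γ) / γ) := by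
          gcongr; exact integral_rpow_neg_sub_one_le hγ0 hd0 hS
      _ = _ := by ring
  have hmain : ∀ S, max d 1 ≤ S → |pd a (pd b U) x|
      ≤ Kφ * (A * (2 + ‖x‖) ^ (2 - ε)) * S ^ (-ε) + C₂ * M * d ^ (-γ) := by
    intro S hS
    have hS1 : 1 ≤ S := (le_max_right _ _).trans hS
    have hS0 : 0 < S := by linarith
    rw [p.hessian_representation hU a b x hS0,
      ← intervalIntegral.integral_add_adjacent_intervals (hcont.intervalIntegrable 0 d)
        (hcont.intervalIntegrable d S)]
    have hφ : |(S ^ 2)⁻¹ * scaleAvg (pd a (pd b p.φ)) U S x|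
        ≤ Kφ * (A * (2 + ‖x‖) ^ (2 - ε)) * S ^ (-ε) := by
      rw [abs_mul, abs_of_pos (by positivity), inv_mul_le_iff₀ (by positivity)]
      have := ((p.kφ.dir b).dir a).abs_integral_le (k := fun y => U (x + S • y))
        (B := A * ((2 + ‖x‖) * S) ^ (2 - ε)) (fun y hy => by
          refine (hUg _).trans ?_
          gcongr A * ?_
          refine Real.rpow_le_rpow (by positivity) ?_ (by linarith)
          have h1 := norm_add_le x (S • y)
          rw [norm_smul, Real.norm_of_nonneg hS0.le] at h1
          nlinarith [norm_nonneg x])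
      refine this.trans (le_of_eq ?_)
      rw [Real.mul_rpow (by positivity) hS0.le, sub_eq_add_neg, Real.rpow_add hS0 2,
        Real.rpow_two]
      ring
    have t1 := hfar S ((le_max_left _ _).trans hS)
    refine (abs_sub _ _).trans ?_
    have t2 := abs_add_le (∫ s in (0 : ℝ)..d, p.density U a b x s)
      (∫ s in d..S, p.density U a b x s)
    have e : C₂ * M * d ^ (-γ) = Kψ * n * M * d ^ (-γ) + C₁ / γ * M * d ^ (-γ) := by
      rw [hC₂]; ring
    linarith
  have hlim : Tendsto (fun S : ℝ => Kφ * (A * (2 + ‖x‖) ^ (2 - ε)) * S ^ (-ε)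
      + C₂ * M * d ^ (-γ)) atTop (nhds (Kφ * (A * (2 + ‖x‖) ^ (2 - ε)) * 0
      + C₂ * M * d ^ (-γ))) :=
    ((tendsto_rpow_neg_atTop hε).const_mul _).add_const _
  have hle := ge_of_tendsto hlim (eventually_atTop.2 ⟨max d 1, hmain⟩)
  rw [mul_zero, zero_add] at hle
  refine hle.trans ?_
  have hdx : d ^ (-γ) ≤ 2 * ‖x‖ ^ (-γ) := by
    rw [show ‖x‖ = 2 * d by rw [hd]; ring, Real.mul_rpow (by norm_num) hd0.le, ← mul_assoc]
    have : (1 : ℝ) ≤ 2 * 2 ^ (-γ) := by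
      have : (2 : ℝ) ^ (-1 : ℝ) ≤ 2 ^ (-γ) :=
        Real.rpow_le_rpow_of_exponent_le (by norm_num) (by linarith)
      rw [Real.rpow_neg_one] at this
      linarith
    nlinarith
  calc C₂ * M * d ^ (-γ) ≤ C₂ * M * (2 * ‖x‖ ^ (-γ)) := by gcongr
    _ = _ := by ring

theorem exists_cutoff (n : ℕ) {r R : ℝ} (hr : 0 < r) (hR : r < R) :
    ∃ χ : En n → ℝ, ContDiff ℝ ∞ χ ∧ (∀ x, |χ x| ≤ 1) ∧ (∀ x, ‖x‖ ≤ r → χ x = 0) ∧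
      ∀ x, R ≤ ‖x‖ → χ x = 1 := by
  let f : ContDiffBump (0 : En n) := ⟨r, R, hr, hR⟩
  refine ⟨fun x => 1 - f x, contDiff_const.sub f.contDiff, fun x => ?_, fun x hx => ?_,
    fun x hx => ?_⟩
  · rw [abs_le]
    have h1 := f.nonneg (x := x)
    have h2 := f.le_one (x := x)
    constructor <;> linarith
  · change 1 - f x = 0
    rw [f.one_of_mem_closedBall (by simpa using hx), sub_self]
  · change 1 - f x = 1
    rw [f.zero_of_le_dist (by simpa using hx), sub_zero]

theorem lap_mul {n : ℕ} {χ W : En n → ℝ} (hχ : ContDiff ℝ ∞ χ) (hW : ContDiff ℝ ∞ W) (x : En n) :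
    lap (fun y => χ y * W y) x = ∑ i, (pd (stdVec i) (pd (stdVec i) χ) x * W x
      + 2 * pd (stdVec i) χ x * pd (stdVec i) W x
      + χ x * pd (stdVec i) (pd (stdVec i) W) x) := by
  rw [lap]
  refine Finset.sum_congr rfl fun i _ => ?_
  have h1 := pd_contDiff hχ (stdVec i)
  have h2 := pd_contDiff hW (stdVec i)
  rw [pd_mul hχ hW, pd_add (h1.mul hW) (hχ.mul h2), pd_mul h1 hW, pd_mul hχ h2]
  ring

theorem lap_congr_of_eventuallyEq {n : ℕ} {h k : En n → ℝ} {x : En n} (hk : h =ᶠ[nhds x] k) :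
    lap h =ᶠ[nhds x] lap k := by
  have : ∀ i : Fin n, ∀ᶠ y in nhds x, pd (stdVec i) (pd (stdVec i) h) y
      = pd (stdVec i) (pd (stdVec i) k) y := fun i =>
    pd_congr_of_eventuallyEq (pd_congr_of_eventuallyEq hk _) _
  filter_upwards [eventually_all.2 this] with y hy
  simp only [lap, hy]

theorem exists_bound_lap_cutoff_mul {n : ℕ} {χ : En n → ℝ} (hχ : ContDiff ℝ ∞ χ) (R : ℝ) :
    ∃ B ≥ 0, ∀ (W : En n → ℝ) (D : ℝ), ContDiff ℝ ∞ W → ∀ x, ‖x‖ ≤ R → |W x| ≤ D →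
      (∀ i, |pd (stdVec i) W x| ≤ D) → (∀ i, |pd (stdVec i) (pd (stdVec i) W) x| ≤ D) →
      |lap (fun y => χ y * W y) x| ≤ B * D := by
  have hc : Continuous fun x => ∑ i : Fin n, (|pd (stdVec i) (pd (stdVec i) χ) x|
      + 2 * |pd (stdVec i) χ x| + |χ x|) := by
    refine continuous_finsetSum _ fun i _ => ?_
    have h1 := (pd_contDiff hχ (stdVec i)).continuous
    have h2 := (pd_contDiff (pd_contDiff hχ (stdVec i)) (stdVec i)).continuous
    have h3 := hχ.continuous
    fun_prop
  obtain ⟨B, hB⟩ := (isCompact_closedBall (0 : En n) R).exists_bound_of_continuousOn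
    hc.continuousOn
  refine ⟨|B|, abs_nonneg _, fun W D hW x hx h0 h1 h2 => ?_⟩
  have hD : 0 ≤ D := (abs_nonneg _).trans h0
  rw [lap_mul hχ hW]
  calc _ ≤ ∑ i : Fin n, (|pd (stdVec i) (pd (stdVec i) χ) x|
      + 2 * |pd (stdVec i) χ x| + |χ x|) * D := by
        refine (Finset.abs_sum_le_sum_abs _ _).trans (Finset.sum_le_sum fun i _ => ?_)
        refine (abs_add_three _ _ _).trans ?_
        rw [add_mul, add_mul, abs_mul, abs_mul, abs_mul, abs_mul, abs_two]
        gcongr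
        · exact h1 i
        · exact h2 i
    _ ≤ |B| * D := by
        rw [← Finset.sum_mul]
        gcongr
        exact ((le_abs_self _).trans (hB x (by simpa using hx))).trans (le_abs_self B)

theorem abs_hes_le {n : ℕ} (W : En n → ℝ) (x : En n) (i j : Fin n) :
    |pd (stdVec i) (pd (stdVec j) W) x| ≤ ‖hes W x‖ :=
  (norm_le_pi_norm (hes W x i) j).trans (norm_le_pi_norm (hes W x) i)

theorem ExtDecay.lap_decay {n : ℕ} {W : En n → ℝ} {ε c ρ C L : ℝ} (h : ExtDecay W ε c ρ)
    (hε2 : 2 * ε < 1) (hc : 0 < c) (hL : 0 < L)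
    (hLb : ∀ m : Fin n → Fin n → ℝ, ‖m‖ ≤ 1 → |detRem m| ≤ L * ‖m‖ ^ 2 ∧
      ‖fderiv ℝ detRem m‖ ≤ L * ‖m‖) {x : En n} (hx : ρ ≤ ‖x‖) (hx1 : 1 ≤ ‖x‖) (hC : 0 < C)
    (h1 : ‖hes W x‖ ≤ 1) (h2 : ‖hes W x‖ ≤ C * ‖x‖ ^ (-ε))
    (h3 : ∀ i, ‖x‖ * ‖hes (pd (stdVec i) W) x‖ ≤ C * ‖x‖ ^ (-ε)) :
    |lap W x| ≤ (c + L * C ^ 2) * ‖x‖ ^ (-(2 * ε)) ∧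
      ∀ i, |pd (stdVec i) (lap W) x| ≤ (c + L * C ^ 2) * ‖x‖ ^ (-(2 * ε) - 1) := by
  have hx0 : 0 < ‖x‖ := by linarith
  obtain ⟨b1, b2⟩ := hLb _ h1
  have hinv : ‖x‖⁻¹ ≤ ‖x‖ ^ (-(2 * ε)) := by
    rw [← Real.rpow_neg_one]
    exact Real.rpow_le_rpow_of_exponent_le hx1 (by linarith)
  have hsq : (‖x‖ ^ (-ε)) ^ 2 = ‖x‖ ^ (-(2 * ε)) := by
    rw [← Real.rpow_natCast, ← Real.rpow_mul hx0.le]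
    congr 1
    push_cast; ring
  have h2' : ‖hes W x‖ ^ 2 ≤ C ^ 2 * ‖x‖ ^ (-(2 * ε)) := by
    rw [← hsq, ← mul_pow]
    gcongr
  constructor
  · rw [lap_eq_sub_detRem]
    have hd : |detOne (hes W x) - 1| ≤ c * ‖x‖ ^ (-(2 * ε)) := by
      have := h.det_sub_one x hx
      rw [← le_div_iff₀' hx0, div_eq_mul_inv] at this
      exact this.trans (by gcongr)
    refine (abs_sub _ _).trans ?_
    have : L * ‖hes W x‖ ^ 2 ≤ L * (C ^ 2 * ‖x‖ ^ (-(2 * ε))) := by gcongr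
    linarith
  · intro i
    have e : lap W = fun y => (detHes W y - 1) - detRem (hes W y) := by
      funext y
      exact lap_eq_sub_detRem W y
    have hF := detHes_contDiff h.smooth
    rw [e, pd_sub (k := fun y => detRem (hes W y)) (hF.sub contDiff_const) (contDiff_detRem.comp (hes_contDiff h.smooth)),
      pd_sub_const]
    dsimp only
    rw [pd_detRem_hes h.smooth, Real.rpow_sub_one hx0.ne', mul_div_assoc', le_div_iff₀ hx0]
    have hd : |pd (stdVec i) (detHes W) x| * ‖x‖ ≤ c * ‖x‖ ^ (-(2 * ε)) := by
      have := h.det_deriv x (stdVec i) hx (norm_stdVec i)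
      have : |pd (stdVec i) (detHes W) x| * ‖x‖ ≤ c * ‖x‖⁻¹ := by
        rw [← div_eq_mul_inv, le_div_iff₀ hx0]
        linarith
      exact this.trans (by gcongr)
    have hr : |fderiv ℝ detRem (hes W x) (hes (pd (stdVec i) W) x)| * ‖x‖
        ≤ L * C ^ 2 * ‖x‖ ^ (-(2 * ε)) := by
      calc _ ≤ ‖fderiv ℝ detRem (hes W x)‖ * ‖hes (pd (stdVec i) W) x‖ * ‖x‖ := by
            rw [← Real.norm_eq_abs]
            exact mul_le_mul_of_nonneg_right
              ((fderiv ℝ detRem (hes W x)).le_opNorm _) hx0.le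
        _ ≤ (L * ‖hes W x‖) * ‖hes (pd (stdVec i) W) x‖ * ‖x‖ := by gcongr
        _ = L * ‖hes W x‖ * (‖x‖ * ‖hes (pd (stdVec i) W) x‖) := by ring
        _ ≤ L * (C * ‖x‖ ^ (-ε)) * (C * ‖x‖ ^ (-ε)) := by
            refine mul_le_mul ?_ (h3 i) (by positivity) (by positivity)
            gcongr
        _ = _ := by rw [← hsq]; ring
    have := mul_le_mul_of_nonneg_right (abs_sub (pd (stdVec i) (detHes W) x)
      (fderiv ℝ detRem (hes W x) (hes (pd (stdVec i) W) x))) hx0.le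
    rw [add_mul] at this
    refine this.trans ?_
    linarith

theorem ExtDecay.exists_hessian_decay {n : ℕ} (hn : 0 < n) {ε c : ℝ} (ρ : ℝ) (hε : 0 < ε)
    (hε2 : 2 * ε < 1) (hc : 0 < c) :
    ∃ R, 1 ≤ R ∧ ρ ≤ R ∧ ∃ C > 0, ∀ W : En n → ℝ, ExtDecay W ε c ρ → ∀ x, R ≤ ‖x‖ →
      ‖hes W x‖ ≤ C * ‖x‖ ^ (-(2 * ε)) ∧ ∀ i, |pd (stdVec i) W x| ≤ ‖x‖ := by
  obtain ⟨RB, hRB1, hRBρ, -, CB, hCB, HB⟩ := ExtDecay.exists_decay hn (α := 1 / 2) (by norm_num)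
    (by norm_num) ρ hε hc ρ hε (by linarith) hc
  obtain ⟨Rs, hRs1, hRsρ, HS⟩ := ExtDecay.exists_hes_small hn ρ hε hc one_pos
  obtain ⟨L, hL, hq⟩ := exists_detRem_bounds n
  have hL0 : 0 < L := by linarith
  have hLb : ∀ m : Fin n → Fin n → ℝ, ‖m‖ ≤ 1 → |detRem m| ≤ L * ‖m‖ ^ 2 ∧
      ‖fderiv ℝ detRem m‖ ≤ L * ‖m‖ := by
    intro m hm
    obtain ⟨-, -, -, q1, q2⟩ := hq m 0 hm (by simp)
    have := q2 ‖m‖ le_rfl (by simp) hm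
    rw [detRem_zero, sub_zero, sub_zero] at this
    exact ⟨by linarith [sq ‖m‖], q1⟩
  choose CK hCK HK using fun i j : Fin n =>
    _root_.exists_hessian_decay hn (γ := 2 * ε) (by positivity) hε2 (stdVec i) (stdVec j)
  set RC := max RB Rs with hRC
  have hRCB : RB ≤ RC := le_max_left _ _
  have hRCs : Rs ≤ RC := le_max_right _ _
  have hRC0 : 0 < RC := by linarith
  obtain ⟨χ, hχ, hχ1, hχin, hχout⟩ := exists_cutoff n hRC0 (show RC < 2 * RC by linarith)
  obtain ⟨B, hB0, hB⟩ := exists_bound_lap_cutoff_mul hχ (2 * RC)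
  set D := c * (2 * RC) ^ (2 - ε) + 2 * RC + 1 with hD
  have hD0 : 0 < D := by positivity
  set M := (c + L * CB ^ 2) + B * D * (2 * RC) ^ (2 * ε) with hM
  have hM0 : 0 < M := by positivity
  have hM1 : c + L * CB ^ 2 ≤ M := by
    have : 0 ≤ B * D * (2 * RC) ^ (2 * ε) := by positivity
    linarith
  set C := (∑ i, ∑ j, CK i j) * M + 1 with hC
  have hCs : ∀ i j, CK i j ≤ ∑ i, ∑ j, CK i j := fun i j =>
    (Finset.single_le_sum (f := fun j => CK i j) (fun j _ => (hCK i j).le)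
      (Finset.mem_univ j)).trans
    (Finset.single_le_sum (f := fun i => ∑ j, CK i j)
      (fun i _ => Finset.sum_nonneg fun j _ => (hCK i j).le) (Finset.mem_univ i))
  have hCs0 : 0 ≤ ∑ i, ∑ j, CK i j :=
    Finset.sum_nonneg fun i _ => Finset.sum_nonneg fun j _ => (hCK i j).le
  have hC0 : 0 < C := by positivity
  refine ⟨6 * RC, by linarith, by linarith, C, hC0, fun W h x hx => ?_⟩
  set U : En n → ℝ := fun y => χ y * W y with hU
  have hUs : ContDiff ℝ ∞ U := hχ.mul h.smooth
  have hUW : ∀ z, 2 * RC < ‖z‖ → U =ᶠ[nhds z] W := by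
    intro z hz
    filter_upwards [continuous_norm.continuousAt.eventually (lt_mem_nhds hz)] with y hy
    rw [hU]; dsimp only
    rw [hχout y hy.le, one_mul]
  have hlapW : ∀ z, RC ≤ ‖z‖ → _ := fun z hz =>
    h.lap_decay hε2 hc hL0 hLb (by linarith) (by linarith) hCB (HS W h z (by linarith)).1
      (HB W h h.growth z (by linarith)).1 (HB W h h.growth z (by linarith)).2.1
  have hUg : ∀ y, |U y| ≤ c * (1 + ‖y‖) ^ (2 - ε) := by
    intro y
    rw [hU]; dsimp only
    rcases le_or_gt ‖y‖ RC with hy | hy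
    · rw [hχin y hy, zero_mul, abs_zero]
      positivity
    · rw [abs_mul]
      calc |χ y| * |W y| ≤ 1 * (c * ‖y‖ ^ (2 - ε)) := by
            gcongr
            · exact hχ1 y
            · exact h.growth y (by linarith)
        _ ≤ _ := by
            rw [one_mul]
            gcongr c * ?_
            exact Real.rpow_le_rpow (norm_nonneg _) (by linarith) (by linarith)
  have hUlap : ∀ z, |lap U z| ≤ M * ‖z‖ ^ (-(2 * ε)) := by
    intro z
    rcases lt_or_ge ‖z‖ RC with hz | hz
    · have : U =ᶠ[nhds z] fun _ => 0 := by
        filter_upwards [continuous_norm.continuousAt.eventually (gt_mem_nhds hz)] with y hy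
        rw [hU]; dsimp only
        rw [hχin y (le_of_lt hy), zero_mul]
      rw [(lap_congr_of_eventuallyEq this).eq_of_nhds]
      have : lap (fun _ : En n => (0 : ℝ)) z = 0 := by
        have e : ∀ a : En n, pd a (fun _ : En n => (0 : ℝ)) = fun _ => 0 := fun a => by
          funext y; simp [pd]
        simp [lap, e]
      rw [this, abs_zero]
      positivity
    · have hz0 : 0 < ‖z‖ := by linarith
      rcases le_or_gt ‖z‖ (2 * RC) with hz2 | hz2
      · obtain ⟨s1, s2⟩ := HS W h z (by linarith)
        have hR0 : 0 ≤ c * (2 * RC) ^ (2 - ε) := by positivity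
        have := hB W D h.smooth z hz2 (by
          have : c * ‖z‖ ^ (2 - ε) ≤ c * (2 * RC) ^ (2 - ε) := by
            gcongr
            linarith
          linarith [h.growth z (by linarith)])
          (fun i => by linarith [s2 _ (norm_stdVec i)])
          (fun i => by linarith [abs_hes_le W z i i])
        refine this.trans ?_
        have e1 : 1 ≤ (2 * RC) ^ (2 * ε) * ‖z‖ ^ (-(2 * ε)) := by
          rw [Real.rpow_neg hz0.le, ← div_eq_mul_inv, le_div_iff₀ (by positivity), one_mul]
          exact Real.rpow_le_rpow hz0.le hz2 (by positivity)
        have e2 : B * D * 1 ≤ B * D * ((2 * RC) ^ (2 * ε) * ‖z‖ ^ (-(2 * ε))) := by gcongr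
        have e3 : 0 ≤ (c + L * CB ^ 2) * ‖z‖ ^ (-(2 * ε)) := by positivity
        rw [hM, add_mul]
        linarith
      · rw [(lap_congr_of_eventuallyEq (hUW z hz2)).eq_of_nhds]
        refine (hlapW z hz).1.trans ?_
        gcongr
  have hUd : ∀ z, 3 * RC ≤ ‖z‖ → ∀ i, |pd (stdVec i) (lap U) z| ≤ M * ‖z‖ ^ (-(2 * ε) - 1) := by
    intro z hz i
    rw [(pd_congr_of_eventuallyEq (lap_congr_of_eventuallyEq
      (hUW z (by linarith))) _).eq_of_nhds]
    refine ((hlapW z (by linarith)).2 i).trans ?_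
    gcongr
  have hx0 : 0 < ‖x‖ := by linarith
  refine ⟨?_, fun i => (HS W h x (by linarith)).2 _ (norm_stdVec i)⟩
  rw [pi_norm_le_iff_of_nonneg (by positivity)]
  intro i
  rw [pi_norm_le_iff_of_nonneg (by positivity)]
  intro j
  have := HK i j U hUs M (3 * RC) ε c hM0.le (by positivity) hε (by linarith) hUg hUlap hUd x
    (by linarith)
  rw [(pd_congr_of_eventuallyEq (pd_congr_of_eventuallyEq
      (hUW x (by linarith)) _) _).eq_of_nhds] at this
  refine this.trans ?_
  have e1 : CK i j * M ≤ (∑ i, ∑ j, CK i j) * M := by gcongr; exact hCs i j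
  gcongr
  linarith

theorem abs_le_of_radial_derivative {n : ℕ} {h : En n → ℝ} (hh : ContDiff ℝ ∞ h) {R D B p : ℝ}
    (hR : 1 ≤ R) (hp : 0 < p) (hD : 0 ≤ D) (hB : 0 ≤ B) (h0 : ∀ z, ‖z‖ = R → |h z| ≤ D)
    (h1 : ∀ z u, R ≤ ‖z‖ → ‖u‖ = 1 → |pd u h z| ≤ B * ‖z‖ ^ (p - 1)) {x : En n} (hx : R ≤ ‖x‖) :
    |h x| ≤ (D + B / p) * ‖x‖ ^ p := by
  have hx0 : 0 < ‖x‖ := by linarith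
  set u : En n := ‖x‖⁻¹ • x with hu
  have hu1 : ‖u‖ = 1 := by rw [hu, norm_smul, norm_inv, norm_norm, inv_mul_cancel₀ hx0.ne']
  have hnorm : ∀ t : ℝ, 0 ≤ t → ‖(0 : En n) + t • u‖ = t := by
    intro t ht
    rw [zero_add, norm_smul, hu1, mul_one, Real.norm_of_nonneg ht]
  have hd : ∀ t, HasDerivAt (fun t : ℝ => h (0 + t • u)) (pd u h (0 + t • u)) t :=
    hasDerivAt_line hh 0 u
  have hBd : ∀ t : ℝ, 0 < t → HasDerivAt (fun t : ℝ => D + B / p * t ^ p) (B * t ^ (p - 1)) t := by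
    intro t ht
    refine (((Real.hasDerivAt_rpow_const (Or.inl ht.ne')).const_mul (B / p)).const_add D).congr_deriv
      ?_
    field_simp
  have key := image_norm_le_of_norm_deriv_right_le_deriv_boundary'
    (f := fun t : ℝ => h (0 + t • u)) (a := R) (b := ‖x‖)
    (f' := fun t => pd u h (0 + t • u)) (B := fun t => D + B / p * t ^ p)
    (B' := fun t => B * t ^ (p - 1))
    (fun t _ => (hd t).continuousAt.continuousWithinAt) (fun t _ => (hd t).hasDerivWithinAt)
    (by
      have := h0 (0 + R • u) (hnorm R (by linarith))
      have h2 : 0 ≤ B / p * R ^ p := by positivity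
      rw [Real.norm_eq_abs]
      linarith)
    (fun t ht => (hBd t (by linarith [ht.1])).continuousAt.continuousWithinAt)
    (fun t ht => (hBd t (by linarith [ht.1])).hasDerivWithinAt)
    (fun t ht => by
      have hn := hnorm t (by linarith [ht.1])
      have := h1 (0 + t • u) u (by rw [hn]; exact ht.1) hu1
      rwa [hn] at this)
    (Set.right_mem_Icc.2 hx)
  have e : (0 : En n) + ‖x‖ • u = x := by rw [zero_add, hu, smul_inv_smul₀ hx0.ne']
  rw [e, Real.norm_eq_abs] at key
  have : 1 ≤ ‖x‖ ^ p := Real.one_le_rpow (by linarith) hp.le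
  calc |h x| ≤ D * 1 + B / p * ‖x‖ ^ p := by linarith
    _ ≤ D * ‖x‖ ^ p + B / p * ‖x‖ ^ p := by gcongr
    _ = _ := by ring

theorem ExtDecay.exists_full_decay {n : ℕ} (hn : 0 < n) {ε c : ℝ} (ρ : ℝ) (hε : 0 < ε)
    (hε2 : 2 * ε < 1) (hc : 0 < c) :
    ∃ R, 1 ≤ R ∧ ρ ≤ R ∧ ∃ C > 0, ∀ W : En n → ℝ, ExtDecay W ε c ρ → ∀ x, R ≤ ‖x‖ →
      |W x| ≤ C * ‖x‖ ^ (2 - 2 * ε) ∧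
      (∀ i, ‖x‖ * |pd (stdVec i) W x| ≤ C * ‖x‖ ^ (2 - 2 * ε)) ∧
      ‖hes W x‖ ≤ C * ‖x‖ ^ (-(2 * ε)) ∧
      (∀ i, ‖x‖ * ‖hes (pd (stdVec i) W) x‖ ≤ C * ‖x‖ ^ (-(2 * ε))) ∧
      ∀ i j, ‖x‖ ^ 2 * ‖hes (pd (stdVec i) (pd (stdVec j) W)) x‖ ≤ C * ‖x‖ ^ (-(2 * ε)) := by
  obtain ⟨R, hR1, hRρ, C, hC, H⟩ := ExtDecay.exists_hessian_decay hn ρ hε hε2 hc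
  have hR0 : 0 < R := by linarith
  set C₁ := R + n * C / (1 - 2 * ε) with hC₁
  have h12 : 0 < 1 - 2 * ε := by linarith
  have hC₁0 : 0 < C₁ := by positivity
  set C₂ := c * R ^ (2 - ε) + n * C₁ / (2 - 2 * ε) with hC₂
  have h22 : 0 < 2 - 2 * ε := by linarith
  have hC₂0 : 0 < C₂ := by positivity
  have hgrad : ∀ W : En n → ℝ, ExtDecay W ε c ρ → ∀ x, R ≤ ‖x‖ → ∀ i,
      |pd (stdVec i) W x| ≤ C₁ * ‖x‖ ^ (1 - 2 * ε) := by
    intro W h x hx i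
    refine abs_le_of_radial_derivative (pd_contDiff h.smooth _) hR1 h12 hR0.le (by positivity)
      (fun z hz => by simpa [hz] using (H W h z hz.ge).2 i) (fun z u hz hu => ?_) hx
    have := abs_pd_le_of_basis (g := pd (stdVec i) W) (x := z) u fun j =>
      (abs_hes_le W z j i).trans (H W h z hz).1
    rw [hu, mul_one] at this
    rw [show 1 - 2 * ε - 1 = -(2 * ε) by ring, mul_assoc]
    exact this
  have hval : ∀ W : En n → ℝ, ExtDecay W ε c ρ → ∀ x, R ≤ ‖x‖ →
      |W x| ≤ C₂ * ‖x‖ ^ (2 - 2 * ε) := by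
    intro W h x hx
    refine abs_le_of_radial_derivative h.smooth hR1 h22 (by positivity) (by positivity)
      (fun z hz => by simpa [hz] using h.growth z (hRρ.trans hz.ge)) (fun z u hz hu => ?_) hx
    have := abs_pd_le_of_basis (g := W) (x := z) u fun j => hgrad W h z hz j
    rw [hu, mul_one] at this
    rw [show 2 - 2 * ε - 1 = 1 - 2 * ε by ring, mul_assoc]
    exact this
  obtain ⟨R', hR'1, hR'ρ, hR'R, C₃, hC₃, HD⟩ := ExtDecay.exists_decay hn (α := 1 / 2)
    (by norm_num) (by norm_num) ρ hε hc R (show 0 < 2 * ε by linarith) hε2.le hC₂0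
  refine ⟨R', hR'1, hR'ρ, C₁ + C₂ + C₃, by positivity, fun W h x hx => ?_⟩
  have hx0 : 0 < ‖x‖ := by linarith
  obtain ⟨d1, d2, d3⟩ := HD W h (hval W h) x hx
  have hmono : ∀ {D q : ℝ}, D ≤ C₁ + C₂ + C₃ → D * ‖x‖ ^ q ≤ (C₁ + C₂ + C₃) * ‖x‖ ^ q := by
    intro D q hD
    gcongr
  refine ⟨(hval W h x (by linarith)).trans (hmono (by linarith)), fun i => ?_,
    d1.trans (hmono (by linarith)), fun i => (d2 i).trans (hmono (by linarith)),
    fun i j => (d3 i j).1.trans (hmono (by linarith))⟩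
  calc ‖x‖ * |pd (stdVec i) W x| ≤ ‖x‖ * (C₁ * ‖x‖ ^ (1 - 2 * ε)) := by
        gcongr
        exact hgrad W h x (by linarith) i
    _ = C₁ * ‖x‖ ^ (2 - 2 * ε) := by
        rw [show 2 - 2 * ε = 1 + (1 - 2 * ε) by ring, Real.rpow_add hx0, Real.rpow_one]
        ring
    _ ≤ _ := hmono (by linarith)

theorem pd_comp_clm {n : ℕ} {h : En n → ℝ} (hh : ContDiff ℝ ∞ h) (x₀ : En n)
    (L : En n →L[ℝ] En n) (a : En n) :
    pd a (fun y => h (x₀ + L y)) = fun y => pd (L a) h (x₀ + L y) := by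
  funext y
  have h1 : HasFDerivAt h (fderiv ℝ h (x₀ + L y)) (x₀ + L y) :=
    (hh.differentiable (by norm_num) _).hasFDerivAt
  have h2 : HasFDerivAt (fun y : En n => x₀ + L y) L y := L.hasFDerivAt.const_add x₀
  have := (h1.comp y h2).fderiv
  simp only [pd]
  change fderiv ℝ (h ∘ fun y => x₀ + L y) y a = _
  rw [this]
  simp

theorem contDiff_comp_clm {n : ℕ} {h : En n → ℝ} (hh : ContDiff ℝ ∞ h) (x₀ : En n)
    (L : En n →L[ℝ] En n) : ContDiff ℝ ∞ (fun y => h (x₀ + L y)) :=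
  hh.comp (contDiff_const.add L.contDiff)

theorem abs_apply_le_of_basis {n k : ℕ}
    (T : ContinuousMultilinearMap ℝ (fun _ : Fin k => En n) ℝ) {B : ℝ} (hB : 0 ≤ B)
    (hT : ∀ I : Fin k → Fin n, |T fun j => stdVec (I j)| ≤ B) (m : Fin k → En n) :
    |T m| ≤ (n : ℝ) ^ k * B * ∏ j, ‖m j‖ := by
  have h1 := T.le_opNorm m
  rw [Real.norm_eq_abs] at h1
  exact h1.trans (mul_le_mul_of_nonneg_right (norm_multilinear_le_of_basis T hB hT)
    (Finset.prod_nonneg fun _ _ => norm_nonneg _))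

theorem abs_pds_le_of_basis {n k : ℕ} {h : En n → ℝ} (hh : ContDiff ℝ ∞ h) {x : En n} {B : ℝ}
    (hB : 0 ≤ B) (hI : ∀ I : Fin k → Fin n, |pds (List.ofFn fun j => stdVec (I j)) h x| ≤ B)
    (m : Fin k → En n) : |pds (List.ofFn m) h x| ≤ (n : ℝ) ^ k * B * ∏ j, ‖m j‖ := by
  rw [← iteratedFDeriv_apply_eq_pds hh]
  refine abs_apply_le_of_basis _ hB (fun I => ?_) m
  rw [iteratedFDeriv_apply_eq_pds hh]
  exact hI I

theorem abs_pds_sub_le_of_basis {n k : ℕ} {h : En n → ℝ} (hh : ContDiff ℝ ∞ h) {x x' : En n}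
    {B : ℝ} (hB : 0 ≤ B)
    (hI : ∀ I : Fin k → Fin n, |pds (List.ofFn fun j => stdVec (I j)) h x -
      pds (List.ofFn fun j => stdVec (I j)) h x'| ≤ B) (m : Fin k → En n) :
    |pds (List.ofFn m) h x - pds (List.ofFn m) h x'| ≤ (n : ℝ) ^ k * B * ∏ j, ‖m j‖ := by
  have := abs_apply_le_of_basis (iteratedFDeriv ℝ k h x - iteratedFDeriv ℝ k h x') hB
    (fun I => ?_) m
  · simpa only [_root_.sub_apply, iteratedFDeriv_apply_eq_pds hh] using this
  · simpa only [_root_.sub_apply, iteratedFDeriv_apply_eq_pds hh] using hI I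

theorem abs_pd_pd_pd_le_of_basis {n : ℕ} {h : En n → ℝ} (hh : ContDiff ℝ ∞ h) {x : En n} {B : ℝ}
    (hB : 0 ≤ B)
    (hI : ∀ i j k, |pd (stdVec i) (pd (stdVec j) (pd (stdVec k) h)) x| ≤ B) (a b c : En n) :
    |pd a (pd b (pd c h)) x| ≤ (n : ℝ) ^ 3 * B * (‖a‖ * ‖b‖ * ‖c‖) := by
  have := abs_pds_le_of_basis hh hB (x := x) (k := 3)
    (fun I => by simpa [List.ofFn_succ, pds] using hI (I 0) (I 1) (I 2)) ![a, b, c]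
  simpa [List.ofFn_succ, pds, Fin.prod_univ_succ, mul_assoc] using this

theorem abs_pd_pd_le_of_basis {n : ℕ} {h : En n → ℝ} (hh : ContDiff ℝ ∞ h) {x : En n} {B : ℝ}
    (hB : 0 ≤ B)
    (hI : ∀ i j, |pd (stdVec i) (pd (stdVec j) h) x| ≤ B) (a b : En n) :
    |pd a (pd b h) x| ≤ (n : ℝ) ^ 2 * B * (‖a‖ * ‖b‖) := by
  have := abs_pds_le_of_basis hh hB (x := x) (k := 2)
    (fun I => by simpa [List.ofFn_succ, pds] using hI (I 0) (I 1)) ![a, b]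
  simpa [List.ofFn_succ, pds, Fin.prod_univ_succ, mul_assoc] using this

theorem abs_pd_pd_pd_pd_sub_le_of_basis {n : ℕ} {h : En n → ℝ} (hh : ContDiff ℝ ∞ h) {x x' : En n}
    {B : ℝ} (hB : 0 ≤ B)
    (hI : ∀ i j k l, |pd (stdVec i) (pd (stdVec j) (pd (stdVec k) (pd (stdVec l) h))) x -
      pd (stdVec i) (pd (stdVec j) (pd (stdVec k) (pd (stdVec l) h))) x'| ≤ B) (a b c d : En n) :
    |pd a (pd b (pd c (pd d h))) x - pd a (pd b (pd c (pd d h))) x'| ≤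
      (n : ℝ) ^ 4 * B * (‖a‖ * ‖b‖ * ‖c‖ * ‖d‖) := by
  have := abs_pds_sub_le_of_basis hh hB (x := x) (x' := x') (k := 4)
    (fun I => by simpa [List.ofFn_succ, pds] using hI (I 0) (I 1) (I 2) (I 3)) ![a, b, c, d]
  simpa [List.ofFn_succ, pds, Fin.prod_univ_succ, mul_assoc] using this

theorem pd_smul {n : ℕ} (s : ℝ) (a : En n) (h : En n → ℝ) :
    pd (s • a) h = fun x => s * pd a h x := by
  funext x
  simp [pd]

theorem detOne_scaled {n : ℕ} (s : Fin n → ℝ) (m m' : Fin n → Fin n → ℝ)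
    (h : ∀ i j, m' i j = (if i = j then s i ^ 2 - 1 else 0) + s i * s j * m i j) :
    detOne m' = (∏ i, s i) ^ 2 * detOne m := by
  have h1 : 1 + Matrix.of m' = Matrix.diagonal s * (1 + Matrix.of m) * Matrix.diagonal s := by
    ext i j
    simp only [Matrix.add_apply, Matrix.of_apply, h, Matrix.diagonal_mul, Matrix.mul_diagonal,
      Matrix.one_apply]
    split_ifs with hij
    · subst hij; ring
    · ring
  rw [detOne, detOne, h1, Matrix.det_mul, Matrix.det_mul, Matrix.det_diagonal]
  ring

theorem exists_normalizing_map {n : ℕ} (hn : 0 < n) {W : En n → ℝ} (hW : ContDiff ℝ ∞ W)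
    (x₀ : En n) (hx₀ : ‖hes W x₀‖ ≤ 1 / (2 * (n : ℝ) ^ 2)) :
    ∃ (T : En n →L[ℝ] En n) (P : ℝ) (d : Fin n → ℝ), 0 ≤ P ∧ P ≤ 4 ^ n ∧
      (∀ y, ‖T y‖ ≤ 2 * n * ‖y‖) ∧ (∀ x, ∃ y, T y = x ∧ ‖y‖ ≤ 2 * n * ‖x‖) ∧
      (∀ i j, (if i = j then d i else 0) + pd (T (stdVec i)) (pd (T (stdVec j)) W) x₀ = 0) ∧
      ∀ x, detOne (fun i j => (if i = j then d i else 0) +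
        pd (T (stdVec i)) (pd (T (stdVec j)) W) x) = P * detHes W x := by
  have hn' : (1 : ℝ) ≤ n := by exact_mod_cast hn
  obtain ⟨b, lam, hb⟩ := exists_eigenbasis hW x₀
  have hlam : ∀ i, |lam i - 1| ≤ 1 / 2 := by
    intro i
    have h1 := hb i i
    rw [if_pos rfl] at h1
    rw [← h1, hesB]
    have := abs_pd_pd_le_of_basis hW (x := x₀) (B := 1 / (2 * (n : ℝ) ^ 2)) (by positivity)
      (fun i j => (abs_hes_le W x₀ i j).trans hx₀) (b i) (b i)
    rw [b.norm_eq_one] at this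
    refine this.trans (le_of_eq ?_)
    field_simp
  have hl1 : ∀ i, 1 / 2 ≤ lam i := fun i => by linarith [(abs_le.1 (hlam i)).1]
  have hl2 : ∀ i, lam i ≤ 2 := fun i => by linarith [(abs_le.1 (hlam i)).2]
  set s : Fin n → ℝ := fun i => (Real.sqrt (lam i))⁻¹ with hs
  have hq0 : ∀ i, 0 < Real.sqrt (lam i) := fun i => Real.sqrt_pos.2 (by linarith [hl1 i])
  have hs0 : ∀ i, 0 < s i := fun i => inv_pos.2 (hq0 i)
  have hsq : ∀ i, s i ^ 2 * lam i = 1 := by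
    intro i
    rw [hs]
    simp only [inv_pow]
    rw [Real.sq_sqrt (by linarith [hl1 i]), inv_mul_cancel₀ (by linarith [hl1 i])]
  have hs2 : ∀ i, s i ≤ 2 := by
    intro i
    have h1 := hsq i
    have h2 := hl1 i
    by_contra h
    push Not at h
    nlinarith [hs0 i, sq_nonneg (s i - 2)]
  have hsi : ∀ i, (s i)⁻¹ ≤ 2 := by
    intro i
    simp only [hs, inv_inv]
    rw [Real.sqrt_le_left (by norm_num)]
    linarith [hl2 i]
  have hcoord : ∀ (y : En n) i, |y i| ≤ ‖y‖ := fun y i => by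
    simpa using PiLp.norm_apply_le y i
  let T : En n →L[ℝ] En n :=
    ∑ k, (s k • (EuclideanSpace.proj k : En n →L[ℝ] ℝ)).smulRight (b k)
  have hT : ∀ y, T y = ∑ k, (s k * y k) • b k := by
    intro y
    simp [T]
  have hTe : ∀ i, T (stdVec i) = s i • b i := by
    intro i
    rw [hT]
    simp
  have hpd : ∀ i j x, pd (T (stdVec i)) (pd (T (stdVec j)) W) x = s i * s j * hesB b W x i j := by
    intro i j x
    rw [hTe, hTe, pd_smul, pd_smul, pd_const_mul (pd_contDiff hW _), hesB]
    ring
  have hnorm : ∀ (c : Fin n → ℝ) (q : ℝ) (e : Fin n → En n), (∀ k, ‖e k‖ = 1) →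
      (∀ k, |c k| ≤ q) → ‖∑ k, c k • e k‖ ≤ n * q := by
    intro c q e he hc
    refine (norm_sum_le _ _).trans ?_
    refine (Finset.sum_le_sum (g := fun _ => q) fun k _ => ?_).trans (by simp)
    rw [norm_smul, he, mul_one]
    exact hc k
  refine ⟨T, (∏ i, s i) ^ 2, fun i => s i ^ 2 - 1, sq_nonneg _, ?_, ?_, ?_, ?_, ?_⟩
  · rw [← Finset.prod_pow]
    refine (Finset.prod_le_prod (g := fun _ => (4 : ℝ)) (fun i _ => sq_nonneg _)
      fun i _ => ?_).trans (by simp)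
    nlinarith [hs0 i, hs2 i]
  · intro y
    rw [hT]
    refine (hnorm _ (2 * ‖y‖) _ (fun k => b.norm_eq_one k) fun k => ?_).trans (by ring_nf; rfl)
    rw [abs_mul, abs_of_pos (hs0 k)]
    exact mul_le_mul (hs2 k) (hcoord y k) (abs_nonneg _) (by norm_num)
  · intro x
    refine ⟨∑ k, ((s k)⁻¹ * ⟪b k, x⟫) • stdVec k, ?_, ?_⟩
    · rw [map_sum]
      conv_rhs => rw [← b.sum_repr' x]
      refine Finset.sum_congr rfl fun k _ => ?_
      rw [map_smul, hTe, smul_smul]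
      congr 1
      field_simp [(hs0 k).ne']
    · refine (hnorm _ (2 * ‖x‖) _ norm_stdVec fun k => ?_).trans (by ring_nf; rfl)
      rw [abs_mul, abs_of_pos (inv_pos.2 (hs0 k))]
      refine mul_le_mul (hsi k) ?_ (abs_nonneg _) (by norm_num)
      have := abs_real_inner_le_norm (b k) x
      rwa [b.norm_eq_one, one_mul] at this
  · intro i j
    rw [hpd, hb]
    split_ifs with hij
    · subst hij
      linear_combination hsq i
    · ring
  · intro x
    rw [detHes, ← detOne_hesB b hW]
    refine detOne_scaled s _ _ fun i j => ?_
    rw [hpd]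

theorem pd_clm {n : ℕ} (l : En n →L[ℝ] ℝ) (a : En n) : pd a (fun y => l y) = fun _ => l a := by
  funext y
  simp [pd]

theorem pd_const {n : ℕ} (c : ℝ) (a : En n) : pd a (fun _ => c) = fun _ => 0 := by
  funext y
  simp [pd]

theorem exists_zero_jet {n : ℕ} {V : En n → ℝ} (hV : ContDiff ℝ ∞ V) :
    ∃ V' : En n → ℝ, ContDiff ℝ ∞ V' ∧ V' 0 = 0 ∧ (∀ a, pd a V' 0 = 0) ∧
      ∀ a c, pd a (pd c V') = pd a (pd c V) := by
  have hl : ContDiff ℝ ∞ fun y => fderiv ℝ V 0 y := (fderiv ℝ V 0).contDiff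
  have h1 : ∀ a, pd a (fun y => V y - fderiv ℝ V 0 y - V 0) =
      fun y => pd a V y - fderiv ℝ V 0 a := by
    intro a
    rw [pd_sub_const, pd_sub hV hl, pd_clm]
  refine ⟨fun y => V y - fderiv ℝ V 0 y - V 0, (hV.sub hl).sub contDiff_const, by simp,
    fun a => ?_, fun a c => ?_⟩
  · rw [h1]
    simp [pd]
  · rw [h1, pd_sub_const]

theorem pd_pd_diag_quadratic {n : ℕ} (d : Fin n → ℝ) :
    ContDiff ℝ ∞ (fun y : En n => ∑ k, d k / 2 * (y k * y k)) ∧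
      ∀ a c, pd a (pd c fun y : En n => ∑ k, d k / 2 * (y k * y k)) =
        fun _ => ∑ k, d k * (a k * c k) := by
  have hc : ∀ k, ContDiff ℝ ∞ fun y : En n => y k := fun k =>
    (EuclideanSpace.proj k : En n →L[ℝ] ℝ).contDiff
  have hp : ∀ k (a : En n), pd a (fun y : En n => y k) = fun _ => a k := fun k a =>
    pd_clm (EuclideanSpace.proj k : En n →L[ℝ] ℝ) a
  refine ⟨ContDiff.sum fun k _ => contDiff_const.mul ((hc k).mul (hc k)), fun a c => ?_⟩
  rw [pd_sum (h := fun k y => d k / 2 * (y k * y k)) _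
    fun k _ => contDiff_const.mul ((hc k).mul (hc k))]
  have h1 : ∀ k, pd c (fun y : En n => d k / 2 * (y k * y k)) = fun y => d k * c k * y k := by
    intro k
    rw [pd_const_mul ((hc k).mul (hc k)), pd_mul (hc k) (hc k), hp]
    funext y
    ring
  simp only [h1]
  rw [pd_sum (h := fun k y => d k * c k * y k) _ fun k _ => contDiff_const.mul (hc k)]
  simp only [pd_const_mul (hc _), hp]
  funext y
  exact Finset.sum_congr rfl fun k _ => by ring

theorem small_of_hes_small {n : ℕ} {V : En n → ℝ} (hV : ContDiff ℝ ∞ V) {η : ℝ}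
    (h0 : V 0 = 0) (h1 : ∀ a, pd a V 0 = 0) (h2 : ∀ x, ‖x‖ ≤ 1 → ‖hes V x‖ ≤ η) {x : En n}
    (hx : ‖x‖ ≤ 1) : |V x| ≤ (n : ℝ) ^ 2 * η := by
  have hη : 0 ≤ η := (norm_nonneg _).trans (h2 x hx)
  have hs : Convex ℝ (Metric.closedBall (0 : En n) 1) := convex_closedBall _ _
  have hm : ∀ {y : En n}, y ∈ Metric.closedBall (0 : En n) 1 ↔ ‖y‖ ≤ 1 := by simp
  have hm0 : (0 : En n) ∈ Metric.closedBall (0 : En n) 1 := by simp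
  have h3 : ∀ i, ∀ y ∈ Metric.closedBall (0 : En n) 1, |pd (stdVec i) V y| ≤ n * η := by
    intro i y hy
    have := abs_sub_le_of_abs_pd_le (pd_contDiff hV (stdVec i)) hs hη
      (fun j z hz => (abs_hes_le V z j i).trans (h2 z (hm.1 hz))) hy hm0
    rw [h1, sub_zero, sub_zero] at this
    refine this.trans (mul_le_of_le_one_right (by positivity) (hm.1 hy))
  have := abs_sub_le_of_abs_pd_le hV hs (by positivity) h3 (hm.2 hx) hm0
  rw [h0, sub_zero, sub_zero] at this
  calc |V x| ≤ n * (n * η) * ‖x‖ := this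
    _ ≤ n * (n * η) * 1 := by gcongr
    _ = (n : ℝ) ^ 2 * η := by ring

theorem local_holder {n : ℕ} (hn : 0 < n) {α : ℝ} (hα : 0 < α) (hα1 : α < 1) {B : ℝ}
    (hB : 0 ≤ B) :
    ∃ τ > 0, ∃ C > 0, ∀ W : En n → ℝ, ContDiff ℝ ∞ W → ∀ x₀ : En n,
      ‖hes W x₀‖ ≤ 1 / (2 * (n : ℝ) ^ 2) →
      (∀ x, ‖x - x₀‖ ≤ 1 → (∀ i, ‖hes (pd (stdVec i) W) x‖ ≤ B) ∧
        ∀ i j k, |pd (stdVec i) (detHes W) x| ≤ B ∧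
          |pd (stdVec i) (pd (stdVec j) (detHes W)) x| ≤ B ∧
          |pd (stdVec i) (pd (stdVec j) (pd (stdVec k) (detHes W))) x| ≤ B) →
      ∀ x, ‖x - x₀‖ ≤ τ → ∀ i j, ‖hes (pd (stdVec i) (pd (stdVec j) W)) x -
        hes (pd (stdVec i) (pd (stdVec j) W)) x₀‖ ≤ C * ‖x - x₀‖ ^ α := by
  obtain ⟨δ₀, hδ₀, C, hC, H⟩ := small_solution_estimate hn hα hα1
  have hn' : (1 : ℝ) ≤ n := by exact_mod_cast hn
  set K : ℝ := 4 ^ n * 8 * (n : ℝ) ^ 9 * B with hK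
  have hK0 : 0 ≤ K := by positivity
  set ρ : ℝ := min (1 / (2 * n)) (δ₀ / (K + 1)) with hρ
  have hρ0 : 0 < ρ := lt_min (by positivity) (by positivity)
  have hρ1 : ρ * (2 * n) ≤ 1 := by
    have : ρ ≤ 1 / (2 * n) := min_le_left _ _
    rwa [le_div_iff₀ (by positivity)] at this
  have hρ1' : ρ ≤ 1 := by nlinarith
  have hρ2 : ρ * K ≤ δ₀ := by
    have : ρ ≤ δ₀ / (K + 1) := min_le_right _ _
    rw [le_div_iff₀ (by positivity)] at this
    linarith
  refine ⟨ρ / (16 * n), by positivity,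
    (ρ ^ 2)⁻¹ * (n ^ 4 * (C * δ₀ * (2 * n * ρ⁻¹) ^ α) * (2 * n) ^ 4), by positivity,
    fun W hW x₀ hx₀ hx x hxτ i j => ?_⟩
  obtain ⟨T, P, d, hP0, hP, hT, hTs, hd, hdet⟩ := exists_normalizing_map hn hW x₀ hx₀
  set L : En n →L[ℝ] En n := ρ • T with hL
  have hLy : ∀ y, L y = ρ • T y := fun y => rfl
  have hLn : ∀ y, ‖y‖ ≤ 1 → ‖x₀ + L y - x₀‖ ≤ 1 := by
    intro y hy
    rw [add_sub_cancel_left, hLy, norm_smul, Real.norm_of_nonneg hρ0.le]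
    calc ρ * ‖T y‖ ≤ ρ * (2 * n * 1) := by
          gcongr
          exact (hT y).trans (by gcongr)
      _ ≤ 1 := by linarith
  have hTe : ∀ i, ‖T (stdVec i)‖ ≤ 2 * n := fun i => by
    simpa [norm_stdVec] using hT (stdVec i)
  obtain ⟨hq, hqd⟩ := pd_pd_diag_quadratic d
  have hWL : ContDiff ℝ ∞ fun y => (ρ ^ 2)⁻¹ * W (x₀ + L y) :=
    contDiff_const.mul (contDiff_comp_clm hW x₀ L)
  have hLpd : ∀ {h : En n → ℝ} (_ : ContDiff ℝ ∞ h) a,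
      pd a (fun y => h (x₀ + L y)) = fun y => ρ * pd (T a) h (x₀ + L y) := by
    intro h hh a
    rw [pd_comp_clm hh, hLy, pd_smul]
  obtain ⟨V, hV, hV0, hV1, hV2⟩ := exists_zero_jet (hWL.add hq)
  have hVW : ∀ a c, pd a (pd c V) =
      fun y => pd (T a) (pd (T c) W) (x₀ + L y) + ∑ k, d k * (a k * c k) := by
    intro a c
    rw [hV2, pd_add hWL hq, pd_add (pd_contDiff hWL c) (pd_contDiff hq c), hqd,
      pd_const_mul (contDiff_comp_clm hW x₀ L), hLpd hW,
      pd_const_mul (contDiff_const.mul (contDiff_comp_clm (pd_contDiff hW _) x₀ L)),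
      pd_const_mul (contDiff_comp_clm (pd_contDiff hW _) x₀ L), hLpd (pd_contDiff hW _)]
    funext y
    field_simp
  have hVW3 : ∀ a b c, pd a (pd b (pd c V)) =
      fun y => ρ * pd (T a) (pd (T b) (pd (T c) W)) (x₀ + L y) := by
    intro a b c
    have hc2 := pd_contDiff (pd_contDiff hW (T c)) (T b)
    rw [hVW, pd_add (contDiff_comp_clm hc2 x₀ L) contDiff_const, hLpd hc2, pd_const]
    funext y
    ring
  have hVW4 : ∀ a b c e, pd a (pd b (pd c (pd e V))) =
      fun y => ρ ^ 2 * pd (T a) (pd (T b) (pd (T c) (pd (T e) W))) (x₀ + L y) := by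
    intro a b c e
    have hc3 := pd_contDiff (pd_contDiff (pd_contDiff hW (T e)) (T c)) (T b)
    rw [hVW3, pd_const_mul (contDiff_comp_clm hc3 x₀ L), hLpd hc3]
    funext y
    ring
  have hhes : ∀ y, hes V y = fun i j => (if i = j then d i else 0) +
      pd (T (stdVec i)) (pd (T (stdVec j)) W) (x₀ + L y) := by
    intro y
    funext i j
    rw [hes, hVW]
    have : ∑ k, d k * ((stdVec i : En n) k * (stdVec j : En n) k) = if i = j then d i else 0 := by
      simp only [PiLp.single_apply]
      split_ifs with hij <;> simp [hij, eq_comm]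
    rw [this, add_comm]
  have hhes0 : hes V 0 = 0 := by
    rw [hhes]
    funext i j
    rw [map_zero, add_zero, hd]
    rfl
  have hF : (fun y => detOne (hes V y)) = fun y => P * detHes W (x₀ + L y) := by
    funext y
    rw [hhes, hdet]
  have hb3 : ∀ y, ‖y‖ ≤ 1 → ∀ i j k, |pd (stdVec i) (pd (stdVec j) (pd (stdVec k) V)) y| ≤
      ρ * (8 * (n : ℝ) ^ 6 * B) := by
    intro y hy i j k
    rw [hVW3, abs_mul, abs_of_pos hρ0]
    refine mul_le_mul_of_nonneg_left ?_ hρ0.le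
    refine (abs_pd_pd_pd_le_of_basis hW hB (fun i j k => ?_) _ _ _).trans ?_
    · exact (abs_hes_le (pd (stdVec k) W) _ i j).trans ((hx _ (hLn y hy)).1 k)
    · calc (n : ℝ) ^ 3 * B * (‖T (stdVec i)‖ * ‖T (stdVec j)‖ * ‖T (stdVec k)‖)
          ≤ (n : ℝ) ^ 3 * B * ((2 * n) * (2 * n) * (2 * n)) := by
            gcongr <;> exact hTe _
        _ = 8 * (n : ℝ) ^ 6 * B := by ring
  have hhb : ∀ y, ‖y‖ ≤ 1 → ‖hes V y‖ ≤ ρ * (8 * (n : ℝ) ^ 7 * B) := by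
    intro y hy
    rw [pi_norm_le_iff_of_nonneg (by positivity)]
    intro i
    rw [pi_norm_le_iff_of_nonneg (by positivity)]
    intro j
    have := abs_sub_le_of_abs_pd_le (g := pd (stdVec i) (pd (stdVec j) V))
      (pd_contDiff (pd_contDiff hV _) _) (convex_closedBall (0 : En n) 1)
      (B := ρ * (8 * (n : ℝ) ^ 6 * B)) (by positivity)
      (fun k z hz => hb3 z (by simpa using hz) k i j) (x := y) (x' := 0) (by simpa using hy)
      (by simp)
    have h0 : pd (stdVec i) (pd (stdVec j) V) 0 = 0 := congrFun (congrFun hhes0 i) j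
    rw [h0, sub_zero, sub_zero] at this
    rw [Real.norm_eq_abs]
    calc |hes V y i j| ≤ n * (ρ * (8 * (n : ℝ) ^ 6 * B)) * ‖y‖ := this
      _ ≤ n * (ρ * (8 * (n : ℝ) ^ 6 * B)) * 1 := by gcongr
      _ = ρ * (8 * (n : ℝ) ^ 7 * B) := by ring
  have h4 : (1 : ℝ) ≤ 4 ^ n := one_le_pow₀ (by norm_num)
  have hcmp : ∀ m : ℕ, m ≤ 9 → ρ * (4 ^ n * 8 * (n : ℝ) ^ m * B) ≤ δ₀ := by
    intro m hm
    refine le_trans ?_ hρ2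
    rw [hK]
    gcongr
  have hcmp' : ∀ m : ℕ, m ≤ 9 → ρ * (8 * (n : ℝ) ^ m * B) ≤ δ₀ := by
    intro m hm
    refine le_trans ?_ (hcmp m hm)
    gcongr
    linarith
  have hbV := H V hV δ₀ hδ₀.le le_rfl (fun y hy =>
    ⟨(small_of_hes_small hV hV0 hV1 hhb hy).trans
      (le_trans (le_of_eq (by ring)) (hcmp' 9 le_rfl)), (hhb y hy).trans (hcmp' 7 (by norm_num))⟩)
    (fun y hy i j k => ?_)
  swap
  · have hD := detHes_contDiff hW
    have hxy := (hx _ (hLn y hy)).2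
    have hpL : ∀ a, pd a (fun y => detOne (hes V y)) =
        fun y => P * ρ * pd (T a) (detHes W) (x₀ + L y) := by
      intro a
      rw [hF, pd_const_mul (contDiff_comp_clm hD x₀ L), hLpd hD]
      funext y
      ring
    have hpL2 : ∀ a b, pd a (pd b (fun y => detOne (hes V y))) =
        fun y => P * ρ ^ 2 * pd (T a) (pd (T b) (detHes W)) (x₀ + L y) := by
      intro a b
      rw [hpL, pd_const_mul (contDiff_comp_clm (pd_contDiff hD _) x₀ L), hLpd (pd_contDiff hD _)]
      funext y
      ring
    have hpL3 : ∀ a b c, pd a (pd b (pd c (fun y => detOne (hes V y)))) =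
        fun y => P * ρ ^ 3 * pd (T a) (pd (T b) (pd (T c) (detHes W))) (x₀ + L y) := by
      intro a b c
      have hc2 := pd_contDiff (pd_contDiff hD (T c)) (T b)
      rw [hpL2, pd_const_mul (contDiff_comp_clm hc2 x₀ L), hLpd hc2]
      funext y
      ring
    refine ⟨?_, ?_, ?_⟩
    · rw [hpL, abs_mul, abs_mul, abs_of_nonneg hP0, abs_of_pos hρ0]
      refine le_trans ?_ (hcmp 2 (by norm_num))
      calc P * ρ * |pd (T (stdVec i)) (detHes W) (x₀ + L y)|
          ≤ 4 ^ n * ρ * (n * B * (2 * n)) := by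
            gcongr
            exact (abs_pd_le_of_basis _ fun i => (hxy i i i).1).trans
              (by gcongr; exact hTe _)
        _ ≤ ρ * (4 ^ n * 8 * (n : ℝ) ^ 2 * B) := by
            have : 0 ≤ 4 ^ n * ρ * (n : ℝ) ^ 2 * B := by positivity
            linarith
    · rw [hpL2, abs_mul, abs_mul, abs_of_nonneg hP0, abs_of_pos (by positivity)]
      refine le_trans ?_ (hcmp 4 (by norm_num))
      calc P * ρ ^ 2 * |pd (T (stdVec i)) (pd (T (stdVec j)) (detHes W)) (x₀ + L y)|
          ≤ 4 ^ n * ρ ^ 1 * ((n : ℝ) ^ 2 * B * ((2 * n) * (2 * n))) := by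
            refine mul_le_mul (mul_le_mul hP (pow_le_pow_of_le_one hρ0.le hρ1' (by norm_num))
              (by positivity) (by positivity)) ?_ (abs_nonneg _) (by positivity)
            exact (abs_pd_pd_le_of_basis hD hB (fun i j => (hxy i j i).2.1) _ _).trans
              (by gcongr <;> exact hTe _)
        _ ≤ ρ * (4 ^ n * 8 * (n : ℝ) ^ 4 * B) := by
            have : 0 ≤ 4 ^ n * ρ * (n : ℝ) ^ 4 * B := by positivity
            linarith
    · rw [hpL3, abs_mul, abs_mul, abs_of_nonneg hP0, abs_of_pos (by positivity)]
      refine le_trans ?_ (hcmp 6 (by norm_num))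
      calc P * ρ ^ 3 * |pd (T (stdVec i)) (pd (T (stdVec j)) (pd (T (stdVec k)) (detHes W)))
            (x₀ + L y)|
          ≤ 4 ^ n * ρ ^ 1 * ((n : ℝ) ^ 3 * B * ((2 * n) * (2 * n) * (2 * n))) := by
            refine mul_le_mul (mul_le_mul hP (pow_le_pow_of_le_one hρ0.le hρ1' (by norm_num))
              (by positivity) (by positivity)) ?_ (abs_nonneg _) (by positivity)
            exact (abs_pd_pd_pd_le_of_basis hD hB (fun i j k => (hxy i j k).2.2) _ _ _).trans
              (by gcongr <;> exact hTe _)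
        _ = ρ * (4 ^ n * 8 * (n : ℝ) ^ 6 * B) := by ring
  obtain ⟨z, hz, hzn⟩ := hTs (ρ⁻¹ • (x - x₀))
  rw [norm_smul, Real.norm_of_nonneg (by positivity), ← mul_assoc] at hzn
  have hLz : x₀ + L z = x := by
    rw [hLy, hz, smul_smul, mul_inv_cancel₀ hρ0.ne', one_smul]
    abel
  have hz8 : ‖z‖ ≤ 1 / 8 := by
    calc ‖z‖ ≤ 2 * n * ρ⁻¹ * (ρ / (16 * n)) := hzn.trans (by gcongr)
      _ = 1 / 8 := by field_simp; norm_num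
  have hstd : ∀ i j k l, |pd (stdVec i) (pd (stdVec j) (pd (stdVec k) (pd (stdVec l) V))) z -
      pd (stdVec i) (pd (stdVec j) (pd (stdVec k) (pd (stdVec l) V))) 0| ≤ C * δ₀ * ‖z‖ ^ α := by
    intro i j k l
    have h1 := ((hbV.2 l).2 k).2 z 0 (by simpa using hz8) (by simp)
    rw [sub_zero] at h1
    refine le_trans ?_ h1
    have h2 := (norm_le_pi_norm _ j).trans (norm_le_pi_norm
      (hes (pd (stdVec k) (pd (stdVec l) V)) z - hes (pd (stdVec k) (pd (stdVec l) V)) 0) i)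
    exact h2
  have hC0 : 0 ≤ C * δ₀ * ‖z‖ ^ α := by positivity
  rw [pi_norm_le_iff_of_nonneg (by positivity)]
  intro p
  rw [pi_norm_le_iff_of_nonneg (by positivity)]
  intro q
  rw [Real.norm_eq_abs]
  change |pd (stdVec p) (pd (stdVec q) (pd (stdVec i) (pd (stdVec j) W))) x -
    pd (stdVec p) (pd (stdVec q) (pd (stdVec i) (pd (stdVec j) W))) x₀| ≤ _
  have hpre : ∀ i : Fin n, ∃ a, T a = stdVec i ∧ ‖a‖ ≤ 2 * n := fun i => by
    simpa [norm_stdVec] using hTs (stdVec i)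
  obtain ⟨a, ha, han⟩ := hpre p
  obtain ⟨b, hb, hbn⟩ := hpre q
  obtain ⟨c, hc, hcn⟩ := hpre i
  obtain ⟨e, he, hen⟩ := hpre j
  have hfin := abs_pd_pd_pd_pd_sub_le_of_basis hV hC0 hstd a b c e
  simp only [hVW4] at hfin
  rw [ha, hb, hc, he, hLz, map_zero, add_zero, ← mul_sub, abs_mul,
    abs_of_pos (by positivity)] at hfin
  set Q := |pd (stdVec p) (pd (stdVec q) (pd (stdVec i) (pd (stdVec j) W))) x -
    pd (stdVec p) (pd (stdVec q) (pd (stdVec i) (pd (stdVec j) W))) x₀|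
  have hzα : ‖z‖ ^ α ≤ (2 * n * ρ⁻¹) ^ α * ‖x - x₀‖ ^ α := by
    rw [← Real.mul_rpow (by positivity) (norm_nonneg _)]
    exact Real.rpow_le_rpow (norm_nonneg _) hzn hα.le
  have h5 : ρ ^ 2 * Q ≤ n ^ 4 * (C * δ₀ * ((2 * n * ρ⁻¹) ^ α * ‖x - x₀‖ ^ α)) *
      ((2 * n) * (2 * n) * (2 * n) * (2 * n)) := by
    refine hfin.trans ?_
    gcongr
  calc Q = (ρ ^ 2)⁻¹ * (ρ ^ 2 * Q) := by field_simp
    _ ≤ (ρ ^ 2)⁻¹ * (n ^ 4 * (C * δ₀ * ((2 * n * ρ⁻¹) ^ α * ‖x - x₀‖ ^ α)) *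
      ((2 * n) * (2 * n) * (2 * n) * (2 * n))) := by gcongr
    _ = _ := by ring

theorem ExtDecay.exists_holder {n : ℕ} (hn : 0 < n) {ε c : ℝ} (ρ : ℝ) (hε : 0 < ε)
    (hε2 : 2 * ε < 1) (hc : 0 < c) :
    ∃ R, 1 ≤ R ∧ ρ ≤ R ∧ (∃ C > 0, ∀ W : En n → ℝ, ExtDecay W ε c ρ → ∀ x, R ≤ ‖x‖ →
      |W x| ≤ C * ‖x‖ ^ (2 - 2 * ε) ∧
      (∀ i, ‖x‖ * |pd (stdVec i) W x| ≤ C * ‖x‖ ^ (2 - 2 * ε)) ∧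
      ‖hes W x‖ ≤ C * ‖x‖ ^ (-(2 * ε)) ∧
      (∀ i, ‖x‖ * ‖hes (pd (stdVec i) W) x‖ ≤ C * ‖x‖ ^ (-(2 * ε))) ∧
      ∀ i j, ‖x‖ ^ 2 * ‖hes (pd (stdVec i) (pd (stdVec j) W)) x‖ ≤ C * ‖x‖ ^ (-(2 * ε))) ∧
      ∀ α, 0 < α → α < 1 → ∃ C > 0, ∀ W : En n → ℝ, ExtDecay W ε c ρ → ∀ y₁ y₂,
        2 * R ≤ ‖y₁‖ → ‖y₂ - y₁‖ < ‖y₁‖ / 2 → ∀ i j,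
          ‖hes (pd (stdVec i) (pd (stdVec j) W)) y₁ - hes (pd (stdVec i) (pd (stdVec j) W)) y₂‖
            ≤ C * (‖y₁‖ ^ (-2 - 2 * ε - α) * ‖y₁ - y₂‖ ^ α) := by
  have hn' : (1 : ℝ) ≤ n := by exact_mod_cast hn
  obtain ⟨Rf, hRf1, hRfρ, C₀, hC₀, hf⟩ := ExtDecay.exists_full_decay hn ρ hε hε2 hc
  obtain ⟨Rs, hRs1, hRsρ, hs⟩ := ExtDecay.exists_hes_small hn ρ hε hc
    (μ := 1 / (2 * (n : ℝ) ^ 2)) (by positivity)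
  set R := max Rf Rs with hR
  have hRf : Rf ≤ R := le_max_left _ _
  have hRs : Rs ≤ R := le_max_right _ _
  have hR1 : 1 ≤ R := hRf1.trans hRf
  refine ⟨R, hR1, hRfρ.trans hRf, ⟨C₀, hC₀, fun W hW x hx => hf W hW x (hRf.trans hx)⟩,
    fun α hα hα1 => ?_⟩
  obtain ⟨Rd, hRd1, -, -, C₂, hC₂, hd⟩ := ExtDecay.exists_decay hn hα hα1 (ε := ε) ρ hε hc
    (θ := 2 * ε) Rf (by positivity) hε2.le hC₀
  obtain ⟨τ, hτ, C₃, hC₃, hl⟩ := local_holder hn hα hα1 (B := max C₀ c) (hc.le.trans (le_max_right _ _))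
  set D := 144 * C₀ + C₂ + C₃ * Rd ^ (2 + 2 * ε + α) + 9 * C₀ * (Rd / τ) ^ α with hD
  have hRd0 : 0 < Rd := by linarith
  have hD1 : 0 ≤ C₃ * Rd ^ (2 + 2 * ε + α) := by positivity
  have hD2 : 0 ≤ 9 * C₀ * (Rd / τ) ^ α := by positivity
  refine ⟨D, by positivity, fun W hW y₁ y₂ hy hyy i j => ?_⟩
  set r := ‖y₁‖ with hr
  set d := ‖y₁ - y₂‖ with hdd
  have hr0 : 0 < r := by linarith
  have hd0 : 0 ≤ d := norm_nonneg _
  have hy2 : r / 2 ≤ ‖y₂‖ := by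
    have := norm_sub_norm_le y₁ y₂
    rw [norm_sub_rev] at this
    linarith
  set H := hes (pd (stdVec i) (pd (stdVec j) W)) with hH
  set q := r ^ (-2 - 2 * ε - α) with hq
  have hq0 : 0 < q := by positivity
  have hqd : 0 ≤ q * d ^ α := by positivity
  have hqr : r ^ (-(2 * ε)) = r ^ 2 * (q * r ^ α) := by
    rw [hq, ← Real.rpow_add hr0, ← Real.rpow_natCast, ← Real.rpow_add hr0]
    congr 1
    push_cast
    ring
  have hdiv : ∀ s, 0 < s → (d / s) ^ α = d ^ α / s ^ α := fun s hs => Real.div_rpow hd0 hs.le α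
  have hsup1 : ‖H y₁‖ ≤ C₀ * (q * r ^ α) := by
    have h1 := (hf W hW y₁ (by linarith)).2.2.2.2 i j
    rw [← hr, hqr] at h1
    have hr2 : 0 < r ^ 2 := by positivity
    refine le_of_mul_le_mul_left ?_ hr2
    linarith
  have hsup2 : ‖H y₂‖ ≤ 8 * (C₀ * (q * r ^ α)) := by
    have h1 := (hf W hW y₂ (by linarith)).2.2.2.2 i j
    have h2 : ‖y₂‖ ^ (-(2 * ε)) ≤ 2 * r ^ (-(2 * ε)) := by
      calc ‖y₂‖ ^ (-(2 * ε)) ≤ (r / 2) ^ (-(2 * ε)) :=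
            Real.rpow_le_rpow_of_nonpos (by positivity) hy2 (by linarith)
        _ = 2 ^ (2 * ε) * r ^ (-(2 * ε)) := by
            rw [Real.div_rpow hr0.le (by norm_num), Real.rpow_neg (by norm_num : (0 : ℝ) ≤ 2)]
            field_simp
        _ ≤ 2 ^ (1 : ℝ) * r ^ (-(2 * ε)) := by
            gcongr
            norm_num
        _ = 2 * r ^ (-(2 * ε)) := by norm_num
    have h3 : (r / 2) ^ 2 ≤ ‖y₂‖ ^ 2 := by gcongr
    have h4 : (r / 2) ^ 2 * ‖H y₂‖ ≤ C₀ * (2 * (r ^ 2 * (q * r ^ α))) := by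
      rw [← hqr]
      calc (r / 2) ^ 2 * ‖H y₂‖ ≤ ‖y₂‖ ^ 2 * ‖H y₂‖ := by gcongr
        _ ≤ C₀ * ‖y₂‖ ^ (-(2 * ε)) := h1
        _ ≤ _ := by gcongr
    have hr2 : 0 < r ^ 2 := by positivity
    refine le_of_mul_le_mul_left ?_ hr2
    linarith
  have hsup : ‖H y₁ - H y₂‖ ≤ 9 * C₀ * (q * r ^ α) := (norm_sub_le _ _).trans (by linarith)
  have hfinish : ∀ E, E ≤ D → ‖H y₁ - H y₂‖ ≤ E * (q * d ^ α) →
      ‖H y₁ - H y₂‖ ≤ D * (q * d ^ α) := fun E hE h =>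
    h.trans (mul_le_mul_of_nonneg_right hE hqd)
  rcases lt_or_ge (r / 16) d with hfar | hnear
  · refine hfinish (144 * C₀) (by linarith) ?_
    have h1 : r ^ α ≤ 16 * d ^ α := by
      calc r ^ α ≤ (16 * d) ^ α := Real.rpow_le_rpow hr0.le (by linarith) hα.le
        _ = 16 ^ α * d ^ α := Real.mul_rpow (by norm_num) hd0
        _ ≤ 16 ^ (1 : ℝ) * d ^ α := by
            gcongr
            norm_num
        _ = 16 * d ^ α := by norm_num
    calc ‖H y₁ - H y₂‖ ≤ 9 * C₀ * (q * r ^ α) := hsup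
      _ ≤ 9 * C₀ * (q * (16 * d ^ α)) := by gcongr
      _ = 144 * C₀ * (q * d ^ α) := by ring
  rcases le_or_gt Rd r with hbig | hsmall
  · refine hfinish C₂ (by linarith) ?_
    have h1 := ((hd W hW (fun x hx => (hf W hW x hx).1) y₁ hbig).2.2 i j).2 y₂
      (by rw [norm_sub_rev]; exact hnear)
    rw [← hr, ← hdd, ← hH, hqr, hdiv r hr0] at h1
    have hr2 : 0 < r ^ 2 := by positivity
    refine le_of_mul_le_mul_left (h1.trans (le_of_eq ?_)) hr2
    field_simp
  · rcases le_or_gt d τ with hdτ | hdτ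
    · refine hfinish (C₃ * Rd ^ (2 + 2 * ε + α)) (by linarith) ?_
      have h1 := hl W hW.smooth y₁ (hs W hW y₁ (by linarith)).1 (fun x hx => ?_) y₂
        (by rw [norm_sub_rev]; exact hdτ) i j
      · rw [norm_sub_rev, norm_sub_rev y₂, ← hdd] at h1
        have h2 : 1 ≤ Rd ^ (2 + 2 * ε + α) * q := by
          calc (1 : ℝ) = r ^ (2 + 2 * ε + α) * q := by
                rw [hq, ← Real.rpow_add hr0]
                ring_nf
                exact (Real.rpow_zero _).symm
            _ ≤ Rd ^ (2 + 2 * ε + α) * q := by gcongr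
        calc ‖H y₁ - H y₂‖ ≤ C₃ * d ^ α * 1 := by rw [mul_one]; exact h1
          _ ≤ C₃ * d ^ α * (Rd ^ (2 + 2 * ε + α) * q) := by gcongr
          _ = _ := by ring
      · have hxR : R ≤ ‖x‖ := by
          have := norm_sub_norm_le y₁ x
          rw [norm_sub_rev] at this
          linarith
        have hx1 : 1 ≤ ‖x‖ := hR1.trans hxR
        have hxρ : ρ ≤ ‖x‖ := (hRfρ.trans hRf).trans hxR
        have key : ∀ (k : ℕ) (t b : ℝ), ‖x‖ ^ k * |t| ≤ b → |t| ≤ b := fun k t b h =>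
          (le_mul_of_one_le_left (abs_nonneg t) (one_le_pow₀ hx1)).trans h
        refine ⟨fun k => ?_, fun k l m => ⟨?_, ?_, ?_⟩⟩
        · refine le_trans ?_ (le_max_left _ _)
          have h3 := (hf W hW x (hRf.trans hxR)).2.2.2.1 k
          have h4 : ‖x‖ ^ (-(2 * ε)) ≤ 1 := Real.rpow_le_one_of_one_le_of_nonpos hx1 (by linarith)
          have h5 := le_mul_of_one_le_left (norm_nonneg (hes (pd (stdVec k) W) x)) hx1
          nlinarith
        · exact (key 2 _ _ (hW.det_deriv x _ hxρ (norm_stdVec k))).trans (le_max_right _ _)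
        · exact (key 3 _ _ (hW.det_deriv₂ x _ _ hxρ (norm_stdVec k) (norm_stdVec l))).trans
            (le_max_right _ _)
        · exact (key 4 _ _ (hW.det_deriv₃ x _ _ _ hxρ (norm_stdVec k) (norm_stdVec l)
            (norm_stdVec m))).trans (le_max_right _ _)
    · refine hfinish (9 * C₀ * (Rd / τ) ^ α) (by linarith) ?_
      have h1 : r ^ α ≤ (Rd / τ) ^ α * d ^ α := by
        rw [← Real.mul_rpow (by positivity) hd0]
        refine Real.rpow_le_rpow hr0.le ?_ hα.le
        rw [div_mul_eq_mul_div, le_div_iff₀ hτ]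
        nlinarith
      calc ‖H y₁ - H y₂‖ ≤ 9 * C₀ * (q * r ^ α) := hsup
        _ ≤ 9 * C₀ * (q * ((Rd / τ) ^ α * d ^ α)) := by gcongr
        _ = 9 * C₀ * (Rd / τ) ^ α * (q * d ^ α) := by ring

theorem exists_smooth_extension {n : ℕ} {w : En n → ℝ} {R₀ : ℝ} (hR₀ : 0 < R₀)
    (hw : ContDiffOn ℝ ∞ w {x | R₀ < ‖x‖}) :
    ∃ W : En n → ℝ, ContDiff ℝ ∞ W ∧ ∀ x, R₀ + 1 < ‖x‖ → W =ᶠ[nhds x] w := by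
  obtain ⟨χ, hχ, -, hχ0, hχ1⟩ := exists_cutoff n (r := R₀ + 1 / 2) (R := R₀ + 1) (by linarith)
    (by linarith)
  refine ⟨fun x => χ x * w x, ?_, fun x hx => ?_⟩
  · rw [contDiff_iff_contDiffAt]
    intro x
    rcases lt_or_ge ‖x‖ (R₀ + 1 / 2) with hx | hx
    · refine (contDiffAt_const (c := (0 : ℝ))).congr_of_eventuallyEq ?_
      filter_upwards [(isOpen_lt continuous_norm continuous_const).mem_nhds hx] with y hy
      rw [hχ0 y (le_of_lt hy), zero_mul]
    · refine hχ.contDiffAt.mul (hw.contDiffAt ?_)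
      exact (isOpen_lt continuous_const continuous_norm).mem_nhds
        (show R₀ < ‖x‖ by linarith)
  · filter_upwards [(isOpen_lt continuous_const continuous_norm).mem_nhds hx] with y hy
    rw [hχ1 y (le_of_lt hy), one_mul]

theorem Hess_eq_one_add_hes {n : ℕ} {W v : En n → ℝ} (hW : ContDiff ℝ ∞ W) {x : En n}
    (h : W =ᶠ[nhds x] fun z => v z - ‖z‖ ^ 2 / 2) : Hess v x = 1 + Matrix.of (hes W x) := by
  obtain ⟨hq, hqd⟩ := pd_pd_diag_quadratic (n := n) fun _ => 1
  have hv : v =ᶠ[nhds x] fun y => W y + ∑ k, 1 / 2 * (y k * y k) := by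
    filter_upwards [h] with y hy
    rw [hy, EuclideanSpace.real_norm_sq_eq, Finset.sum_div]
    have : ∑ k, y k ^ 2 / 2 = ∑ k, 1 / 2 * (y k * y k) :=
      Finset.sum_congr rfl fun k _ => by ring
    rw [this]
    ring
  ext i j
  rw [Hess, Matrix.of_apply, (hv.iteratedFDeriv ℝ 2).eq_of_nhds,
    iteratedFDeriv_apply_eq_pds (hW.add hq)]
  have : pds (List.ofFn ![EuclideanSpace.single i 1, EuclideanSpace.single j 1])
      (fun y => W y + ∑ k, 1 / 2 * (y k * y k)) x =
      pd (stdVec i) (pd (stdVec j) fun y => W y + ∑ k, 1 / 2 * (y k * y k)) x := by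
    simp [List.ofFn_succ, pds]
  rw [this, pd_add hW hq, pd_add (pd_contDiff hW _) (pd_contDiff hq _), hqd]
  simp only [one_mul, Matrix.add_apply, Matrix.of_apply, hes, Matrix.one_apply]
  rw [add_comm]
  congr 1
  simp only [PiLp.single_apply]
  split_ifs with hij <;> simp [hij, eq_comm]

theorem semiconvex_of_posSemidef {n : ℕ} {W : En n → ℝ} (hW : ContDiff ℝ ∞ W) {x a : En n}
    (h : (1 + Matrix.of (hes W x)).PosSemidef) (ha : ‖a‖ = 1) : 0 ≤ 1 + pd a (pd a W) x := by
  have h1 := h.dotProduct_mulVec_nonneg (fun i => a i)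
  have h2 : ∑ i, a i * a i = 1 := by
    have := EuclideanSpace.real_norm_sq_eq a
    rw [ha] at this
    simpa [sq] using this.symm
  rw [pd_pd_eq_sum hW, ← h2]
  refine h1.trans (le_of_eq ?_)
  rw [Matrix.add_mulVec, Matrix.one_mulVec, dotProduct_add]
  congr 1
  simp only [dotProduct, Matrix.mulVec, Matrix.of_apply, Finset.mul_sum, Pi.star_apply,
    star_trivial]
  exact Finset.sum_congr rfl fun i _ => Finset.sum_congr rfl fun j _ => by ring

theorem abs_pds_le_norm {n k : ℕ} {h : En n → ℝ} (hh : ContDiff ℝ ∞ h) (m : Fin k → En n)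
    (hm : ∀ j, ‖m j‖ = 1) (x : En n) : |pds (List.ofFn m) h x| ≤ ‖iteratedFDeriv ℝ k h x‖ := by
  rw [← iteratedFDeriv_apply_eq_pds hh, ← Real.norm_eq_abs]
  refine ((iteratedFDeriv ℝ k h x).le_opNorm m).trans (le_of_eq ?_)
  simp [hm]

theorem ExtHyp.exists_extDecay {n : ℕ} {R₀ c₀ c₁ β ε : ℝ} (hR₀ : 0 < R₀) (hc₀ : 1 ≤ c₀)
    (hβ : 2 < β) {fv v : En n → ℝ} (H : ExtHyp n R₀ c₀ c₁ β ε fv v) :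
    ∃ W : En n → ℝ, ExtDecay W ε (max c₀ c₁) (R₀ + 2) ∧
      ∀ x, R₀ + 1 < ‖x‖ → W =ᶠ[nhds x] fun z => v z - ‖z‖ ^ 2 / 2 := by
  obtain ⟨-, -, hfd, hvs, hH, hg⟩ := H
  obtain ⟨W, hW, hWv⟩ := exists_smooth_extension hR₀
    (w := fun z => v z - ‖z‖ ^ 2 / 2) (hvs.sub
      ((contDiff_norm_sq ℝ).div_const 2).contDiffOn)
  have hc : c₀ ≤ max c₀ c₁ := le_max_left _ _
  have hD := detHes_contDiff hW
  have hF : ∀ y, R₀ + 1 < ‖y‖ → detHes W y = fv y := by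
    intro y hy
    rw [← (hH y (by linarith)).2, Hess_eq_one_add_hes hW (hWv y hy)]
    rfl
  have hder : ∀ k ≤ 3, ∀ x, R₀ + 2 ≤ ‖x‖ →
      ‖x‖ ^ (k + 1) * ‖iteratedFDeriv ℝ k (fun y => detHes W y - 1) x‖ ≤ max c₀ c₁ := by
    intro k hk x hx
    have hx1 : 1 ≤ ‖x‖ := by linarith
    have hx0 : 0 < ‖x‖ := by linarith
    have he : (fun y => detHes W y - 1) =ᶠ[nhds x] fun y => fv y - 1 := by
      filter_upwards [(isOpen_lt continuous_const continuous_norm).mem_nhds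
        (show R₀ + 1 < ‖x‖ by linarith)] with y hy
      rw [hF y hy]
    rw [(he.iteratedFDeriv ℝ k).eq_of_nhds]
    refine le_trans ?_ hc
    have h1 : ‖x‖ ^ (-β - (k : ℝ)) ≤ (‖x‖ ^ (k + 1))⁻¹ := by
      rw [← Real.rpow_natCast, ← Real.rpow_neg hx0.le]
      refine Real.rpow_le_rpow_of_exponent_le hx1 ?_
      push_cast
      linarith
    calc ‖x‖ ^ (k + 1) * ‖iteratedFDeriv ℝ k (fun y => fv y - 1) x‖
        ≤ ‖x‖ ^ (k + 1) * (c₀ * (‖x‖ ^ (k + 1))⁻¹) := by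
          gcongr
          exact (hfd k hk x (by linarith)).trans (by gcongr)
      _ = c₀ := by field_simp
  have hpds : ∀ k ≤ 3, ∀ x, R₀ + 2 ≤ ‖x‖ → ∀ m : Fin k → En n, (∀ j, ‖m j‖ = 1) →
      ‖x‖ ^ (k + 1) * |pds (List.ofFn m) (fun y => detHes W y - 1) x| ≤ max c₀ c₁ := by
    intro k hk x hx m hm
    refine le_trans ?_ (hder k hk x hx)
    gcongr
    exact abs_pds_le_norm (hD.sub contDiff_const) m hm x
  refine ⟨W, ⟨hW, fun x hx => ?_, fun x a hx ha => ?_, fun x hx => ?_, fun x a hx ha => ?_,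
    fun x a b hx ha hb => ?_, fun x a b d hx ha hb hd => ?_⟩, hWv⟩
  · rw [(hWv x (by linarith)).eq_of_nhds]
    exact (hg x (by linarith)).trans (by gcongr; exact le_max_right _ _)
  · refine semiconvex_of_posSemidef hW ?_ ha
    rw [← Hess_eq_one_add_hes hW (hWv x (by linarith))]
    exact (hH x (by linarith)).1
  · simpa [pds] using hpds 0 (by norm_num) x hx ![] (fun j => j.elim0)
  · simpa [List.ofFn_succ, pds, pd_sub_const] using hpds 1 (by norm_num) x hx ![a] (by simpa using ha)
  · simpa [List.ofFn_succ, pds, pd_sub_const] using hpds 2 (by norm_num) x hx ![a, b]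
      (by simpa [Fin.forall_fin_succ] using ⟨ha, hb⟩)
  · simpa [List.ofFn_succ, pds, pd_sub_const] using hpds 3 le_rfl x hx ![a, b, d]
      (by simpa [Fin.forall_fin_succ] using ⟨ha, hb, hd⟩)

theorem exists_decay_estimates {n : ℕ} (hn : 0 < n) {R₀ c₀ c₁ β ε : ℝ} (hR₀ : 0 < R₀)
    (hc₀ : 1 ≤ c₀) (hβ : 2 < β) (hε : 0 < ε) (hε' : 2 * ε < 1) :
    ∃ R₁ > R₀, ∀ κ ≤ 2 * ε, ∀ α ∈ Set.Ioo (0 : ℝ) 1, ∃ C > (0 : ℝ),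
      ∀ fv v : En n → ℝ, ExtHyp n R₀ c₀ c₁ β ε fv v →
        (∀ j : ℕ, j ≤ 4 → ∀ x : En n, 2 * R₁ < ‖x‖ →
          ‖iteratedFDeriv ℝ j (fun z => v z - ‖z‖ ^ 2 / 2) x‖ ≤
            C * ‖x‖ ^ ((2 : ℝ) - κ - (j : ℝ))) ∧
        (∀ y₁ y₂ : En n, 2 * R₁ < ‖y₁‖ → ‖y₂ - y₁‖ < ‖y₁‖ / 2 →
          ‖iteratedFDeriv ℝ 4 (fun z => v z - ‖z‖ ^ 2 / 2) y₁ -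
              iteratedFDeriv ℝ 4 (fun z => v z - ‖z‖ ^ 2 / 2) y₂‖ ≤
            C * ‖y₁‖ ^ (-(2 : ℝ) - κ - α) * ‖y₁ - y₂‖ ^ α) := by
  have hn' : (1 : ℝ) ≤ n := by exact_mod_cast hn
  have hc : 0 < max c₀ c₁ := lt_of_lt_of_le (by linarith) (le_max_left _ _)
  obtain ⟨R, hR1, hRρ, ⟨C, hC, hd⟩, hh⟩ := ExtDecay.exists_holder hn (R₀ + 2) hε hε' hc
  refine ⟨R, by linarith, fun κ hκ α hα => ?_⟩
  obtain ⟨C', hC', hh⟩ := hh α hα.1 hα.2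
  refine ⟨(n : ℝ) ^ 4 * (C + C'), by positivity, fun fv v H => ?_⟩
  obtain ⟨W, hW, hWv⟩ := H.exists_extDecay hR₀ hc₀ hβ
  have hWs := hW.smooth
  have hit : ∀ (j : ℕ) x, R₀ + 1 < ‖x‖ → iteratedFDeriv ℝ j (fun z => v z - ‖z‖ ^ 2 / 2) x =
      iteratedFDeriv ℝ j W x := fun j x hx => ((hWv x hx).iteratedFDeriv ℝ j).eq_of_nhds.symm
  have hexp : ∀ (x : En n) (k : ℕ) (t p : ℝ), 1 ≤ ‖x‖ → ‖x‖ ^ k * t ≤ C * ‖x‖ ^ p →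
      t ≤ C * ‖x‖ ^ (p - k) := by
    intro x k t p hx h
    have hx0 : 0 < ‖x‖ := by linarith
    rw [Real.rpow_sub hx0, Real.rpow_natCast, ← mul_div_assoc, le_div_iff₀ (by positivity)]
    linarith
  have hstd : ∀ (j : ℕ), j ≤ 4 → ∀ x : En n, R ≤ ‖x‖ → ∀ I : Fin j → Fin n,
      |pds (List.ofFn fun l => stdVec (I l)) W x| ≤ C * ‖x‖ ^ (2 - 2 * ε - (j : ℝ)) := by
    intro j hj x hx I
    have hx1 : 1 ≤ ‖x‖ := hR1.trans hx
    obtain ⟨d0, d1, d2, d3, d4⟩ := hd W hW x hx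
    interval_cases j
    · simpa [pds] using d0
    · have := hexp x 1 _ _ hx1 (by simpa using d1 (I 0))
      simpa [List.ofFn_succ, pds] using this
    · have h1 : ‖x‖ ^ (2 - 2 * ε - ((2 : ℕ) : ℝ)) = ‖x‖ ^ (-(2 * ε)) := by
        congr 1; push_cast; ring
      rw [h1]
      have := (abs_hes_le W x (I 0) (I 1)).trans d2
      simpa [List.ofFn_succ, pds] using this
    · have h1 : ‖x‖ ^ (2 - 2 * ε - ((3 : ℕ) : ℝ)) = ‖x‖ ^ (-(2 * ε) - ((1 : ℕ) : ℝ)) := by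
        congr 1; push_cast; ring
      rw [h1]
      have := (abs_hes_le (pd (stdVec (I 2)) W) x (I 0) (I 1)).trans
        (hexp x 1 _ _ hx1 (by simpa using d3 (I 2)))
      simpa [List.ofFn_succ, pds] using this
    · have h1 : ‖x‖ ^ (2 - 2 * ε - ((4 : ℕ) : ℝ)) = ‖x‖ ^ (-(2 * ε) - ((2 : ℕ) : ℝ)) := by
        congr 1; push_cast; ring
      rw [h1]
      have := (abs_hes_le (pd (stdVec (I 2)) (pd (stdVec (I 3)) W)) x (I 0) (I 1)).trans
        (hexp x 2 _ _ hx1 (d4 (I 2) (I 3)))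
      simpa [List.ofFn_succ, pds] using this
  refine ⟨fun j hj x hx => ?_, fun y₁ y₂ hy hyy => ?_⟩
  · have hx1 : 1 ≤ ‖x‖ := by linarith
    rw [hit j x (by linarith)]
    calc ‖iteratedFDeriv ℝ j W x‖ ≤ (n : ℝ) ^ j * (C * ‖x‖ ^ (2 - 2 * ε - (j : ℝ))) := by
          refine norm_multilinear_le_of_basis _ (by positivity) fun I => ?_
          rw [iteratedFDeriv_apply_eq_pds hWs]
          exact hstd j hj x (by linarith) I
      _ ≤ (n : ℝ) ^ 4 * ((C + C') * ‖x‖ ^ (2 - κ - (j : ℝ))) := by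
          gcongr
          linarith
      _ = _ := by ring
  · have hy1 : 1 ≤ ‖y₁‖ := by linarith
    have hy2 : R₀ + 1 < ‖y₂‖ := by
      have := norm_sub_norm_le y₁ y₂
      rw [norm_sub_rev] at this
      linarith
    rw [hit 4 y₁ (by linarith), hit 4 y₂ hy2]
    have hα0 : 0 ≤ ‖y₁ - y₂‖ ^ α := by positivity
    calc ‖iteratedFDeriv ℝ 4 W y₁ - iteratedFDeriv ℝ 4 W y₂‖
        ≤ (n : ℝ) ^ 4 * (C' * (‖y₁‖ ^ (-2 - 2 * ε - α) * ‖y₁ - y₂‖ ^ α)) := by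
          refine norm_multilinear_le_of_basis _ (by positivity) fun I => ?_
          rw [_root_.sub_apply, iteratedFDeriv_apply_eq_pds hWs, iteratedFDeriv_apply_eq_pds hWs]
          have h1 := (norm_le_pi_norm _ (I 1)).trans ((norm_le_pi_norm _ (I 0)).trans
            (hh W hW y₁ y₂ hy.le hyy (I 2) (I 3)))
          rw [Real.norm_eq_abs] at h1
          simpa [List.ofFn_succ, pds, hes] using h1
      _ ≤ (n : ℝ) ^ 4 * ((C + C') * (‖y₁‖ ^ (-2 - κ - α) * ‖y₁ - y₂‖ ^ α)) := by
          gcongr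
          linarith
      _ = _ := by ring

/-- Lemma 2.3: improved decay estimates for `w = v - |x|²/2` when `2ε < 1`; the decay exponent
doubles for `n ≥ 3`, and for `n = 2` one gets any rate `ε̄ < 2ε`. -/
theorem lemma_improved_decay
    (n : ℕ) (hn : 2 ≤ n) (R₀ c₀ c₁ β ε : ℝ)
    (hR₀ : 0 < R₀) (hc₀ : 1 ≤ c₀) (hc₁ : 0 < c₁) (hβ : 2 < β)
    (hε : 0 < ε) (hε' : 2 * ε < 1) :
    ∃ R₁ > R₀,
      (3 ≤ n → ∀ α ∈ Set.Ioo (0 : ℝ) 1, ∃ C > (0 : ℝ),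
        ∀ fv v : En n → ℝ, ExtHyp n R₀ c₀ c₁ β ε fv v →
          (∀ j : ℕ, j ≤ 4 → ∀ x : En n, 2 * R₁ < ‖x‖ →
            ‖iteratedFDeriv ℝ j (fun z => v z - ‖z‖ ^ 2 / 2) x‖ ≤
              C * ‖x‖ ^ ((2 : ℝ) - 2 * ε - (j : ℝ))) ∧
          (∀ y₁ y₂ : En n, 2 * R₁ < ‖y₁‖ → ‖y₂ - y₁‖ < ‖y₁‖ / 2 →
            ‖iteratedFDeriv ℝ 4 (fun z => v z - ‖z‖ ^ 2 / 2) y₁ -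
                iteratedFDeriv ℝ 4 (fun z => v z - ‖z‖ ^ 2 / 2) y₂‖ ≤
              C * ‖y₁‖ ^ (-(2 : ℝ) - 2 * ε - α) * ‖y₁ - y₂‖ ^ α)) ∧
      (n = 2 → ∀ εb : ℝ, 0 < εb → εb < 2 * ε → ∀ α ∈ Set.Ioo (0 : ℝ) 1, ∃ C > (0 : ℝ),
        ∀ fv v : En n → ℝ, ExtHyp n R₀ c₀ c₁ β ε fv v →
          (∀ j : ℕ, j ≤ 4 → ∀ x : En n, 2 * R₁ < ‖x‖ →
            ‖iteratedFDeriv ℝ j (fun z => v z - ‖z‖ ^ 2 / 2) x‖ ≤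
              C * ‖x‖ ^ ((2 : ℝ) - εb - (j : ℝ))) ∧
          (∀ y₁ y₂ : En n, 2 * R₁ < ‖y₁‖ → ‖y₂ - y₁‖ < ‖y₁‖ / 2 →
            ‖iteratedFDeriv ℝ 4 (fun z => v z - ‖z‖ ^ 2 / 2) y₁ -
                iteratedFDeriv ℝ 4 (fun z => v z - ‖z‖ ^ 2 / 2) y₂‖ ≤
              C * ‖y₁‖ ^ (-(2 : ℝ) - εb - α) * ‖y₁ - y₂‖ ^ α)) := by
  obtain ⟨R₁, hR₁, h⟩ := exists_decay_estimates (n := n) (c₁ := c₁) (by omega) hR₀ hc₀ hβ hε hε'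
  exact ⟨R₁, hR₁, fun _ => h _ le_rfl, fun _ εb _ hεb => h _ hεb.le⟩
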